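/- Let n, t, ℓ₁, …, ℓ_t be natural numbers with ℓ_i ≥ 3 for each i ∈ [t] and ℓ₁ + ⋯ + ℓ_t = n. For any strongly 10⁵⁰t-connected n-vertex tournament T and any t distinct vertices x₁, …, x_t of T, there exist pairwise vertex-disjoint directed cycles C₁, …, C_t in T such that for each i ∈ [t], x_i ∈ V(C_i) and |V(C_i)| = ℓ_i (so the cycles partition V(T)). -/

import Mathlib

/-- A digraph on the vertex type `V`, given by its adjacency (directed edge) relation. -/
structure Digr (V : Type) where
  Adj : V → V → Prop

namespace Digr

variable {V : Type}

/-- No loops. -/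
def Loopless (G : Digr V) : Prop := ∀ v, ¬ G.Adj v v

/-- A tournament: every pair of distinct vertices is joined by exactly one directed edge. -/
def IsTournament (G : Digr V) : Prop :=
  G.Loopless ∧ ∀ u v : V, u ≠ v → (G.Adj u v ↔ ¬ G.Adj v u)

/-- A semicomplete digraph: every pair of distinct vertices is joined by at least one
directed edge (edges in both directions are allowed). -/
def IsSemicomplete (G : Digr V) : Prop :=
  G.Loopless ∧ ∀ u v : V, u ≠ v → (G.Adj u v ∨ G.Adj v u)

/-- Out-neighbourhood `N⁺_G(v)`. -/
def outN (G : Digr V) (v : V) : Set V := {u | G.Adj v u}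

/-- In-neighbourhood `N⁻_G(v)`. -/
def inN (G : Digr V) (v : V) : Set V := {u | G.Adj u v}

/-- Union of two digraphs (on the same vertex type). -/
def union (G H : Digr V) : Digr V := ⟨fun a b => G.Adj a b ∨ H.Adj a b⟩

/-- `l` is a directed path of `G` lying inside the vertex set `A`, from `u` to `v`. -/
def IsPathOn (G : Digr V) (A : Set V) (u v : V) (l : List V) : Prop :=
  l.Nodup ∧ l.Chain' G.Adj ∧ (∀ x ∈ l, x ∈ A) ∧ l.head? = some u ∧ l.getLast? = some v

/-- There is a directed path of `G` inside `A` from `u` to `v`. -/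
def Reaches (G : Digr V) (A : Set V) (u v : V) : Prop :=
  ∃ l, G.IsPathOn A u v l

/-- The induced subdigraph of `G` on `W` is strongly `k`-connected: `|W| ≥ k + 1` and for
every ordered pair of distinct vertices of `W` and every `S ⊆ W ∖ {u,v}` with `|S| ≤ k - 1`
there is a directed path from `u` to `v` avoiding `S`. -/
def StronglyConnOn (G : Digr V) (W : Set V) (k : ℕ) : Prop :=
  k + 1 ≤ W.ncard ∧
  ∀ u ∈ W, ∀ v ∈ W, u ≠ v → ∀ S : Set V, S ⊆ W \ {u, v} → S.ncard < k →
    G.Reaches (W \ S) u v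

/-- Strong `c`-connectedness for a real parameter `c` (the condition on the removed set `S`
is `|S| ≤ c - 1`). -/
def StronglyConnOnR (G : Digr V) (W : Set V) (c : ℝ) : Prop :=
  c + 1 ≤ (W.ncard : ℝ) ∧
  ∀ u ∈ W, ∀ v ∈ W, u ≠ v → ∀ S : Set V, S ⊆ W \ {u, v} → (S.ncard : ℝ) ≤ c - 1 →
    G.Reaches (W \ S) u v

/-- `l` is a directed cycle of `G` (length at least 3) whose vertex set is `C`. -/
def IsCycleOn (G : Digr V) (C : Set V) (l : List V) : Prop :=
  3 ≤ l.length ∧ l.Nodup ∧ (∀ x, x ∈ l ↔ x ∈ C) ∧ l.Chain' G.Adj ∧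
  ∃ a b, l.getLast? = some a ∧ l.head? = some b ∧ G.Adj a b

/-- The pair `(v, U)` is `k`-connected in the induced subdigraph of `G` on `A`: after
deleting any `S ⊆ A ∖ {v}` with `|S| ≤ k - 1` there is a path from `v` to some vertex
of `U ∖ S` inside `A ∖ S`. -/
def VtxSetConn (G : Digr V) (A : Set V) (v : V) (U : Set V) (k : ℕ) : Prop :=
  ∀ S : Set V, S ⊆ A \ {v} → S.ncard < k → ∃ u ∈ U \ S, G.Reaches (A \ S) v u

/-- The pair `(U, v)` is `k`-connected in the induced subdigraph of `G` on `A`. -/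
def SetVtxConn (G : Digr V) (A : Set V) (U : Set V) (v : V) (k : ℕ) : Prop :=
  ∀ S : Set V, S ⊆ A \ {v} → S.ncard < k → ∃ u ∈ U \ S, G.Reaches (A \ S) u v

end Digr

open Digr

namespace CyclePartition

open scoped Classical

variable {V : Type*}

/-- Reachability of one vertex from another inside the vertex set `W`. -/
def Rch (r : V → V → Prop) (W : Finset V) : V → V → Prop :=
  Relation.ReflTransGen (fun a b => r a b ∧ a ∈ W ∧ b ∈ W)

/-- The subdigraph induced on `W` is strongly connected. -/
def Strong (r : V → V → Prop) (W : Finset V) : Prop := ∀ u ∈ W, ∀ v ∈ W, Rch r W u v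

/-- Deleting fewer than `k` vertices from `W` leaves a strongly connected digraph. -/
def KC (r : V → V → Prop) (W : Finset V) (k : ℕ) : Prop :=
  ∀ S : Finset V, S.card < k → Strong r (W \ S)

/-- The relation `r` is a tournament. -/
structure Tourn (r : V → V → Prop) : Prop where
  irrefl : ∀ a, ¬ r a a
  total : ∀ a b, a ≠ b → r a b ∨ r b a
  asymm : ∀ a b, r a b → ¬ r b a

/-- `C` is the vertex set of a directed cycle of length at least three. -/
def Cyc (r : V → V → Prop) (C : Finset V) : Prop :=
  ∃ (y : V) (l : List V), 2 ≤ l.length ∧ (y :: l).Nodup ∧ (∀ x, x ∈ y :: l ↔ x ∈ C) ∧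
    List.IsChain r (y :: (l ++ [y]))

variable {r : V → V → Prop} {W W' K L : Finset V} {a b c x y : V}

lemma Tourn.ne (hT : Tourn r) (h : r a b) : a ≠ b := by
  rintro rfl; exact hT.irrefl _ h

lemma Tourn.swap (hT : Tourn r) : Tourn (Function.swap r) where
  irrefl := hT.irrefl
  total a b h := hT.total b a h.symm
  asymm a b h := hT.asymm b a h

lemma Rch.refl (a : V) : Rch r W a a := Relation.ReflTransGen.refl

lemma Rch.trans (h : Rch r W a b) (h' : Rch r W b c) : Rch r W a c :=
  Relation.ReflTransGen.trans h h'

lemma Rch.single (h : r a b) (ha : a ∈ W) (hb : b ∈ W) : Rch r W a b :=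
  Relation.ReflTransGen.single ⟨h, ha, hb⟩

lemma Rch.mono (h : Rch r W a b) (hW : W ⊆ W') : Rch r W' a b :=
  Relation.ReflTransGen.mono (fun _ _ h => ⟨h.1, hW h.2.1, hW h.2.2⟩) _ _ h

lemma Rch.swap (h : Rch r W a b) : Rch (Function.swap r) W b a := by
  induction h with
  | refl => exact Relation.ReflTransGen.refl
  | tail _ h ih => exact Relation.ReflTransGen.head ⟨h.1, h.2.2, h.2.1⟩ ih

lemma Strong.swap (h : Strong r W) : Strong (Function.swap r) W :=
  fun u hu v hv => (h v hv u hu).swap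

lemma KC.swap {k : ℕ} (h : KC r W k) : KC (Function.swap r) W k :=
  fun S hS => (h S hS).swap

lemma KC.mono {k k' : ℕ} (h : KC r W k) (hk : k' ≤ k) : KC r W k' :=
  fun S hS => h S (by omega)

lemma KC.strong {k : ℕ} (h : KC r W k) (hk : 0 < k) : Strong r W := by
  have := h ∅ (by simpa using hk)
  simpa using this

lemma KC.sdiff {k m : ℕ} (h : KC r W k) {D : Finset V} (hD : D.card + m ≤ k) :
    KC r (W \ D) m := by
  intro S hS
  have := h (D ∪ S) (lt_of_le_of_lt (Finset.card_union_le _ _) (by omega))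
  rwa [sdiff_sdiff_left, Finset.sup_eq_union]

/-- A walk leaving a set uses an edge that leaves the set. -/
lemma Rch.exists_cross (h : Rch r W a b) (S : V → Prop) (ha : S a) (hb : ¬ S b) :
    ∃ u v, Rch r W a u ∧ S u ∧ ¬ S v ∧ r u v ∧ u ∈ W ∧ v ∈ W := by
  induction h with
  | refl => exact absurd ha hb
  | @tail u v h1 h2 ih =>
    by_cases hu : S u
    · exact ⟨u, v, h1, hu, hb, h2⟩
    · exact ih hu

lemma strong_of_hub (h : V) (hK : ∀ v ∈ K, Rch r K h v ∧ Rch r K v h) : Strong r K :=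
  fun u hu v hv => (hK u hu).2.trans (hK v hv).1

lemma strong_ear (hK : Strong r K) {E : Finset V}
    (h : ∀ v ∈ E, (∃ u ∈ K, Rch r (K ∪ E) u v) ∧ ∃ u ∈ K, Rch r (K ∪ E) v u) :
    Strong r (K ∪ E) := by
  have key : ∀ v ∈ K ∪ E, (∃ u ∈ K, Rch r (K ∪ E) u v) ∧ ∃ u ∈ K, Rch r (K ∪ E) v u := by
    intro v hv
    rcases Finset.mem_union.1 hv with hv | hv
    · exact ⟨⟨v, hv, Rch.refl v⟩, v, hv, Rch.refl v⟩
    · exact h v hv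
  intro u hu v hv
  obtain ⟨u', hu', h1⟩ := (key u hu).2
  obtain ⟨v', hv', h2⟩ := (key v hv).1
  exact h1.trans (((hK u' hu' v' hv').mono Finset.subset_union_left).trans h2)

lemma strong_attach (hK : Strong r K) {F : Finset V}
    (h : ∀ v ∈ F, (∃ u ∈ K, r u v) ∧ ∃ u ∈ K, r v u) : Strong r (K ∪ F) := by
  refine strong_ear hK fun v hv => ?_
  obtain ⟨⟨u, hu, h1⟩, w, hw, h2⟩ := h v hv
  exact ⟨⟨u, hu, .single h1 (Finset.mem_union_left _ hu) (Finset.mem_union_right _ hv)⟩,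
    w, hw, .single h2 (Finset.mem_union_right _ hv) (Finset.mem_union_left _ hw)⟩

lemma strong_singleton_union_biUnion {ι : Type*} (s : Finset ι) (f : ι → Finset V)
    (hK : Strong r K) (hf : ∀ i ∈ s, Strong r (f i)) (hc : ∀ i ∈ s, c ∈ f i) (hc' : c ∈ K) :
    Strong r (K ∪ s.biUnion f) := by
  refine strong_ear hK fun v hv => ?_
  obtain ⟨i, hi, hv⟩ := Finset.mem_biUnion.1 hv
  have hsub : f i ⊆ K ∪ s.biUnion f :=
    (Finset.subset_biUnion_of_mem f hi).trans Finset.subset_union_right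
  exact ⟨⟨c, hc', (hf i hi c (hc i hi) v hv).mono hsub⟩,
    c, hc', (hf i hi v hv c (hc i hi)).mono hsub⟩

lemma exists_insert_chain {v e : V} : ∀ (l : List V) (a : V), List.IsChain r (a :: (l ++ [e])) →
    r a v → (∃ z ∈ l ++ [e], r v z) → (∀ z ∈ l ++ [e], r v z ∨ r z v) →
    ∃ l' : List V, List.IsChain r (a :: (l' ++ [e])) ∧ l'.Perm (v :: l) := by
  intro l
  induction l with
  | nil =>
    intro a _ hav ⟨z, hz, hvz⟩ _
    refine ⟨[v], ?_, List.Perm.refl _⟩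
    simp at hz
    subst hz
    simp [hav, hvz]
  | cons b l ih =>
    intro a hch hav ⟨z, hz, hvz⟩ htot
    simp only [List.cons_append, List.isChain_cons_cons] at hch
    by_cases hvb : r v b
    · refine ⟨v :: b :: l, ?_, List.Perm.refl _⟩
      simp only [List.cons_append, List.isChain_cons_cons]
      exact ⟨hav, hvb, hch.2⟩
    · have hbv : r b v := (htot b (by simp)).resolve_left hvb
      have hz' : z ∈ l ++ [e] := by
        simp only [List.cons_append, List.mem_cons] at hz
        rcases hz with rfl | hz
        · exact absurd hvz hvb
        · exact hz
      obtain ⟨l', h1, h2⟩ := ih b hch.2 hbv ⟨z, hz', hvz⟩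
        (fun z hz => htot z (by simp only [List.cons_append, List.mem_cons]; exact Or.inr hz))
      refine ⟨b :: l', ?_, ?_⟩
      · simp only [List.cons_append, List.isChain_cons_cons]
        exact ⟨hch.1, h1⟩
      · exact (h2.cons b).trans (List.Perm.swap _ _ _)

lemma exists_insert_cycle (hT : Tourn r) {v : V} {l : List V}
    (hch : List.IsChain r (x :: (l ++ [x]))) (hv : v ∉ x :: l)
    (hin : ∃ z ∈ x :: l, r z v) (hout : ∃ z ∈ x :: l, r v z) :
    ∃ l' : List V, List.IsChain r (x :: (l' ++ [x])) ∧ l'.Perm (v :: l) := by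
  have hmem : ∀ z, z ∈ l ++ [x] ↔ z ∈ x :: l := by intro z; simp [or_comm]
  have hne : ∀ z ∈ x :: l, z ≠ v := by rintro z hz rfl; exact hv hz
  rcases hT.total x v (hne x (by simp)) with h | h
  · obtain ⟨z, hz, hz'⟩ := hout
    exact exists_insert_chain l x hch h ⟨z, (hmem z).2 hz, hz'⟩
      fun z hz => (hT.total v z (hne z ((hmem z).1 hz)).symm)
  · obtain ⟨z, hz, hz'⟩ := hin
    have hrev : List.IsChain (Function.swap r) (x :: (l.reverse ++ [x])) := by
      simpa using (List.isChain_reverse (R := Function.swap r) (l := x :: (l ++ [x]))).2 hch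
    obtain ⟨l', h1, h2⟩ := exists_insert_chain (r := Function.swap r) l.reverse x hrev h
      ⟨z, by simpa [or_comm] using hz, hz'⟩
      (fun z hz => (hT.total v z (hne z (by simpa [or_comm] using hz)).symm).symm)
    refine ⟨l'.reverse, ?_, ?_⟩
    · have := (List.isChain_reverse (R := r) (l := x :: (l' ++ [x]))).2 h1
      simpa using this
    · exact (List.reverse_perm _).trans (h2.trans ((List.reverse_perm _).cons v))

lemma exists_triangle (hT : Tourn r) (hW : Strong r W) (hx : x ∈ W) (hcard : 2 ≤ W.card) :
    ∃ u ∈ W, ∃ v ∈ W, r x u ∧ r u v ∧ r v x := by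
  obtain ⟨w, hw, hwx⟩ := Finset.exists_mem_ne (by omega : 1 < W.card) x
  obtain ⟨_, o, _, rfl, _, hxo, _, ho⟩ := (hW x hx w hw).exists_cross (fun z => z = x) rfl hwx
  obtain ⟨u, v, _, hu, hv, huv, huW, hvW⟩ :=
    (hW o ho _ hx).exists_cross (fun z => r _ z) hxo (hT.irrefl _)
  refine ⟨u, huW, v, hvW, hu, huv, (hT.total v _ ?_).resolve_right hv⟩
  rintro rfl
  exact hT.asymm _ _ huv hu

/-- Vertex pancyclicity of strong tournaments (Moon), for cycles given by lists. -/
lemma exists_cycle_list (hT : Tourn r) (hW : Strong r W) (hx : x ∈ W) (n : ℕ) (hn : 2 ≤ n)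
    (hcard : n + 1 ≤ W.card) :
    ∃ l : List V, l.length = n ∧ (x :: l).Nodup ∧ (∀ z ∈ x :: l, z ∈ W) ∧
      List.IsChain r (x :: (l ++ [x])) := by
  induction n, hn using Nat.le_induction with
  | base =>
    obtain ⟨u, hu, v, hv, h1, h2, h3⟩ := exists_triangle hT hW hx (by omega)
    refine ⟨[u, v], rfl, ?_, ?_, ?_⟩
    · simp [hT.ne h1, (hT.ne h3).symm, hT.ne h2]
    · simp [hx, hu, hv]
    · simp [h1, h2, h3]
  | succ n hn ih =>
    obtain ⟨l, hl, hnd, hlW, hch⟩ := ih (by omega)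
    by_cases hex : ∃ v ∈ W, v ∉ x :: l ∧ (∃ z ∈ x :: l, r z v) ∧ ∃ z ∈ x :: l, r v z
    · obtain ⟨v, hvW, hv, hin, hout⟩ := hex
      obtain ⟨l', h1, h2⟩ := exists_insert_cycle hT hch hv hin hout
      have hp : (x :: l').Perm (v :: x :: l) := (h2.cons x).trans (List.Perm.swap _ _ _)
      refine ⟨l', by rw [h2.length_eq]; simp [hl], ?_, ?_, h1⟩
      · rw [hp.nodup_iff]
        exact List.nodup_cons.2 ⟨hv, hnd⟩
      · intro z hz
        rcases List.mem_cons.1 (hp.mem_iff.1 hz) with rfl | hz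
        · exact hvW
        · exact hlW z hz
    · push Not at hex
      have hex' : ∃ w ∈ W, w ∉ x :: l := by
        by_contra hcon
        push Not at hcon
        have : W ⊆ (x :: l).toFinset := fun z hz => by simpa using hcon z hz
        have h2 := Finset.card_le_card this
        have h3 := List.toFinset_card_le (x :: l)
        simp only [List.length_cons] at h3
        omega
      obtain ⟨w, hwW, hw⟩ := hex'
      obtain ⟨c, o, _, hc, ho, hco, _, hoW⟩ :=
        (hW x hx w hwW).exists_cross (fun z => z ∈ x :: l) (by simp) hw
      obtain ⟨u, v, _, ⟨hu, hu'⟩, hv, huv, huW, hvW⟩ :=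
        (hW o hoW x hx).exists_cross (fun z => z ∉ x :: l ∧ ∃ c ∈ x :: l, r c z)
          ⟨ho, c, hc, hco⟩ (by simp)
      have hvl : v ∉ x :: l := fun hv' => hex u huW hu hu' v hv' huv
      have hv2 : ∀ c ∈ x :: l, r v c := by
        intro c hc
        have : ¬ r c v := fun h => hv ⟨hvl, c, hc, h⟩
        exact (hT.total v c (by rintro rfl; exact hvl hc)).resolve_right this
      have hu2 : ∀ c ∈ x :: l, r c u := by
        intro c hc
        exact (hT.total c u (by rintro rfl; exact hu hc)).resolve_right (hex u huW hu hu' c hc)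
      rcases List.eq_nil_or_concat l with rfl | ⟨l0, z, rfl⟩
      · simp at hl; omega
      · rw [List.concat_eq_append] at *
        have hsub : ∀ c, c ∈ x :: l0 → c ∈ x :: (l0 ++ [z]) := by
          intro c hc; simp at hc ⊢; tauto
        refine ⟨l0 ++ [u, v], by simp at hl ⊢; omega, ?_, ?_, ?_⟩
        · have h0 : (x :: l0).Nodup := by
            have : ((x :: l0) ++ [z]).Nodup := by simpa using hnd
            exact (List.nodup_append.1 this).1
          have : ((x :: l0) ++ [u, v]).Nodup := by
            refine List.nodup_append.2 ⟨h0, by simp [hT.ne huv], ?_⟩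
            intro c hc d hd hcd
            subst hcd
            simp only [List.mem_cons, List.not_mem_nil, or_false] at hd
            rcases hd with rfl | rfl
            · exact hu (hsub _ hc)
            · exact hvl (hsub _ hc)
          simpa using this
        · intro c hc
          have : c ∈ (x :: l0) ++ [u, v] := by simpa using hc
          rcases List.mem_append.1 this with h | h
          · exact hlW c (hsub c h)
          · simp at h
            rcases h with rfl | rfl <;> assumption
        · have h1 : List.IsChain r ((x :: l0) ++ [z, x]) := by simpa using hch
          have h2 := (List.isChain_append.1 h1).1
          have : List.IsChain r ((x :: l0) ++ [u, v, x]) := by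
            refine List.isChain_append.2 ⟨h2, ?_, ?_⟩
            · simp [huv, hv2 x (by simp)]
            · intro c hc d hd
              simp at hd
              subst hd
              exact hu2 c (hsub c (List.mem_of_mem_getLast? hc))
          simpa using this

/-- Vertex pancyclicity of strong tournaments. -/
lemma exists_cyc (hT : Tourn r) (hW : Strong r W) (hx : x ∈ W) {n : ℕ} (hn : 3 ≤ n)
    (hcard : n ≤ W.card) : ∃ C ⊆ W, x ∈ C ∧ C.card = n ∧ Cyc r C := by
  obtain ⟨l, h1, h2, h3, h4⟩ := exists_cycle_list hT hW hx (n - 1) (by omega) (by omega)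
  refine ⟨(x :: l).toFinset, ?_, by simp, ?_, x, l, by omega, h2, by simp, h4⟩
  · intro z hz
    exact h3 z (by simpa using hz)
  · rw [List.toFinset_card_of_nodup h2]
    simp; omega

lemma Strong.cyc (hT : Tourn r) (hW : Strong r W) (hcard : 3 ≤ W.card) : Cyc r W := by
  obtain ⟨x, hx⟩ : W.Nonempty := Finset.card_pos.1 (by omega)
  obtain ⟨C, h1, _, h2, h3⟩ := exists_cyc hT hW hx hcard le_rfl
  rwa [← Finset.eq_of_subset_of_card_le h1 h2.ge]

end CyclePartition

namespace CyclePartition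

open scoped Classical

variable {V : Type*}
variable {r : V → V → Prop} {W W' K L : Finset V} {a b c x y : V}

/-- Deleting a set on which a Lipschitz function is injective lowers the connectivity of a
tournament by at most four. -/
lemma KC.sdiff_of_lipschitz (hT : Tourn r) {k : ℕ} (h : KC r W (k + 4)) {φ : V → ℕ}
    (hφ : ∀ u ∈ W, ∀ v ∈ W, r u v → φ v ≤ φ u + 1) {U : Finset V} (hUW : U ⊆ W)
    (hinj : Set.InjOn φ U) : KC r (W \ U) k := by
  intro S hS x hx y hy
  by_contra hxy
  set G := (W \ U) \ S with hG
  have hGW : G ⊆ W := Finset.sdiff_subset.trans Finset.sdiff_subset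
  have hstep : ∀ u v, Rch r G x u → u ∈ G → v ∈ G → r u v → Rch r G x v :=
    fun u v h1 h2 h3 h4 => h1.trans (.single h4 h2 h3)
  have main : ∀ c : ℕ, (∀ p ∈ U, ∀ z ∈ G, ¬ Rch r G x z → r p z → c ≤ φ p) →
      (∀ u ∈ G, Rch r G x u → φ u ≤ c + 2) → False := by
    intro c hc1 hc2
    set Win := U.filter (fun p => c ≤ φ p ∧ φ p ≤ c + 3) with hWin
    have hWin4 : Win.card ≤ 4 := by
      have : Win.card ≤ (Finset.Icc c (c + 3)).card := by
        refine Finset.card_le_card_of_injOn φ ?_ ?_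
        · intro p hp
          simp only [hWin, Finset.coe_filter, Set.mem_ofPred_eq] at hp
          simpa using hp.2
        · intro p hp q hq hpq
          exact hinj (Finset.mem_filter.1 hp).1 (Finset.mem_filter.1 hq).1 hpq
      rw [Nat.card_Icc] at this
      omega
    have hcon := h (S ∪ Win) (lt_of_le_of_lt (Finset.card_union_le _ _) (by omega))
    have hmem : ∀ z ∈ G, z ∈ W \ (S ∪ Win) := by
      intro z hz
      simp only [hG, hWin, Finset.mem_sdiff, Finset.mem_union, Finset.mem_filter] at hz ⊢
      tauto
    obtain ⟨u, v, _, hu, hv, huv, huW, hvW⟩ := (hcon x (hmem x hx) y (hmem y hy)).exists_cross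
      (fun z => (z ∈ G ∧ Rch r G x z) ∨ (z ∈ U ∧ φ z < c)) (Or.inl ⟨hx, Rch.refl x⟩) (by
        rintro (h | h)
        · exact hxy h.2
        · simp only [hG, Finset.mem_sdiff] at hy
          exact hy.1.2 h.1)
    push Not at hv
    have hvW' : v ∈ W := (Finset.mem_sdiff.1 hvW).1
    by_cases hvU : v ∈ U
    · have h1 := hv.2 hvU
      have h2 : c + 3 < φ v := by
        by_contra h2
        refine (Finset.mem_sdiff.1 hvW).2 (Finset.mem_union_right _ ?_)
        exact Finset.mem_filter.2 ⟨hvU, h1, by omega⟩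
      have h3 := hφ u (Finset.mem_sdiff.1 huW).1 v hvW' huv
      rcases hu with hu | hu
      · have := hc2 u hu.1 hu.2
        omega
      · omega
    · have hvG : v ∈ G := by
        simp only [hG, Finset.mem_sdiff, Finset.mem_union, not_or] at hvW ⊢
        exact ⟨⟨hvW.1, hvU⟩, hvW.2.1⟩
      rcases hu with hu | hu
      · exact hv.1 hvG (hstep u v hu.2 hu.1 hvG huv)
      · have := hc1 u hu.1 v hvG (hv.1 hvG) huv
        omega
  by_cases hex : ∃ c : ℕ, ∃ p ∈ U, φ p = c ∧ ∃ z ∈ G, ¬ Rch r G x z ∧ r p z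
  · obtain ⟨p, hp, hpc, z, hz, hz', hpz⟩ := Nat.find_spec hex
    refine main (Nat.find hex) ?_ ?_
    · intro p' hp' z' hz' h1 h2
      exact Nat.find_min' hex ⟨p', hp', rfl, z', hz', h1, h2⟩
    · intro u hu hu'
      have hzu : r z u := by
        refine (hT.total z u ?_).resolve_right fun h => hz' (hstep u z hu' hu hz h)
        rintro rfl
        exact hz' hu'
      have h1 := hφ z (hGW hz) u (hGW hu) hzu
      have h2 := hφ p (hUW hp) z (hGW hz) hpz
      omega
  · push Not at hex
    refine main (G.sup φ) ?_ ?_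
    · intro p hp z hz h1 h2
      exact absurd h2 (hex _ p hp rfl z hz h1)
    · intro u hu _
      have := Finset.le_sup (f := φ) hu
      omega

/-- The distance function from a nonempty set of vertices of a strong digraph. -/
lemma exists_dist (hW : Strong r W) {Src : Finset V} (hSW : Src ⊆ W) (hS : Src.Nonempty) :
    ∃ φ : V → ℕ, (∀ v ∈ W, φ v = 0 ↔ v ∈ Src) ∧
      (∀ u ∈ W, ∀ v ∈ W, r u v → φ v ≤ φ u + 1) ∧
      ∀ v ∈ W, ∀ d, φ v = d + 1 → ∃ u ∈ W, φ u = d ∧ r u v := by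
  let B : ℕ → Set V := fun d =>
    Nat.rec (Src : Set V) (fun _ s => s ∪ {v | v ∈ W ∧ ∃ u ∈ s, r u v}) d
  have hB0 : B 0 = Src := rfl
  have hBs : ∀ d, B (d + 1) = B d ∪ {v | v ∈ W ∧ ∃ u ∈ B d, r u v} := fun d => rfl
  have hBW : ∀ d, ∀ v ∈ B d, v ∈ W := by
    intro d
    induction d with
    | zero => intro v hv; exact hSW hv
    | succ d ih =>
      intro v hv
      rw [hBs] at hv
      rcases hv with hv | hv
      · exact ih v hv
      · exact hv.1
  have hex : ∀ v ∈ W, ∃ d, v ∈ B d := by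
    obtain ⟨b, hb⟩ := hS
    intro v hv
    have := hW b (hSW hb) v hv
    induction this with
    | refl => exact ⟨0, hb⟩
    | @tail u v _ h2 ih =>
      obtain ⟨d, hd⟩ := ih h2.2.1
      refine ⟨d + 1, ?_⟩
      rw [hBs]
      exact Or.inr ⟨hv, u, hd, h2.1⟩
  let φ : V → ℕ := fun v => sInf {d | v ∈ B d}
  have hspec : ∀ v ∈ W, v ∈ B (φ v) := fun v hv => Nat.sInf_mem (hex v hv)
  have hle : ∀ v d, v ∈ B d → φ v ≤ d := fun v d hd => Nat.sInf_le hd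
  refine ⟨φ, ?_, ?_, ?_⟩
  · intro v hv
    constructor
    · intro h
      have := hspec v hv
      rw [h, hB0] at this
      exact this
    · intro h
      have := hle v 0 h
      omega
  · intro u hu v hv huv
    apply hle
    rw [hBs]
    exact Or.inr ⟨hv, u, hspec u hu, huv⟩
  · intro v hv d hd
    have h1 := hspec v hv
    rw [hd, hBs] at h1
    rcases h1 with h1 | ⟨_, u, hu, huv⟩
    · have := hle v d h1
      omega
    · have huW := hBW d u hu
      refine ⟨u, huW, ?_, huv⟩
      have h2 := hle u d hu
      by_contra hne
      have : v ∈ B (φ u + 1) := by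
        rw [hBs]
        exact Or.inr ⟨hv, u, hspec u huW, huv⟩
      have := hle v (φ u + 1) this
      omega

/-- A shortest path between two sets in a highly connected digraph. -/
lemma exists_geodesic {k : ℕ} (hW : KC r W k) (hk : 1 ≤ k) {Src Tgt : Finset V}
    (hSW : Src ⊆ W) (hTW : Tgt ⊆ W) (hS : Src.Nonempty) (hTn : Tgt.Nonempty) :
    ∃ b ∈ Src, ∃ a ∈ Tgt, ∃ P ⊆ W, ∃ φ : V → ℕ,
      (∀ u ∈ W, ∀ v ∈ W, r u v → φ v ≤ φ u + 1) ∧ Set.InjOn φ P ∧ b ∈ P ∧ a ∈ P ∧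
      (∀ p ∈ P, p ∈ Src → p = b) ∧ (∀ p ∈ P, p ∈ Tgt → p = a) ∧
      (∀ p ∈ P, Rch r P b p ∧ Rch r P p a) ∧ (P.card - 2) * k ≤ W.card := by
  obtain ⟨φ, h0, h1, h2⟩ := exists_dist (hW.strong hk) hSW hS
  obtain ⟨a, ha, hamin⟩ := Finset.exists_min_image Tgt φ hTn
  have back : ∀ d, ∀ v ∈ W, φ v = d → ∃ b ∈ Src, ∃ P ⊆ W, v ∈ P ∧ b ∈ P ∧ P.card = d + 1 ∧
      Set.InjOn φ P ∧ (∀ p ∈ P, φ p ≤ d) ∧ ∀ p ∈ P, Rch r P b p ∧ Rch r P p v := by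
    intro d
    induction d with
    | zero =>
      intro v hv hvd
      refine ⟨v, (h0 v hv).1 hvd, {v}, by simpa using hv, by simp, by simp, by simp, by simp,
        by simp [hvd], ?_⟩
      intro p hp
      rw [Finset.mem_singleton] at hp
      subst hp
      exact ⟨Rch.refl _, Rch.refl _⟩
    | succ d ih =>
      intro v hv hvd
      obtain ⟨u, hu, hud, huv⟩ := h2 v hv d hvd
      obtain ⟨b, hb, P, hPW, huP, hbP, hcard, hinj, hle, hr⟩ := ih u hu hud
      have hvP : v ∉ P := fun h => by
        have := hle v h
        omega
      refine ⟨b, hb, insert v P, ?_, by simp, by simp [hbP], by simp [hvP, hcard], ?_, ?_, ?_⟩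
      · exact Finset.insert_subset hv hPW
      · rw [Finset.coe_insert, Set.injOn_insert (by simpa using hvP)]
        refine ⟨hinj, ?_⟩
        rintro ⟨p, hp, hpv⟩
        have := hle p hp
        omega
      · intro p hp
        rcases Finset.mem_insert.1 hp with rfl | hp
        · omega
        · have := hle p hp
          omega
      · have hsub : P ⊆ insert v P := Finset.subset_insert _ _
        have huv' : Rch r (insert v P) u v := .single huv (hsub huP) (by simp)
        intro p hp
        rcases Finset.mem_insert.1 hp with rfl | hp
        · exact ⟨((hr u huP).1.mono hsub).trans huv', Rch.refl _⟩
        · exact ⟨(hr p hp).1.mono hsub, ((hr p hp).2.mono hsub).trans huv'⟩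
  obtain ⟨b, hb, P, hPW, haP, hbP, hcard, hinj, hle, hr⟩ := back (φ a) a (hTW ha) rfl
  refine ⟨b, hb, a, ha, P, hPW, φ, h1, hinj, hbP, haP, ?_, ?_, hr, ?_⟩
  · intro p hp hp'
    exact hinj hp hbP (((h0 p (hPW hp)).2 hp').trans ((h0 b (hSW hb)).2 hb).symm)
  · intro p hp hp'
    exact hinj hp haP (le_antisymm (hle p hp) (hamin p hp'))
  · have hlev : ∀ d ∈ Finset.Ioo 0 (φ a), k ≤ (W.filter (fun v => φ v = d)).card := by
      intro d hd'
      rw [Finset.mem_Ioo] at hd'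
      by_contra hlt
      push Not at hlt
      have hb0 := (h0 b (hSW hb)).2 hb
      obtain ⟨u, v, _, hu, hv, huv, huW, hvW⟩ := (hW _ hlt b (by
          simp only [Finset.mem_sdiff, Finset.mem_filter, not_and]
          exact ⟨hSW hb, fun _ => by omega⟩) a (by
          simp only [Finset.mem_sdiff, Finset.mem_filter, not_and]
          exact ⟨hTW ha, fun _ => by omega⟩)).exists_cross (fun z => φ z < d)
            (by omega) (by omega)
      simp only [Finset.mem_sdiff, Finset.mem_filter, not_and] at huW hvW
      have h3 := h1 u huW.1 v hvW.1 huv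
      have h4 := hvW.2 hvW.1
      omega
    have hsum : (Finset.Ioo 0 (φ a)).card * k ≤ W.card := by
      have hd' : (∑ d ∈ Finset.Ioo 0 (φ a), (W.filter (fun v => φ v = d)).card) ≤ W.card := by
        rw [← Finset.card_biUnion]
        · refine Finset.card_le_card (Finset.biUnion_subset.2 fun d _ => Finset.filter_subset _ _)
        · intro d _ e _ hde
          rw [Function.onFun, Finset.disjoint_left]
          intro v hv hv'
          exact hde ((Finset.mem_filter.1 hv).2.symm.trans (Finset.mem_filter.1 hv').2)
      refine le_trans ?_ hd'
      simpa using Finset.card_nsmul_le_sum _ _ _ hlev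
    rw [Nat.card_Ioo] at hsum
    rw [hcard]
    simpa using hsum

end CyclePartition

namespace CyclePartition

open scoped Classical

variable {V : Type*}
variable {r : V → V → Prop} {W W' K L : Finset V} {a b c x y : V}

/-- No vertex of `A` has an edge to `v`. -/
def Misses (r : V → V → Prop) (A : Finset V) (v : V) : Prop := ∀ a ∈ A, ¬ r a v

/-- The vertices of `D` with no in-neighbour in `A`. -/
noncomputable def undom (r : V → V → Prop) (D A : Finset V) : Finset V :=
  D.filter (Misses r A)

lemma mem_undom {D A : Finset V} {v : V} : v ∈ undom r D A ↔ v ∈ D ∧ ∀ a ∈ A, ¬ r a v :=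
  Finset.mem_filter

lemma undom_subset {D A : Finset V} : undom r D A ⊆ D := fun _ hv => (mem_undom.1 hv).1

lemma undom_mono {D D' A A' : Finset V} (hD : D ⊆ D') (hA : A' ⊆ A) :
    undom r D A ⊆ undom r D' A' := by
  intro v hv
  rw [mem_undom] at hv ⊢
  exact ⟨hD hv.1, fun a ha => hv.2 a (hA ha)⟩

lemma exists_inNbr_weight_le_half (hT : Tourn r) {X : Finset V} (hX : X.Nonempty) (w : V → ℕ) :
    ∃ a ∈ X, 2 * ∑ v ∈ X.filter (fun v => r v a), w v ≤ ∑ v ∈ X, w v := by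
  by_contra hcon
  push Not at hcon
  set S := ∑ v ∈ X, w v with hS
  have h1 : ∑ a ∈ X, w a * (S + 1) ≤
      ∑ a ∈ X, w a * (2 * ∑ v ∈ X.filter (fun v => r v a), w v) :=
    Finset.sum_le_sum fun a ha => Nat.mul_le_mul_left _ (hcon a ha)
  have h2 : ∀ a ∈ X, ∑ v ∈ X.filter (fun v => r v a), w v =
      ∑ v ∈ X, if r v a then w v else 0 := fun a _ => Finset.sum_filter _ _
  have h3 : ∑ a ∈ X, w a * (2 * ∑ v ∈ X.filter (fun v => r v a), w v) ≤ S * S := by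
    have e1 : ∑ a ∈ X, w a * (2 * ∑ v ∈ X.filter (fun v => r v a), w v) =
        (∑ a ∈ X, ∑ v ∈ X, if r v a then w a * w v else 0) +
          ∑ a ∈ X, ∑ v ∈ X, if r a v then w a * w v else 0 := by
      have e2 : (∑ a ∈ X, ∑ v ∈ X, if r a v then w a * w v else 0) =
          ∑ a ∈ X, ∑ v ∈ X, if r v a then w a * w v else 0 := by
        rw [Finset.sum_comm]
        refine Finset.sum_congr rfl fun a _ => Finset.sum_congr rfl fun v _ => ?_
        rw [mul_comm]
      rw [e2, ← two_mul, Finset.mul_sum]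
      refine Finset.sum_congr rfl fun a ha => ?_
      rw [h2 a ha, mul_left_comm, Finset.mul_sum]
      congr 1
      refine Finset.sum_congr rfl fun v _ => ?_
      split_ifs <;> simp
    rw [e1, ← Finset.sum_add_distrib, hS, Finset.sum_mul_sum]
    refine Finset.sum_le_sum fun a _ => ?_
    rw [← Finset.sum_add_distrib]
    refine Finset.sum_le_sum fun v _ => ?_
    have := hT.asymm a v
    split_ifs <;> first | omega | tauto
  rw [← Finset.sum_mul, ← hS] at h1
  have h4 : S = 0 := by nlinarith
  obtain ⟨a, ha⟩ := hX
  have h5 := hcon a ha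
  have h6 : ∑ v ∈ X.filter (fun v => r v a), w v ≤ S :=
    Finset.sum_le_sum_of_subset (Finset.filter_subset _ _)
  omega

/-- A small transitive-like set dominating all but a tiny fraction of the weight. -/
lemma exists_dominating (hT : Tourn r) (w : V → ℕ) (s : ℕ) : ∀ {X : Finset V}, X.Nonempty →
    ∃ A ⊆ X, ∃ e ∈ A, A.card ≤ s + 1 ∧ (∀ a ∈ A, a ≠ e → r e a) ∧
      2 ^ s * ∑ v ∈ undom r (X \ A) A, w v ≤ ∑ v ∈ X, w v := by
  induction s with
  | zero =>
    rintro X ⟨x, hx⟩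
    refine ⟨{x}, by simpa using hx, x, by simp, by simp, by simp, ?_⟩
    rw [pow_zero, one_mul]
    exact Finset.sum_le_sum_of_subset ((Finset.filter_subset _ _).trans Finset.sdiff_subset)
  | succ s ih =>
    intro X hX
    obtain ⟨a, ha, hw⟩ := exists_inNbr_weight_le_half hT hX w
    rcases (X.filter (fun v => r v a)).eq_empty_or_nonempty with he | hne
    · refine ⟨{a}, by simpa using ha, a, by simp, by simp, by simp, ?_⟩
      have : undom r (X \ {a}) {a} = ∅ := by
        refine Finset.eq_empty_of_forall_notMem fun v hv => ?_
        rw [mem_undom] at hv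
        simp only [Finset.mem_sdiff, Finset.mem_singleton, forall_eq] at hv
        have h1 : r v a := (hT.total v a hv.1.2).resolve_right hv.2
        have : v ∈ X.filter (fun v => r v a) := Finset.mem_filter.2 ⟨hv.1.1, h1⟩
        rw [he] at this
        simp at this
      rw [this]
      simp
    · obtain ⟨A, hA, e, he, hcard, hadj, hres⟩ := ih hne
      have hAX : A ⊆ X := hA.trans (Finset.filter_subset _ _)
      refine ⟨insert a A, Finset.insert_subset ha hAX, e, by simp [he],
        (Finset.card_insert_le _ _).trans (by omega), ?_, ?_⟩
      · intro a' ha' hne'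
        rcases Finset.mem_insert.1 ha' with rfl | h
        · exact (Finset.mem_filter.1 (hA he)).2
        · exact hadj a' h hne'
      · have hsub : undom r (X \ insert a A) (insert a A) ⊆
            undom r (X.filter (fun v => r v a) \ A) A := by
          intro v hv
          rw [mem_undom] at hv ⊢
          simp only [Finset.mem_sdiff, Finset.mem_insert, not_or, forall_eq_or_imp,
            Finset.mem_filter] at hv ⊢
          exact ⟨⟨⟨hv.1.1, (hT.total v a hv.1.2.1).resolve_right hv.2.1⟩, hv.1.2.2⟩, hv.2.2⟩
        have := Finset.sum_le_sum_of_subset (f := w) hsub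
        calc _ ≤ 2 ^ (s + 1) * ∑ v ∈ undom r (X.filter (fun v => r v a) \ A) A, w v :=
              Nat.mul_le_mul_left _ this
          _ = 2 * (2 ^ s * ∑ v ∈ undom r (X.filter (fun v => r v a) \ A) A, w v) := by ring
          _ ≤ _ := (Nat.mul_le_mul_left _ hres).trans hw

variable [Fintype V]

/-- The in-neighbourhood of a vertex. -/
noncomputable def inn (r : V → V → Prop) (v : V) : Finset V := Finset.univ.filter (fun u => r u v)

lemma mem_inn {u v : V} : u ∈ inn r v ↔ r u v := by simp [inn]

lemma exists_dominator (hT : Tourn r) (Z : Finset V) (hZ : ∀ v, Z.card < (inn r v).card)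
    (hne : ∃ v, v ∉ Z) (w : V → ℕ) (s₁ s₂ : ℕ) :
    ∃ (A : Finset V) (e r₀ : V), e ∈ A ∧ r₀ ∈ A ∧ Disjoint A Z ∧ A.card ≤ s₁ + s₂ + 3 ∧
      (∀ a ∈ A, a ≠ e → r e a) ∧ (∀ a ∈ A, a ≠ r₀ → r a r₀) ∧
      2 ^ s₁ * (undom r (Finset.univ \ (Z ∪ A)) A).card ≤ (inn r r₀).card ∧
      2 ^ s₂ * ∑ v ∈ undom r (Finset.univ \ (Z ∪ A)) A, w v ≤ ∑ v ∈ inn r r₀ \ Z, w v ∧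
      (∀ v, v ∉ Z → (inn r r₀).card ≤ (inn r v).card) ∧
      2 * (inn r r₀).card ≤ Fintype.card V + 2 * Z.card := by
  have hne' : (Finset.univ \ Z).Nonempty := by
    obtain ⟨v, hv⟩ := hne
    exact ⟨v, by simpa using hv⟩
  obtain ⟨r₀, hr₀, hmin⟩ := Finset.exists_min_image (Finset.univ \ Z) (fun v => (inn r v).card) hne'
  have hr₀Z : r₀ ∉ Z := (Finset.mem_sdiff.1 hr₀).2
  have hdeg : 2 * (inn r r₀).card ≤ Fintype.card V + 2 * Z.card := by
    obtain ⟨a, ha, hw⟩ := exists_inNbr_weight_le_half hT hne' (fun _ => 1)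
    simp only [Finset.sum_const, smul_eq_mul, mul_one] at hw
    have h1 := hmin a ha
    have h2 : inn r a ⊆ (Finset.univ \ Z).filter (fun v => r v a) ∪ Z := by
      intro v hv
      rw [mem_inn] at hv
      simp [hv, em']
    have h3 := (Finset.card_le_card h2).trans (Finset.card_union_le _ _)
    have h4 := Finset.card_le_univ (Finset.univ \ Z)
    omega
  have hmin' : ∀ v, v ∉ Z → (inn r r₀).card ≤ (inn r v).card :=
    fun v hv => hmin v (by simpa using hv)
  have hXne : (inn r r₀ \ Z).Nonempty := by
    rw [← Finset.card_pos]
    have := Finset.le_card_sdiff Z (inn r r₀)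
    have := hZ r₀
    omega
  have hXc : (inn r r₀ \ Z).card ≤ (inn r r₀).card := Finset.card_le_card Finset.sdiff_subset
  obtain ⟨A₁, hA₁, e₁, he₁, hc₁, hadj₁, hres₁⟩ := exists_dominating hT (fun _ => 1) s₁ hXne
  simp only [Finset.sum_const, smul_eq_mul, mul_one] at hres₁
  have hA₁r : ∀ a ∈ A₁, r a r₀ := fun a ha => mem_inn.1 (Finset.mem_sdiff.1 (hA₁ ha)).1
  have hbad : ∀ A, r₀ ∈ A → A₁ ⊆ A → undom r (Finset.univ \ (Z ∪ A)) A ⊆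
      undom r ((inn r r₀ \ Z) \ A₁) A₁ := by
    intro A h0 h1 v hv
    rw [mem_undom] at hv ⊢
    simp only [Finset.mem_sdiff, Finset.mem_univ, true_and, Finset.mem_union, not_or,
      mem_inn] at hv ⊢
    refine ⟨⟨⟨(hT.total v r₀ ?_).resolve_right (hv.2 _ h0), hv.1.1⟩, fun h => hv.1.2 (h1 h)⟩,
      fun a ha => hv.2 a (h1 ha)⟩
    rintro rfl
    exact hv.1.2 h0
  rcases (undom r ((inn r r₀ \ Z) \ A₁) A₁).eq_empty_or_nonempty with he | hne2
  · refine ⟨insert r₀ A₁, e₁, r₀, by simp [he₁], by simp, ?_, ?_, ?_, ?_, ?_, ?_, hmin', hdeg⟩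
    · rw [Finset.disjoint_insert_left]
      exact ⟨hr₀Z, Finset.disjoint_of_subset_left hA₁ Finset.sdiff_disjoint⟩
    · exact (Finset.card_insert_le _ _).trans (by omega)
    · intro a ha hne
      rcases Finset.mem_insert.1 ha with rfl | ha
      · exact hA₁r _ he₁
      · exact hadj₁ a ha hne
    · intro a ha hne
      exact hA₁r a ((Finset.mem_insert.1 ha).resolve_left hne)
    all_goals
      have := hbad (insert r₀ A₁) (by simp) (Finset.subset_insert _ _)
      rw [he, Finset.subset_empty] at this
      rw [this]
      simp
  · obtain ⟨A₂, hA₂, e₂, he₂, hc₂, hadj₂, hres₂⟩ := exists_dominating hT w s₂ hne2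
    have hA₂X : A₂ ⊆ inn r r₀ \ Z :=
      hA₂.trans (undom_subset.trans Finset.sdiff_subset)
    have hA₂r : ∀ a ∈ A₂, r a r₀ := fun a ha => mem_inn.1 (Finset.mem_sdiff.1 (hA₂X ha)).1
    have hA12 : ∀ a ∈ A₁ ∪ A₂, r a r₀ := by
      intro a ha
      rcases Finset.mem_union.1 ha with h | h
      exacts [hA₁r a h, hA₂r a h]
    refine ⟨insert r₀ (A₁ ∪ A₂), e₂, r₀, by simp [he₂], by simp, ?_, ?_, ?_, ?_, ?_, ?_, hmin',
      hdeg⟩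
    · rw [Finset.disjoint_insert_left, Finset.disjoint_union_left]
      exact ⟨hr₀Z, Finset.disjoint_of_subset_left hA₁ Finset.sdiff_disjoint,
        Finset.disjoint_of_subset_left hA₂X Finset.sdiff_disjoint⟩
    · have h1 := Finset.card_insert_le r₀ (A₁ ∪ A₂)
      have h2 := Finset.card_union_le A₁ A₂
      omega
    · intro a ha hne
      rcases Finset.mem_insert.1 ha with rfl | ha
      · exact hA₂r _ he₂
      · rcases Finset.mem_union.1 ha with ha | ha
        · have := mem_undom.1 (hA₂ he₂)
          exact (hT.total a e₂ hne).resolve_left (this.2 a ha)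
        · exact hadj₂ a ha hne
    · intro a ha hne
      exact hA12 a ((Finset.mem_insert.1 ha).resolve_left hne)
    · have h1 := hbad (insert r₀ (A₁ ∪ A₂)) (by simp)
        (Finset.subset_union_left.trans (Finset.subset_insert _ _))
      exact (Nat.mul_le_mul_left _ (Finset.card_le_card h1)).trans (hres₁.trans hXc)
    · have h1 := hbad (insert r₀ (A₁ ∪ A₂)) (by simp)
        (Finset.subset_union_left.trans (Finset.subset_insert _ _))
      have h2 : undom r (Finset.univ \ (Z ∪ insert r₀ (A₁ ∪ A₂))) (insert r₀ (A₁ ∪ A₂)) ⊆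
          undom r (undom r ((inn r r₀ \ Z) \ A₁) A₁ \ A₂) A₂ := by
        intro v hv
        have h3 := h1 hv
        rw [mem_undom] at hv ⊢
        refine ⟨Finset.mem_sdiff.2 ⟨h3, fun h => ?_⟩, fun a ha => hv.2 a (by simp [ha])⟩
        exact (Finset.mem_sdiff.1 hv.1).2 (by simp [h])
      refine (Nat.mul_le_mul_left _ (Finset.sum_le_sum_of_subset (f := w) h2)).trans
        (hres₂.trans ?_)
      exact Finset.sum_le_sum_of_subset (undom_subset.trans Finset.sdiff_subset)

end CyclePartition

namespace CyclePartition

open scoped Classical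

variable {V : Type*}
variable {r : V → V → Prop} {W W' K L : Finset V} {a b c x y : V}

/-- A family of disjoint sets avoiding `Z`, indexed by their entry vertices, each having a
root that is dominated by the rest of the set. -/
structure DomFam (r : V → V → Prop) (Z Tgt : Finset V) (A : V → Finset V) (rA : V → V) :
    Prop where
  entry_mem : ∀ a ∈ Tgt, a ∈ A a
  root_mem : ∀ a ∈ Tgt, rA a ∈ A a
  entry_adj : ∀ a ∈ Tgt, ∀ a' ∈ A a, a' ≠ a → r a a'
  root_adj : ∀ a ∈ Tgt, ∀ a' ∈ A a, a' ≠ rA a → r a' (rA a)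
  disjZ : ∀ a ∈ Tgt, Disjoint (A a) Z
  disj : ∀ a ∈ Tgt, ∀ b ∈ Tgt, a ≠ b → Disjoint (A a) (A b)

/-- The number of sets of the family, other than the one at `s`, that do not dominate `v`. -/
noncomputable def badCount (r : V → V → Prop) (Tgt : Finset V) (A : V → Finset V) (s v : V) : ℕ :=
  ((Tgt.erase s).filter (fun a => Misses r (A a) v)).card

variable [Fintype V]

/-- The conclusion of the iterated weighted domination argument. -/
structure GoodFam (r : V → V → Prop) (Z Tgt : Finset V) (A : V → Finset V) (rA : V → V)
    (s₀ : V) (s m δ : ℕ) : Prop extends DomFam r Z Tgt A rA where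
  star_mem : s₀ ∈ Tgt
  card_eq : Tgt.card = m + 1
  card_star : (A s₀).card ≤ s + 3
  card_le : ∀ a ∈ Tgt, a ≠ s₀ → (A a).card ≤ 110
  undom_le : ∀ a ∈ Tgt, 100 * (undom r (Finset.univ \ (Z ∪ Tgt.biUnion A)) (A a)).card ≤
    Fintype.card V
  root_deg : ∀ a ∈ Tgt, 2 * (inn r (rA a)).card ≤
    Fintype.card V + 2 * (Z ∪ Tgt.biUnion A).card
  undom_star : 2 ^ s * (undom r (Finset.univ \ (Z ∪ Tgt.biUnion A)) (A s₀)).card ≤ δ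
  eq_deg : ∃ v, δ = (inn r v).card
  le_deg : ∀ v ∈ Finset.univ \ (Z ∪ Tgt.biUnion A), δ ≤ (inn r v).card
  potential : ∑ v ∈ Finset.univ \ (Z ∪ Tgt.biUnion A), 2 ^ (100 * badCount r Tgt A s₀ v) + δ ≤
    (Finset.univ \ (Z ∪ Tgt.biUnion A)).card + 2 ^ m * δ

lemma GoodFam.card_core {Z Tgt : Finset V} {A : V → Finset V} {rA : V → V} {s₀ : V} {s m δ : ℕ}
    (h : GoodFam r Z Tgt A rA s₀ s m δ) :
    (Z ∪ Tgt.biUnion A).card ≤ Z.card + (s + 3) + 110 * m := by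
  have h1 : Tgt.biUnion A = A s₀ ∪ (Tgt.erase s₀).biUnion A := by
    conv_lhs => rw [← Finset.insert_erase h.star_mem]
    rw [Finset.biUnion_insert]
  have h2 : ((Tgt.erase s₀).biUnion A).card ≤ (Tgt.erase s₀).card * 110 :=
    Finset.card_biUnion_le_card_mul _ _ _ fun a ha =>
      h.card_le a (Finset.mem_of_mem_erase ha) (Finset.ne_of_mem_erase ha)
  rw [Finset.card_erase_of_mem h.star_mem, h.card_eq] at h2
  have h3 := Finset.card_union_le Z (Tgt.biUnion A)
  have h4 := Finset.card_union_le (A s₀) ((Tgt.erase s₀).biUnion A)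
  have h5 := h.card_star
  rw [h1] at h3 ⊢
  simp only [Nat.add_sub_cancel] at h2
  omega

lemma exists_goodFam [Nonempty V] (hT : Tourn r) (Z : Finset V) (s : ℕ) (hs : 7 ≤ s) (m : ℕ)
    (hZ : ∀ v, Z.card + (s + 3) + 110 * m < (inn r v).card) :
    ∃ Tgt A rA s₀ δ, GoodFam r Z Tgt A rA s₀ s m δ := by
  induction m with
  | zero =>
    obtain ⟨v⟩ := ‹Nonempty V›
    have hne : ∃ v, v ∉ Z := by
      by_contra hcon
      push Not at hcon
      have h1 : inn r v ⊆ Z := fun u _ => hcon u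
      have := Finset.card_le_card h1
      have := hZ v
      omega
    obtain ⟨A, e, r₀, he, hr₀, hdZ, hc, hadj, hroot, hu1, -, hmin, hdeg⟩ :=
      exists_dominator hT Z (fun v => by have := hZ v; omega) hne (fun _ => 1) s 0
    have hcZ : Z.card ≤ (Z ∪ A).card := Finset.card_le_card Finset.subset_union_left
    have hcV : (inn r r₀).card ≤ Fintype.card V := Finset.card_le_univ _
    refine ⟨{e}, fun _ => A, fun _ => r₀, e, (inn r r₀).card, ⟨⟨?_, ?_, ?_, ?_, ?_, ?_⟩,
      ?_, ?_, ?_, ?_, ?_, ?_, ?_, ?_, ?_, ?_⟩⟩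
    any_goals simp only [Finset.mem_singleton, forall_eq, Finset.singleton_biUnion]
    · exact he
    · exact hr₀
    · exact hadj
    · exact hroot
    · exact hdZ
    · simp
    · simp
    · omega
    · simp
    · have h1 : 2 ^ 7 ≤ 2 ^ s := Nat.pow_le_pow_right (by norm_num) hs
      have h2 := Nat.mul_le_mul_right
        (undom r (Finset.univ \ (Z ∪ A)) A).card h1
      omega
    · omega
    · exact hu1
    · exact ⟨r₀, rfl⟩
    · intro v hv
      apply hmin
      simp only [Finset.mem_sdiff, Finset.mem_union] at hv
      tauto
    · have : ∀ v, badCount r {e} (fun _ => A) e v = 0 := by intro v; simp [badCount]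
      simp [this]
  | succ m ih =>
    obtain ⟨Tgt, A, rA, s₀, δ, h⟩ := ih fun v => by have := hZ v; omega
    set core := Z ∪ Tgt.biUnion A with hcore
    have hcc : core.card ≤ _ := h.card_core
    have hne : ∃ v, v ∉ core := by
      obtain ⟨v⟩ := ‹Nonempty V›
      by_contra hcon
      push Not at hcon
      have h1 : inn r v ⊆ core := fun u _ => hcon u
      have := Finset.card_le_card h1
      have := hZ v
      omega
    obtain ⟨B, e, r₀, he, hr₀, hdZ, hc, hadj, hroot, hu1, hu2, hmin, hdeg⟩ :=
      exists_dominator hT core (fun v => by have := hZ v; omega) hne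
        (fun v => 2 ^ (100 * badCount r Tgt A s₀ v)) 7 100
    have heC : e ∉ core := Finset.disjoint_left.1 hdZ he
    have heT : e ∉ Tgt := fun h' => heC (Finset.mem_union_right _
      (Finset.mem_biUnion.2 ⟨e, h', h.entry_mem e h'⟩))
    have hse : s₀ ≠ e := by rintro rfl; exact heT h.star_mem
    have hupd : ∀ a ∈ Tgt, Function.update A e B a = A a := by
      intro a ha
      rw [Function.update_of_ne]
      rintro rfl
      exact heT ha
    have hupd' : ∀ a ∈ Tgt, Function.update rA e r₀ a = rA a := by
      intro a ha
      rw [Function.update_of_ne]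
      rintro rfl
      exact heT ha
    have hbU : Tgt.biUnion (Function.update A e B) = Tgt.biUnion A :=
      Finset.biUnion_congr rfl hupd
    have hcore' : Z ∪ (insert e Tgt).biUnion (Function.update A e B) = core ∪ B := by
      rw [Finset.biUnion_insert, hbU, Function.update_self, hcore, Finset.union_assoc,
        Finset.union_comm B]
    have hcle : core.card ≤ (core ∪ B).card := Finset.card_le_card Finset.subset_union_left
    have hsub : Finset.univ \ (core ∪ B) ⊆ Finset.univ \ core :=
      Finset.sdiff_subset_sdiff le_rfl Finset.subset_union_left
    have hcV : (inn r r₀).card ≤ Fintype.card V := Finset.card_le_univ _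
    have hr₀C : r₀ ∉ core := Finset.disjoint_left.1 hdZ hr₀
    have hδ : δ ≤ (inn r r₀).card := h.le_deg r₀ (by rw [← hcore]; simpa using hr₀C)
    have hBA : ∀ a ∈ Tgt, Disjoint B (A a) := fun a ha =>
      Finset.disjoint_of_subset_right
        ((Finset.subset_biUnion_of_mem A ha).trans Finset.subset_union_right) hdZ
    refine ⟨insert e Tgt, Function.update A e B, Function.update rA e r₀, s₀, (inn r r₀).card,
      ⟨⟨?_, ?_, ?_, ?_, ?_, ?_⟩, ?_, ?_, ?_, ?_, ?_, ?_, ?_, ?_, ?_, ?_⟩⟩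
    · intro a ha
      rcases Finset.mem_insert.1 ha with rfl | ha
      · simpa using he
      · rw [hupd a ha]; exact h.entry_mem a ha
    · intro a ha
      rcases Finset.mem_insert.1 ha with rfl | ha
      · simpa using hr₀
      · rw [hupd a ha, hupd' a ha]; exact h.root_mem a ha
    · intro a ha
      rcases Finset.mem_insert.1 ha with rfl | ha
      · simpa using hadj
      · rw [hupd a ha]; exact h.entry_adj a ha
    · intro a ha
      rcases Finset.mem_insert.1 ha with rfl | ha
      · simpa using hroot
      · rw [hupd a ha, hupd' a ha]; exact h.root_adj a ha
    · intro a ha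
      rcases Finset.mem_insert.1 ha with rfl | ha
      · simpa using Finset.disjoint_of_subset_right Finset.subset_union_left hdZ
      · rw [hupd a ha]; exact h.disjZ a ha
    · intro a ha a' ha' hne
      rcases Finset.mem_insert.1 ha with rfl | ha <;> rcases Finset.mem_insert.1 ha' with rfl | ha'
      · exact absurd rfl hne
      · rw [hupd a' ha', Function.update_self]
        exact hBA a' ha'
      · rw [hupd _ ‹_›, Function.update_self]
        exact (hBA _ ‹_›).symm
      · rw [hupd a ha, hupd a' ha']
        exact h.disj a ha a' ha' hne
    · exact Finset.mem_insert_of_mem h.star_mem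
    · rw [Finset.card_insert_of_notMem heT, h.card_eq]
    · rw [hupd _ h.star_mem]; exact h.card_star
    · intro a ha hne
      rcases Finset.mem_insert.1 ha with rfl | ha
      · simpa using hc
      · rw [hupd a ha]; exact h.card_le a ha hne
    · rw [hcore']
      intro a ha
      rcases Finset.mem_insert.1 ha with rfl | ha
      · rw [Function.update_self]
        omega
      · rw [hupd a ha]
        refine le_trans ?_ (h.undom_le a ha)
        exact Nat.mul_le_mul_left _ (Finset.card_le_card (undom_mono hsub le_rfl))
    · rw [hcore']
      intro a ha
      rcases Finset.mem_insert.1 ha with rfl | ha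
      · rw [Function.update_self]
        omega
      · rw [hupd' a ha]
        have : _ ≤ Fintype.card V + 2 * core.card := h.root_deg a ha
        omega
    · rw [hcore', hupd _ h.star_mem]
      refine le_trans ?_ (h.undom_star.trans hδ)
      exact Nat.mul_le_mul_left _ (Finset.card_le_card (undom_mono hsub le_rfl))
    · exact ⟨r₀, rfl⟩
    · rw [hcore']
      intro v hv
      apply hmin
      simp only [Finset.mem_sdiff, Finset.mem_union] at hv
      tauto
    · rw [hcore']
      set w : V → ℕ := fun v => 2 ^ (100 * badCount r Tgt A s₀ v) with hw
      have hw1 : ∀ v, 1 ≤ w v := fun v => Nat.one_le_two_pow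
      have hpot : ∑ v ∈ Finset.univ \ core, w v + δ ≤ (Finset.univ \ core).card + 2 ^ m * δ :=
        h.potential
      have hgap : ∀ S ⊆ Finset.univ \ core,
          ∑ v ∈ S, w v + (Finset.univ \ core).card ≤ ∑ v ∈ Finset.univ \ core, w v + S.card := by
        intro S hS
        have h1 := Finset.sum_sdiff (f := w) hS
        have h2 := Finset.card_sdiff_add_card_eq_card hS
        have h3 : ((Finset.univ \ core) \ S).card ≤ ∑ v ∈ (Finset.univ \ core) \ S, w v := by
          simpa using Finset.card_nsmul_le_sum ((Finset.univ \ core) \ S) w 1 fun v _ => hw1 v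
        omega
      have hbc : ∀ v, badCount r (insert e Tgt) (Function.update A e B) s₀ v =
          badCount r Tgt A s₀ v + if Misses r B v then 1 else 0 := by
        intro v
        have h1 : (Tgt.erase s₀).filter (fun a => Misses r (Function.update A e B a) v) =
            (Tgt.erase s₀).filter (fun a => Misses r (A a) v) := by
          refine Finset.filter_congr fun a ha => ?_
          rw [hupd a (Finset.mem_of_mem_erase ha)]
        unfold badCount
        rw [Finset.erase_insert_of_ne hse.symm, Finset.filter_insert, Function.update_self]
        split_ifs with hv
        · rw [Finset.card_insert_of_notMem, h1]
          intro h'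
          exact heT (Finset.mem_of_mem_erase (Finset.mem_filter.1 h').1)
        · rw [h1, add_zero]
      have hnew : ∑ v ∈ Finset.univ \ (core ∪ B),
          2 ^ (100 * badCount r (insert e Tgt) (Function.update A e B) s₀ v) ≤
          ∑ v ∈ Finset.univ \ (core ∪ B), w v +
            2 ^ 100 * ∑ v ∈ undom r (Finset.univ \ (core ∪ B)) B, w v := by
        have hun : ∑ v ∈ undom r (Finset.univ \ (core ∪ B)) B, w v =
            ∑ v ∈ Finset.univ \ (core ∪ B), if Misses r B v then w v else 0 := by
          rw [← Finset.sum_filter]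
          rfl
        rw [hun, Finset.mul_sum, ← Finset.sum_add_distrib]
        refine Finset.sum_le_sum fun v _ => ?_
        rw [hbc v]
        split_ifs
        · rw [mul_add, pow_add, mul_one, mul_comm]
          exact Nat.le_add_left _ _
        · simp [hw]
      have hX : inn r r₀ \ core ⊆ Finset.univ \ core :=
        Finset.sdiff_subset_sdiff (Finset.subset_univ _) le_rfl
      have hXc : (inn r r₀ \ core).card ≤ (inn r r₀).card :=
        Finset.card_le_card Finset.sdiff_subset
      have g1 := hgap _ hX
      have g2 := hgap _ hsub
      have hu2' : 2 ^ 100 * ∑ v ∈ undom r (Finset.univ \ (core ∪ B)) B, w v ≤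
          ∑ v ∈ inn r r₀ \ core, w v := hu2
      have h2m : 1 ≤ 2 ^ m := Nat.one_le_two_pow
      obtain ⟨d, hd⟩ := Nat.exists_eq_add_of_le hδ
      have h5 : 2 ^ (m + 1) * (inn r r₀).card = 2 * (2 ^ m * δ) + 2 * (2 ^ m * d) := by
        rw [hd]; ring
      have h6 : d ≤ 2 ^ m * d := Nat.le_mul_of_pos_left d h2m
      omega

/-- Few vertices are missed by many sets of a good family. -/
lemma GoodFam.card_bad {Z Tgt : Finset V} {A : V → Finset V} {rA : V → V} {s₀ : V} {s t δ : ℕ}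
    (h : GoodFam r Z Tgt A rA s₀ s (30 * t) δ) (ht : 1 ≤ t) :
    2 ^ (60 * t) * ((Finset.univ \ (Z ∪ Tgt.biUnion A)).filter
      (fun v => t ≤ badCount r Tgt A s₀ v)).card ≤ δ := by
  set D := Finset.univ \ (Z ∪ Tgt.biUnion A)
  set E := D.filter (fun v => t ≤ badCount r Tgt A s₀ v) with hE
  have hpot : ∑ v ∈ D, 2 ^ (100 * badCount r Tgt A s₀ v) + δ ≤ D.card + 2 ^ (30 * t) * δ :=
    h.potential
  have h1 := Finset.sum_sdiff (f := fun v => 2 ^ (100 * badCount r Tgt A s₀ v))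
    (Finset.filter_subset (fun v => t ≤ badCount r Tgt A s₀ v) D)
  have h2 := Finset.card_sdiff_add_card_eq_card
    (Finset.filter_subset (fun v => t ≤ badCount r Tgt A s₀ v) D)
  rw [← hE] at h1 h2
  have h3 : (D \ E).card ≤ ∑ v ∈ D \ E, 2 ^ (100 * badCount r Tgt A s₀ v) := by
    simpa using Finset.card_nsmul_le_sum (D \ E) (fun v => 2 ^ (100 * badCount r Tgt A s₀ v)) 1
      fun v _ => Nat.one_le_two_pow
  have h4 : E.card * 2 ^ (100 * t) ≤ ∑ v ∈ E, 2 ^ (100 * badCount r Tgt A s₀ v) := by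
    simpa using Finset.card_nsmul_le_sum E (fun v => 2 ^ (100 * badCount r Tgt A s₀ v))
      (2 ^ (100 * t)) fun v hv => Nat.pow_le_pow_right (by norm_num)
        (Nat.mul_le_mul_left _ (Finset.mem_filter.1 hv).2)
  have h5 : E.card * 2 ^ (100 * t) ≤ E.card + 2 ^ (30 * t) * δ := by omega
  have h6 : 2 ^ (100 * t) = 2 ^ (30 * t) * (2 ^ (60 * t) * 2 ^ (10 * t)) := by
    rw [← pow_add, ← pow_add]
    congr 1
    omega
  have h7 : 2 ≤ 2 ^ (10 * t) := by
    calc 2 = 2 ^ 1 := by norm_num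
      _ ≤ _ := Nat.pow_le_pow_right (by norm_num) (by omega)
  have h8 : 1 ≤ 2 ^ (60 * t) := Nat.one_le_two_pow
  have h9 : 1 ≤ 2 ^ (30 * t) := Nat.one_le_two_pow
  generalize 2 ^ (10 * t) = p at *
  generalize 2 ^ (60 * t) = q at *
  generalize 2 ^ (30 * t) = u at *
  rw [h6] at h5
  have h10 : E.card * (u * (q * 2)) ≤ E.card * (u * (q * p)) := by gcongr
  have h11 : E.card * 1 ≤ E.card * (u * q) := by
    gcongr
    exact Nat.mul_pos h9 h8
  have h12 : u * (q * E.card) ≤ u * δ := by nlinarith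
  exact Nat.le_of_mul_le_mul_left h12 h9

end CyclePartition

namespace CyclePartition

open scoped Classical

variable {V : Type*}
variable {r : V → V → Prop} {W W' K L : Finset V} {a b c x y : V}

/-- Greedy choice of pairwise disjoint small sets. -/
lemma exists_disjoint_choice {ι : Type*} (Q : ι → Finset V → Prop) (q M : ℕ) (s : Finset ι)
    (Z : Finset V)
    (hQ : ∀ i ∈ s, ∀ Z' : Finset V, Z'.card ≤ M → ∃ U, Disjoint U Z' ∧ U.card ≤ q ∧ Q i U)
    (hM : Z.card + q * s.card ≤ M) :
    ∃ U : ι → Finset V, (∀ i ∈ s, Q i (U i) ∧ Disjoint (U i) Z ∧ (U i).card ≤ q) ∧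
      ∀ i ∈ s, ∀ j ∈ s, i ≠ j → Disjoint (U i) (U j) := by
  induction s using Finset.induction_on generalizing Z with
  | empty => exact ⟨fun _ => ∅, by simp, by simp⟩
  | @insert i s hi ih =>
    rw [Finset.card_insert_of_notMem hi, mul_add, mul_one] at hM
    obtain ⟨X, hX, hXq, hQX⟩ := hQ i (Finset.mem_insert_self _ _) Z (by omega)
    obtain ⟨U, hU1, hU2⟩ := ih (Z ∪ X) (fun j hj => hQ j (Finset.mem_insert_of_mem hj))
      (by have := Finset.card_union_le Z X; omega)
    have hne : ∀ j ∈ s, j ≠ i := by rintro j hj rfl; exact hi hj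
    refine ⟨Function.update U i X, ?_, ?_⟩
    · intro j hj
      rcases Finset.mem_insert.1 hj with rfl | hj
      · rw [Function.update_self]
        exact ⟨hQX, hX, hXq⟩
      · rw [Function.update_of_ne (hne j hj)]
        obtain ⟨h1, h2, h3⟩ := hU1 j hj
        exact ⟨h1, Finset.disjoint_of_subset_right Finset.subset_union_left h2, h3⟩
    · intro j hj j' hj' hjj
      rcases Finset.mem_insert.1 hj with rfl | hj <;> rcases Finset.mem_insert.1 hj' with rfl | hj'
      · exact absurd rfl hjj
      · rw [Function.update_self, Function.update_of_ne (hne j' hj')]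
        exact (Finset.disjoint_of_subset_right Finset.subset_union_right (hU1 j' hj').2.1).symm
      · rw [Function.update_self, Function.update_of_ne (hne j ‹_›)]
        exact Finset.disjoint_of_subset_right Finset.subset_union_right (hU1 j ‹_›).2.1
      · rw [Function.update_of_ne (hne j' hj'), Function.update_of_ne (hne j hj)]
        exact hU2 j hj _ hj' (by assumption)

/-- Hall's theorem with capacities. -/
lemma exists_coloring_of_hall {ι I : Type*} [Fintype I] [Nonempty I] (F : Finset ι) (c : I → ℕ)
    (g : ι → I → Prop)
    (hall : ∀ S ⊆ F, S.card ≤ ∑ i ∈ Finset.univ.filter (fun i => ∃ v ∈ S, g v i), c i) :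
    ∃ col : ι → I, (∀ v ∈ F, g v (col v)) ∧
      ∀ i, (F.filter (fun v => col v = i)).card ≤ c i := by
  rcases F.eq_empty_or_nonempty with rfl | hF
  · exact ⟨fun _ => Classical.arbitrary I, by simp, by simp⟩
  let tt : F → Finset (Σ i : I, Fin (c i)) := fun v => Finset.univ.filter (fun p => g v p.1)
  have hcard : ∀ s : Finset F, s.card ≤ (s.biUnion tt).card := by
    intro s
    have h1 := hall (s.map (Function.Embedding.subtype _)) (by
      intro v hv
      simp only [Finset.mem_map, Function.Embedding.coe_subtype] at hv
      obtain ⟨w, _, rfl⟩ := hv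
      exact w.2)
    rw [Finset.card_map] at h1
    refine h1.trans ?_
    have h2 : (Finset.univ.filter
        (fun i => ∃ v ∈ s.map (Function.Embedding.subtype _), g v i)).sigma
        (fun i => (Finset.univ : Finset (Fin (c i)))) ⊆ s.biUnion tt := by
      rintro ⟨i, j⟩ hp
      simp only [Finset.mem_sigma, Finset.mem_filter, Finset.mem_univ, true_and, and_true,
        Finset.mem_map] at hp
      obtain ⟨v, ⟨w, hw, rfl⟩, hv⟩ := hp
      refine Finset.mem_biUnion.2 ⟨w, hw, ?_⟩
      simpa [tt] using hv
    have h3 := Finset.card_le_card h2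
    rw [Finset.card_sigma] at h3
    simpa using h3
  obtain ⟨f, hf, hft⟩ := (Finset.all_card_le_biUnion_card_iff_exists_injective tt).1 hcard
  obtain ⟨v0, hv0⟩ := hF
  refine ⟨fun v => if h : v ∈ F then (f ⟨v, h⟩).1 else (f ⟨v0, hv0⟩).1, ?_, ?_⟩
  · intro v hv
    simp only [hv, dite_true]
    have := hft ⟨v, hv⟩
    simpa [tt] using this
  · intro i
    have h1 : (F.filter (fun v => (if h : v ∈ F then (f ⟨v, h⟩).1 else (f ⟨v0, hv0⟩).1) = i)).card
        ≤ ((Finset.univ : Finset (Fin (c i))).map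
          (Function.Embedding.sigmaMk (β := fun i => Fin (c i)) i)).card := by
      refine Finset.card_le_card_of_injOn
        (fun v => if h : v ∈ F then f ⟨v, h⟩ else f ⟨v0, hv0⟩) ?_ ?_
      · intro v hv
        have hv := Finset.mem_filter.1 (Finset.mem_coe.1 hv)
        have hv2 := hv.2
        simp only [hv.1, dite_true] at hv2 ⊢
        generalize f ⟨v, hv.1⟩ = p at hv2 ⊢
        subst hv2
        simp
      · intro v hv w hw hvw
        have hv := (Finset.mem_filter.1 (Finset.mem_coe.1 hv)).1
        have hw := (Finset.mem_filter.1 (Finset.mem_coe.1 hw)).1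
        simp only [hv, hw, dite_true] at hvw
        exact congrArg Subtype.val (hf hvw)
    simpa using h1

/-- Distributing the vertices of `F` among classes of prescribed sizes. -/
lemma exists_exact_coloring {ι I : Type*} [Fintype I] [Nonempty I] (F : Finset ι) (c : I → ℕ)
    (g : ι → I → Prop) (hsum : ∑ i, c i = F.card)
    (h1 : ∀ v ∈ F, F.card ≤ 2 * ∑ i ∈ Finset.univ.filter (fun i => g v i), c i)
    (h2 : ∀ i, c i ≠ 0 → 2 * (F.filter (fun v => ¬ g v i)).card ≤ F.card) :
    ∃ col : ι → I, (∀ v ∈ F, g v (col v)) ∧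
      ∀ i, (F.filter (fun v => col v = i)).card = c i := by
  obtain ⟨col, hc1, hc2⟩ := exists_coloring_of_hall F c g (by
    intro S hS
    rcases S.eq_empty_or_nonempty with rfl | ⟨v, hv⟩
    · simp
    by_cases hbig : 2 * S.card ≤ F.card
    · have h3 := h1 v (hS hv)
      have h4 : ∑ i ∈ Finset.univ.filter (fun i => g v i), c i ≤
          ∑ i ∈ Finset.univ.filter (fun i => ∃ v ∈ S, g v i), c i :=
        Finset.sum_le_sum_of_subset fun i hi => by
          simp only [Finset.mem_filter, Finset.mem_univ, true_and] at hi ⊢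
          exact ⟨v, hv, hi⟩
      omega
    · have h5 : ∑ i ∈ Finset.univ.filter (fun i => ∃ v ∈ S, g v i), c i = ∑ i, c i := by
        rw [Finset.sum_filter_of_ne]
        intro i _ hi
        by_contra hcon
        push Not at hcon
        have h6 := Finset.card_le_card (s := S) (t := F.filter (fun v => ¬ g v i)) fun w hw =>
          Finset.mem_filter.2 ⟨hS hw, hcon w hw⟩
        have := h2 i hi
        omega
      rw [h5, hsum]
      exact Finset.card_le_card hS)
  refine ⟨col, hc1, ?_⟩
  have h3 : ∑ i, (F.filter (fun v => col v = i)).card = ∑ i, c i := by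
    rw [hsum]
    exact (Finset.card_eq_sum_card_fiberwise (fun _ _ => Finset.mem_coe.2 (Finset.mem_univ _))).symm
  have := (Finset.sum_eq_sum_iff_of_le fun i _ => hc2 i).1 h3
  exact fun i => this i (Finset.mem_univ _)

end CyclePartition

namespace CyclePartition

open scoped Classical

variable {V : Type*} [Fintype V]
variable {r : V → V → Prop} {W W' K L : Finset V} {a b c x y : V}

/-- The result of repeatedly linking sources to targets by shortest paths and allotting the
links to indices. -/
structure Linkage {I : Type*} (r : V → V → Prop) (dem : I → ℕ) (compat : I → V → V → Prop)
    (Ψ : I → V → V → Finset V → Prop) (h k : ℕ) (Src Tgt G : Finset V) (tgt : V → V)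
    (asg : V → Option I) (R : V → Finset V) : Prop where
  tgt_mem : ∀ b ∈ Src, tgt b ∈ Tgt
  tgt_inj : Set.InjOn tgt Src
  sub : ∀ b ∈ Src, R b ⊆ G
  card_le : ∀ b ∈ Src, (R b).card ≤ h + 2
  disj : ∀ b ∈ Src, ∀ b' ∈ Src, b ≠ b' → Disjoint (R b) (R b')
  good : ∀ b ∈ Src, ∀ i, asg b = some i → compat i b (tgt b) ∧ Ψ i b (tgt b) (R b)
  unassigned : ∀ b ∈ Src, asg b = none → R b = ∅
  conn : KC r (G \ Src.biUnion R) k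
  le_dem : ∀ i, (Src.filter (fun b => asg b = some i)).card ≤ dem i
  maximal : ∀ i, (Src.filter (fun b => asg b = some i)).card < dem i →
    ∀ b ∈ Src, asg b = none → ¬ compat i b (tgt b)

lemma exists_linkage (hT : Tourn r) {I : Type*} (compat : I → V → V → Prop)
    (Ψ : I → V → V → Finset V → Prop) (h k bd : ℕ) (hk : 1 ≤ k)
    (hh : Fintype.card V < (h - 1) * k) (Src₀ Tgt₀ : Finset V)
    (step : ∀ i, ∀ b ∈ Src₀, ∀ a ∈ Tgt₀, compat i b a → ∀ G P : Finset V, P ⊆ G →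
      (Finset.univ \ G).card ≤ bd → P.card ≤ h → b ∈ P → a ∈ P →
      (∀ p ∈ P, Rch r P b p ∧ Rch r P p a) →
      ∃ R ⊆ G, (R \ P).card ≤ 2 ∧ Disjoint (R \ P) (Src₀ ∪ Tgt₀) ∧ Ψ i b a R)
    (m : ℕ) : ∀ (dem : I → ℕ) (Src Tgt G : Finset V), Src.card = m → Tgt.card = m → Src ⊆ G →
      Tgt ⊆ G → Src ⊆ Src₀ → Tgt ⊆ Tgt₀ → KC r G (6 * m + k) →
      (Finset.univ \ G).card + m * (h + 2) ≤ bd →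
      ∃ tgt asg R, Linkage r dem compat Ψ h k Src Tgt G tgt asg R := by
  induction m with
  | zero =>
    intro dem Src Tgt G hS _ _ _ _ _ hG _
    rw [Finset.card_eq_zero] at hS
    subst hS
    exact ⟨id, fun _ => Option.none, fun _ => ∅, by simp, by simp, by simp, by simp, by simp,
      by simp, by simp, by simpa using hG, by simp, by simp⟩
  | succ m ih =>
    intro dem Src Tgt G hS hTc hSG hTG hS₀ hT₀ hG hbd
    obtain ⟨b, hb, a, ha, P, hPG, φ, hφ, hinj, hbP, haP, hPS, hPT, hr, hPc⟩ :=
      exists_geodesic hG (by omega) hSG hTG (Finset.card_pos.1 (by omega))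
        (Finset.card_pos.1 (by omega))
    have hPh : P.card ≤ h := by
      have h1 : (P.card - 2) * k ≤ (P.card - 2) * (6 * (m + 1) + k) :=
        Nat.mul_le_mul_left _ (by omega)
      have h2 := Finset.card_le_univ G
      have h3 : (P.card - 2) * k < (h - 1) * k := by omega
      have h4 := Nat.lt_of_mul_lt_mul_right h3
      omega
    have hbd' : m * (h + 2) + (h + 2) = (m + 1) * (h + 2) := by ring
    have hScard : (Src.erase b).card = m := by rw [Finset.card_erase_of_mem hb, hS]; rfl
    have hTcard : (Tgt.erase a).card = m := by rw [Finset.card_erase_of_mem ha, hTc]; rfl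
    have hbE : ∀ b' ∈ Src.erase b, b' ≠ b := fun b' hb' => Finset.ne_of_mem_erase hb'
    have key : ∀ (o : Option I) (R₀ : Finset V) (dem' : I → ℕ), R₀ ⊆ G → (R₀ \ P).card ≤ 2 →
        Disjoint (R₀ \ P) (Src₀ ∪ Tgt₀) →
        (∀ i, o = some i → compat i b a ∧ Ψ i b a R₀) → (o = none → R₀ = ∅) →
        (∀ i, dem' i + (if o = some i then 1 else 0) = dem i) →
        (o = none → ∀ i, 0 < dem i → ¬ compat i b a) →
        ∃ tgt asg R, Linkage r dem compat Ψ h k Src Tgt G tgt asg R := by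
      intro o R₀ dem' hRG hR2 hRd hgood hnone hdem hmax
      have hdS : Disjoint (Src.erase b) R₀ := by
        rw [Finset.disjoint_left]
        intro z hz hzR
        have hzS := Finset.mem_of_mem_erase hz
        by_cases hzP : z ∈ P
        · exact hbE z hz (hPS z hzP hzS)
        · exact Finset.disjoint_left.1 hRd (Finset.mem_sdiff.2 ⟨hzR, hzP⟩)
            (Finset.mem_union_left _ (hS₀ hzS))
      have hdT : Disjoint (Tgt.erase a) R₀ := by
        rw [Finset.disjoint_left]
        intro z hz hzR
        have hzS := Finset.mem_of_mem_erase hz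
        by_cases hzP : z ∈ P
        · exact Finset.ne_of_mem_erase hz (hPT z hzP hzS)
        · exact Finset.disjoint_left.1 hRd (Finset.mem_sdiff.2 ⟨hzR, hzP⟩)
            (Finset.mem_union_right _ (hT₀ hzS))
      have hRc : R₀.card ≤ h + 2 := by
        have h1 := Finset.card_sdiff_add_card_inter R₀ P
        have h2 := Finset.card_le_card (Finset.inter_subset_right : R₀ ∩ P ⊆ P)
        omega
      have hGR : G \ R₀ = (G \ (R₀ ∩ P)) \ (R₀ \ P) := by
        ext z
        simp only [Finset.mem_sdiff, Finset.mem_inter]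
        tauto
      have hconn : KC r (G \ R₀) (6 * m + k) := by
        rw [hGR]
        refine KC.sdiff (k := 6 * m + k + 2) ?_ (by omega)
        refine KC.sdiff_of_lipschitz hT (hG.mono (by omega)) hφ
          (Finset.inter_subset_right.trans hPG) ?_
        exact hinj.mono (by simp)
      have hout : (Finset.univ \ (G \ R₀)).card ≤ (Finset.univ \ G).card + R₀.card := by
        refine (Finset.card_le_card ?_).trans (Finset.card_union_le _ _)
        intro z
        simp only [Finset.mem_sdiff, Finset.mem_univ, Finset.mem_union]
        tauto
      obtain ⟨tgt, asg, R, hL⟩ := ih dem' (Src.erase b) (Tgt.erase a) (G \ R₀) hScard hTcard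
        (Finset.subset_sdiff.2 ⟨(Finset.erase_subset _ _).trans hSG, hdS⟩)
        (Finset.subset_sdiff.2 ⟨(Finset.erase_subset _ _).trans hTG, hdT⟩)
        ((Finset.erase_subset _ _).trans hS₀) ((Finset.erase_subset _ _).trans hT₀) hconn
        (by omega)
      have hcases : ∀ b' ∈ Src, b' = b ∨ b' ∈ Src.erase b := by
        intro b' hb'
        by_cases h : b' = b
        · exact Or.inl h
        · exact Or.inr (Finset.mem_erase.2 ⟨h, hb'⟩)
      have hcount : ∀ i, (Src.filter (fun b' => Function.update asg b o b' = some i)).card =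
          ((Src.erase b).filter (fun b' => asg b' = some i)).card +
            if o = some i then 1 else 0 := by
        intro i
        conv_lhs => rw [← Finset.insert_erase hb]
        rw [Finset.filter_insert, Function.update_self]
        have h1 : (Src.erase b).filter (fun b' => Function.update asg b o b' = some i) =
            (Src.erase b).filter (fun b' => asg b' = some i) := by
          refine Finset.filter_congr fun b' hb' => ?_
          rw [Function.update_of_ne (hbE b' hb')]
        rw [h1]
        split_ifs
        · rw [Finset.card_insert_of_notMem (by simp)]
        · simp
      refine ⟨Function.update tgt b a, Function.update asg b o, Function.update R b R₀, ?_, ?_,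
        ?_, ?_, ?_, ?_, ?_, ?_, ?_, ?_⟩
      · intro b' hb'
        rcases hcases b' hb' with rfl | h
        · simpa using ha
        · rw [Function.update_of_ne (hbE b' h)]
          exact Finset.mem_of_mem_erase (hL.tgt_mem b' h)
      · intro b₁ h₁ b₂ h₂ h12
        rcases hcases b₁ h₁ with rfl | h₁ <;> rcases hcases b₂ h₂ with rfl | h₂
        · rfl
        · rw [Function.update_self, Function.update_of_ne (hbE b₂ h₂)] at h12
          exact absurd h12.symm (Finset.ne_of_mem_erase (hL.tgt_mem b₂ h₂))
        · rw [Function.update_self, Function.update_of_ne (hbE b₁ ‹_›)] at h12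
          exact absurd h12 (Finset.ne_of_mem_erase (hL.tgt_mem b₁ ‹_›))
        · rw [Function.update_of_ne (hbE b₁ h₁), Function.update_of_ne (hbE b₂ h₂)] at h12
          exact hL.tgt_inj h₁ h₂ h12
      · intro b' hb'
        rcases hcases b' hb' with rfl | h
        · simpa using hRG
        · rw [Function.update_of_ne (hbE b' h)]
          exact (hL.sub b' h).trans Finset.sdiff_subset
      · intro b' hb'
        rcases hcases b' hb' with rfl | h
        · simpa using hRc
        · rw [Function.update_of_ne (hbE b' h)]
          exact hL.card_le b' h
      · intro b₁ h₁ b₂ h₂ h12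
        have hdis : ∀ b' ∈ Src.erase b, Disjoint (R b') R₀ := fun b' hb' =>
          Finset.disjoint_of_subset_left (hL.sub b' hb') Finset.sdiff_disjoint
        rcases hcases b₁ h₁ with rfl | h₁ <;> rcases hcases b₂ h₂ with rfl | h₂
        · exact absurd rfl h12
        · rw [Function.update_self, Function.update_of_ne (hbE b₂ h₂)]
          exact (hdis b₂ h₂).symm
        · rw [Function.update_self, Function.update_of_ne (hbE b₁ ‹_›)]
          exact hdis b₁ ‹_›
        · rw [Function.update_of_ne (hbE b₁ h₁), Function.update_of_ne (hbE b₂ h₂)]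
          exact hL.disj b₁ h₁ b₂ h₂ h12
      · intro b' hb' i hi
        rcases hcases b' hb' with rfl | h
        · rw [Function.update_self] at hi
          simpa using hgood i hi
        · rw [Function.update_of_ne (hbE b' h)] at hi ⊢
          rw [Function.update_of_ne (hbE b' h)]
          exact hL.good b' h i hi
      · intro b' hb' hi
        rcases hcases b' hb' with rfl | h
        · rw [Function.update_self] at hi ⊢
          exact hnone hi
        · rw [Function.update_of_ne (hbE b' h)] at hi ⊢
          exact hL.unassigned b' h hi
      · have h1 : Src.biUnion (Function.update R b R₀) = R₀ ∪ (Src.erase b).biUnion R := by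
          conv_lhs => rw [← Finset.insert_erase hb]
          rw [Finset.biUnion_insert, Function.update_self]
          congr 1
          exact Finset.biUnion_congr rfl fun b' hb' => Function.update_of_ne (hbE b' hb') _ _
        have h2 : G \ (R₀ ∪ (Src.erase b).biUnion R) = (G \ R₀) \ (Src.erase b).biUnion R := by
          ext z
          simp only [Finset.mem_sdiff, Finset.mem_union]
          tauto
        rw [h1, h2]
        exact hL.conn
      · intro i
        rw [hcount, ← hdem i]
        exact Nat.add_le_add_right (hL.le_dem i) _
      · intro i hi b' hb' hn
        rw [hcount, ← hdem i] at hi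
        rcases hcases b' hb' with rfl | h
        · rw [Function.update_self] at hn ⊢
          subst hn
          have hd := hdem i
          refine hmax rfl i ?_
          simp at hd hi
          omega
        · rw [Function.update_of_ne (hbE b' h)] at hn ⊢
          exact hL.maximal i (by omega) b' h hn
    by_cases hex : ∃ i, compat i b a ∧ 0 < dem i
    · obtain ⟨i, hi, hd⟩ := hex
      obtain ⟨R₀, h1, h2, h3, h4⟩ := step i b (hS₀ hb) a (hT₀ ha) hi G P hPG (by omega)
        hPh hbP haP hr
      refine key (some i) R₀ (Function.update dem i (dem i - 1)) h1 h2 h3 ?_ (by simp) ?_ (by simp)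
      · rintro j hj
        obtain rfl : i = j := by simpa using hj
        exact ⟨hi, h4⟩
      · intro j
        by_cases hj : i = j
        · subst hj
          simp only [Function.update_self, if_true]
          omega
        · rw [Function.update_of_ne (Ne.symm hj)]
          simp [hj]
    · push Not at hex
      refine key none ∅ dem (by simp) (by simp) (by simp) (by simp) (by simp) (by simp) ?_
      intro _ i hi hc
      have := hex i hc
      omega

end CyclePartition

namespace CyclePartition

open scoped Classical

variable {V : Type*} [Fintype V]
variable {r : V → V → Prop} {W W' K L : Finset V} {a b c x y : V}

lemma KC.le_card_inn (hT : Tourn r) {k : ℕ} (h : KC r Finset.univ k) (hn : k < Fintype.card V)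
    (v : V) : k ≤ (inn r v).card := by
  by_contra hlt
  push Not at hlt
  have hv : v ∉ inn r v := fun hv => hT.irrefl v (mem_inn.1 hv)
  have h1 : (insert v (inn r v)).card < (Finset.univ : Finset V).card := by
    rw [Finset.card_insert_of_notMem hv, Finset.card_univ]
    omega
  obtain ⟨u, -, hu⟩ := Finset.exists_mem_notMem_of_card_lt_card h1
  rw [Finset.mem_insert, not_or] at hu
  obtain ⟨p, q, -, hp, hq, hpq, hpW, -⟩ := (h _ hlt u (by simp [hu.2]) v
    (by simp [hv])).exists_cross (fun z => z ≠ v) hu.1 (by simp)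
  simp only [ne_eq, not_not] at hq
  subst hq
  exact (Finset.mem_sdiff.1 hpW).2 (mem_inn.2 hpq)

/-- One side (dominating or, for the reversed relation, dominated) of the absorbing
configuration. -/
structure Side (r : V → V → Prop) (Z : Finset V) (t s : ℕ) (D T : Finset V) (A : V → Finset V)
    (rA : V → V) (s₀ : V) (E : Finset V) (flag : Prop) : Prop extends DomFam r Z T A rA where
  star_mem : s₀ ∈ T
  card_eq : T.card = 30 * t + 1
  card_star : (A s₀).card ≤ s + 3
  card_le : ∀ a ∈ T, a ≠ s₀ → (A a).card ≤ 110
  undom_le : ∀ a ∈ T, 100 * (undom r D (A a)).card ≤ Fintype.card V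
  root_out : ∀ a ∈ T, 10 * (Finset.univ.filter (fun v => ¬ r (rA a) v)).card ≤
    6 * Fintype.card V
  bad_lt : ∀ v ∈ D, v ∉ E → badCount r T A s₀ v < t
  star_dom : flag → ∀ v ∈ D, v ∉ E → ∃ a ∈ A s₀, r a v
  E_card : 2 ^ (60 * t) * E.card ≤ 2 * Fintype.card V
  E_flag : E.Nonempty → flag
  pick : ∀ v, ∀ Z : Finset V, Z.card ≤ 10 ^ 6 * t → ∃ u ∈ D, u ∉ Z ∧ r u v
  pick_typical : ∀ v ∈ D, ∀ Z : Finset V, Z.card ≤ 10 ^ 6 * t → ∃ u ∈ D, u ∉ E ∧ u ∉ Z ∧ r u v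

lemma exists_mem_of_card_lt {X D Z : Finset V} (h : (Finset.univ \ D).card + Z.card < X.card) :
    ∃ u ∈ X, u ∈ D ∧ u ∉ Z := by
  by_contra hcon
  push Not at hcon
  have h1 : X ⊆ (Finset.univ \ D) ∪ Z := by
    intro u hu
    by_cases hD : u ∈ D
    · exact Finset.mem_union_right _ (hcon u hu hD)
    · exact Finset.mem_union_left _ (by simpa using hD)
  have := (Finset.card_le_card h1).trans (Finset.card_union_le _ _)
  omega

lemma GoodFam.exists_side {Z T : Finset V} {A : V → Finset V} {rA : V → V} {s₀ : V}
    {s t δ : ℕ} (h : GoodFam r Z T A rA s₀ s (30 * t) δ) (ht : 1 ≤ t) (hT : Tourn r)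
    {D : Finset V} (hD : D ⊆ Finset.univ \ (Z ∪ T.biUnion A))
    (hDc : (Finset.univ \ D).card ≤ 10 ^ 5 * t) (hdeg : ∀ v, 10 ^ 50 * t ≤ (inn r v).card)
    {flag : Prop} (hs : flag → s = 60 * t) (hflag : ¬ flag → Fintype.card V < 2 ^ (60 * t)) :
    ∃ E, Side r Z t s D T A rA s₀ E flag := by
  obtain ⟨v₀, hv₀⟩ := h.eq_deg
  have hδk : 10 ^ 50 * t ≤ δ := hv₀ ▸ hdeg v₀
  have hδn : δ ≤ Fintype.card V := hv₀ ▸ Finset.card_le_univ _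
  set E₁ := D.filter (fun v => t ≤ badCount r T A s₀ v) with hE₁
  have hE₁c : 2 ^ (60 * t) * E₁.card ≤ δ :=
    (Nat.mul_le_mul_left _ (Finset.card_le_card (Finset.filter_subset_filter _ hD))).trans
      (h.card_bad ht)
  have hp : 2 ^ 60 ≤ 2 ^ (60 * t) := Nat.pow_le_pow_right (by norm_num) (by omega)
  obtain ⟨E, hEc, hEf, hE1, hE2⟩ : ∃ E : Finset V, 2 ^ (60 * t) * E.card ≤ 2 * δ ∧
      (E.Nonempty → flag) ∧ (∀ v ∈ D, v ∉ E → badCount r T A s₀ v < t) ∧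
      (flag → ∀ v ∈ D, v ∉ E → ∃ a ∈ A s₀, r a v) := by
    by_cases hf : flag
    · refine ⟨E₁ ∪ undom r D (A s₀), ?_, fun _ => hf, ?_, ?_⟩
      · have h1 : 2 ^ s * (undom r D (A s₀)).card ≤ δ :=
          (Nat.mul_le_mul_left _ (Finset.card_le_card (undom_mono hD le_rfl))).trans h.undom_star
        rw [hs hf] at h1
        have h2 := Nat.mul_le_mul_left (2 ^ (60 * t)) (Finset.card_union_le E₁ (undom r D (A s₀)))
        rw [mul_add] at h2
        omega
      · intro v hv hvE
        by_contra hcon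
        exact hvE (Finset.mem_union_left _ (Finset.mem_filter.2 ⟨hv, by omega⟩))
      · intro _ v hv hvE
        by_contra hcon
        push Not at hcon
        exact hvE (Finset.mem_union_right _ (mem_undom.2 ⟨hv, hcon⟩))
    · refine ⟨∅, by simp, by simp, ?_, fun h => absurd h hf⟩
      intro v hv _
      by_contra hcon
      have h1 : 0 < E₁.card := Finset.card_pos.2 ⟨v, Finset.mem_filter.2 ⟨hv, by omega⟩⟩
      have h2 := Nat.le_mul_of_pos_right (2 ^ (60 * t)) h1
      have := hflag hf
      omega
  have hE4 : 4 * E.card ≤ δ := by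
    have := Nat.mul_le_mul_right E.card hp
    omega
  have hZc : (Z ∪ T.biUnion A).card ≤ 10 ^ 5 * t := by
    refine (Finset.card_le_card ?_).trans hDc
    intro v hv
    rw [Finset.mem_sdiff]
    exact ⟨Finset.mem_univ _, fun hvD => (Finset.mem_sdiff.1 (hD hvD)).2 hv⟩
  refine ⟨E, ⟨h.toDomFam, h.star_mem, h.card_eq, h.card_star, h.card_le, ?_, ?_, hE1, hE2,
    by omega, hEf, ?_, ?_⟩⟩
  · intro a ha
    exact (Nat.mul_le_mul_left _ (Finset.card_le_card (undom_mono hD le_rfl))).trans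
      (h.undom_le a ha)
  · intro a ha
    have h1 := h.root_deg a ha
    have h2 : Finset.univ.filter (fun v => ¬ r (rA a) v) ⊆ insert (rA a) (inn r (rA a)) := by
      intro v hv
      rw [Finset.mem_filter] at hv
      rw [Finset.mem_insert, mem_inn]
      by_contra hcon
      push Not at hcon
      exact (hT.total v (rA a) hcon.1).elim hcon.2 hv.2
    have h3 := (Finset.card_le_card h2).trans (Finset.card_insert_le _ _)
    omega
  · intro v Z' hZ'
    have := hdeg v
    obtain ⟨u, hu, h1, h2⟩ := exists_mem_of_card_lt (X := inn r v) (D := D) (Z := Z') (by omega)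
    exact ⟨u, h1, h2, mem_inn.1 hu⟩
  · intro v hv Z' hZ'
    have h1 := h.le_deg v (hD hv)
    have h2 := Finset.card_union_le E Z'
    obtain ⟨u, hu, h3, h4⟩ := exists_mem_of_card_lt (X := inn r v) (D := D) (Z := E ∪ Z')
      (by omega)
    rw [Finset.mem_union, not_or] at h4
    exact ⟨u, h3, h4.1, h4.2, mem_inn.1 hu⟩

/-- The absorbing configuration of dominating and dominated sets. -/
structure Config (r : V → V → Prop) {t : ℕ} (x : Fin t → V) where
  TA : Finset V
  A : V → Finset V
  rA : V → V
  as : V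
  EA : Finset V
  SB : Finset V
  B : V → Finset V
  rB : V → V
  bs : V
  EB : Finset V
  s : ℕ
  flag : Prop
  D : Finset V
  D_eq : D = Finset.univ \ ((Finset.univ.image x ∪ TA.biUnion A) ∪ SB.biUnion B)
  sideA : Side r (Finset.univ.image x) t s D TA A rA as EA flag
  sideB : Side (Function.swap r) (Finset.univ.image x ∪ TA.biUnion A) t s D SB B rB bs EB flag
  s_le : s ≤ 100 * t
  s_le' : s * (10 ^ 6 * t) ≤ Fintype.card V

lemma exists_config (hT : Tourn r) {t : ℕ} (ht : 1 ≤ t) (x : Fin t → V)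
    (hconn : KC r Finset.univ (10 ^ 50 * t)) (hn : 10 ^ 50 * t < Fintype.card V) :
    Nonempty (Config r x) := by
  have hne : Nonempty V := Fintype.card_pos_iff.1 (by omega)
  have hdegA := hconn.le_card_inn hT hn
  have hdegB := hconn.swap.le_card_inn hT.swap hn
  obtain ⟨s, flag, hs7, hst, hsn, hf1, hf2⟩ : ∃ (s : ℕ) (flag : Prop), 7 ≤ s ∧ s ≤ 100 * t ∧
      s * (10 ^ 6 * t) ≤ Fintype.card V ∧ (flag → s = 60 * t) ∧
      (¬ flag → Fintype.card V < 2 ^ (60 * t)) := by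
    by_cases hbig : 2 ^ (60 * t) ≤ Fintype.card V
    · refine ⟨60 * t, True, by omega, by omega, ?_, by simp, by simp⟩
      have h1 : t ≤ 2 ^ t := Nat.lt_two_pow_self.le
      calc 60 * t * (10 ^ 6 * t) = 60 * 10 ^ 6 * (t * t) := by ring
        _ ≤ 2 ^ 30 * (2 ^ t * 2 ^ t) := Nat.mul_le_mul (by norm_num) (Nat.mul_le_mul h1 h1)
        _ = 2 ^ (30 + (t + t)) := by rw [pow_add, pow_add]
        _ ≤ 2 ^ (60 * t) := Nat.pow_le_pow_right (by norm_num) (by omega)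
        _ ≤ _ := hbig
    · exact ⟨100, False, by omega, by omega, by omega, by simp, fun _ => by omega⟩
  have hXc : (Finset.univ.image x).card ≤ t := Finset.card_image_le.trans (by simp)
  obtain ⟨TA, A, rA, as, δA, hA⟩ := exists_goodFam hT (Finset.univ.image x) s hs7 (30 * t)
    (fun v => by have := hdegA v; omega)
  have hAc := hA.card_core
  obtain ⟨SB, B, rB, bs, δB, hB⟩ := exists_goodFam hT.swap (Finset.univ.image x ∪ TA.biUnion A)
    s hs7 (30 * t) (fun v => by have := hdegB v; omega)
  have hBc := hB.card_core
  have hDc : (Finset.univ \ (Finset.univ \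
      ((Finset.univ.image x ∪ TA.biUnion A) ∪ SB.biUnion B))).card ≤ 10 ^ 5 * t := by
    rw [Finset.sdiff_sdiff_eq_self (Finset.subset_univ _)]
    omega
  obtain ⟨EA, hsA⟩ := hA.exists_side ht hT (D := Finset.univ \
    ((Finset.univ.image x ∪ TA.biUnion A) ∪ SB.biUnion B))
    (Finset.sdiff_subset_sdiff le_rfl Finset.subset_union_left) hDc hdegA hf1 hf2
  obtain ⟨EB, hsB⟩ := hB.exists_side ht hT.swap (D := Finset.univ \
    ((Finset.univ.image x ∪ TA.biUnion A) ∪ SB.biUnion B)) le_rfl hDc hdegB hf1 hf2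
  exact ⟨⟨TA, A, rA, as, EA, SB, B, rB, bs, EB, s, flag, _, rfl, hsA, hsB, hst, hsn⟩⟩

end CyclePartition

namespace CyclePartition

open scoped Classical

variable {V : Type*}
variable {r : V → V → Prop} {W W' K L : Finset V} {a b c x y : V}

/-- The vertex `a` is the source and `z` the sink of a set `A` in which `a` dominates
everything and everything dominates `z`. -/
structure Fan (r : V → V → Prop) (A : Finset V) (a z : V) : Prop where
  entry_mem : a ∈ A
  root_mem : z ∈ A
  entry_adj : ∀ v ∈ A, v ≠ a → r a v
  root_adj : ∀ v ∈ A, v ≠ z → r v z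

lemma Fan.rch_entry {A : Finset V} {z : V} (h : Fan r A a z) {v : V} (hv : v ∈ A) :
    Rch r A a v := by
  by_cases he : v = a
  · subst he; exact .refl v
  · exact .single (h.entry_adj v hv he) h.entry_mem hv

lemma Fan.rch_root {A : Finset V} {z : V} (h : Fan r A a z) {v : V} (hv : v ∈ A) :
    Rch r A v z := by
  by_cases he : v = z
  · subst he; exact .refl v
  · exact .single (h.root_adj v hv he) hv h.root_mem

lemma DomFam.fan {Z Tgt : Finset V} {A : V → Finset V} {rA : V → V} (h : DomFam r Z Tgt A rA)
    (ha : a ∈ Tgt) : Fan r (A a) a (rA a) :=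
  ⟨h.entry_mem a ha, h.root_mem a ha, h.entry_adj a ha, h.root_adj a ha⟩

lemma DomFam.fan_swap {Z Tgt : Finset V} {A : V → Finset V} {rA : V → V}
    (h : DomFam (Function.swap r) Z Tgt A rA) (ha : a ∈ Tgt) : Fan r (A a) (rA a) a :=
  ⟨h.root_mem a ha, h.entry_mem a ha, h.root_adj a ha, h.entry_adj a ha⟩

/-- A set `P` of vertices all lying on walks inside `P` from `b` to `a`. -/
def Between (r : V → V → Prop) (b a : V) (P : Finset V) : Prop :=
  b ∈ P ∧ a ∈ P ∧ ∀ p ∈ P, Rch r P b p ∧ Rch r P p a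

lemma Between.rch_line {A B P : Finset V} {ra rb f g : V} (hP : Between r b a P)
    (hA : Fan r A a ra) (hB : Fan r B rb b) (hf : r ra f) (hg : r g rb) :
    ∀ v ∈ A ∪ (B ∪ (P ∪ {f, g})), Rch r (A ∪ (B ∪ (P ∪ {f, g}))) g v ∧
      Rch r (A ∪ (B ∪ (P ∪ {f, g}))) v f := by
  obtain ⟨hb, ha, hP⟩ := hP
  set E := A ∪ (B ∪ (P ∪ {f, g})) with hE
  have hAE : A ⊆ E := Finset.subset_union_left
  have hBE : B ⊆ E := Finset.subset_union_left.trans Finset.subset_union_right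
  have hPE : P ⊆ E :=
    Finset.subset_union_left.trans (Finset.subset_union_right.trans Finset.subset_union_right)
  have hfE : f ∈ E := by simp [hE]
  have hgE : g ∈ E := by simp [hE]
  have g1 : Rch r E g rb := .single hg hgE (hBE hB.entry_mem)
  have g2 : ∀ v ∈ B, Rch r E g v := fun v hv => g1.trans ((hB.rch_entry hv).mono hBE)
  have g3 : ∀ v ∈ P, Rch r E g v := fun v hv => (g2 _ hB.root_mem).trans ((hP v hv).1.mono hPE)
  have g4 : ∀ v ∈ A, Rch r E g v := fun v hv => (g3 _ ha).trans ((hA.rch_entry hv).mono hAE)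
  have f1 : Rch r E ra f := .single hf (hAE hA.root_mem) hfE
  have f2 : ∀ v ∈ A, Rch r E v f := fun v hv => ((hA.rch_root hv).mono hAE).trans f1
  have f3 : ∀ v ∈ P, Rch r E v f := fun v hv => ((hP v hv).2.mono hPE).trans (f2 _ hA.entry_mem)
  have f4 : ∀ v ∈ B, Rch r E v f := fun v hv => ((hB.rch_root hv).mono hBE).trans (f3 _ hb)
  have gf : Rch r E g f := (g4 _ hA.root_mem).trans f1
  intro v hv
  simp only [hE, Finset.mem_union, Finset.mem_insert, Finset.mem_singleton] at hv
  rcases hv with hv | hv | hv | rfl | rfl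
  · exact ⟨g4 v hv, f2 v hv⟩
  · exact ⟨g2 v hv, f4 v hv⟩
  · exact ⟨g3 v hv, f3 v hv⟩
  · exact ⟨gf, .refl v⟩
  · exact ⟨.refl v, gf⟩

lemma Between.strong {A B P : Finset V} {ra rb f g : V} (hP : Between r b a P)
    (hA : Fan r A a ra) (hB : Fan r B rb b) (hf : r ra f) (hg : r g rb)
    (hf' : ∃ v ∈ B, r f v) (hg' : ∃ v ∈ A, r v g) : Strong r (A ∪ (B ∪ (P ∪ {f, g}))) := by
  have hl := hP.rch_line hA hB hf hg
  obtain ⟨b', hb', hf'⟩ := hf'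
  obtain ⟨a', ha', hg'⟩ := hg'
  refine strong_of_hub g fun v hv => ⟨(hl v hv).1, (hl v hv).2.trans ?_⟩
  have hAE : A ⊆ A ∪ (B ∪ (P ∪ {f, g})) := Finset.subset_union_left
  have hBE : B ⊆ A ∪ (B ∪ (P ∪ {f, g})) :=
    Finset.subset_union_left.trans Finset.subset_union_right
  have hPE : P ⊆ A ∪ (B ∪ (P ∪ {f, g})) :=
    Finset.subset_union_left.trans (Finset.subset_union_right.trans Finset.subset_union_right)
  refine (Rch.single hf' (by simp) (hBE hb')).trans (((hB.rch_root hb').mono hBE).trans ?_)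
  refine ((hP.2.2 b hP.1).2.mono hPE).trans (((hA.rch_entry ha').mono hAE).trans ?_)
  exact .single hg' (hAE ha') (by simp)

lemma Between.strong_union {A B P : Finset V} {ra rb f g : V} (hP : Between r b a P)
    (hA : Fan r A a ra) (hB : Fan r B rb b) (hf : r ra f) (hg : r g rb) (hK : Strong r K)
    (hf' : ∃ v ∈ K, r f v) (hg' : ∃ v ∈ K, r v g) :
    Strong r (K ∪ (A ∪ (B ∪ (P ∪ {f, g})))) := by
  have hl := hP.rch_line hA hB hf hg
  obtain ⟨b', hb', hf'⟩ := hf'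
  obtain ⟨a', ha', hg'⟩ := hg'
  refine strong_ear hK fun v hv => ⟨⟨a', ha', ?_⟩, b', hb', ?_⟩
  · exact (Rch.single hg' (Finset.mem_union_left _ ha') (by simp)).trans
      ((hl v hv).1.mono Finset.subset_union_right)
  · exact ((hl v hv).2.mono Finset.subset_union_right).trans
      (Rch.single hf' (by simp) (Finset.mem_union_left _ (by assumption)))

/-- `U` consists of the vertices other than `v` of a walk with middle vertex `v`, from `p` to `q`
of length four. -/
def ChainAt (r : V → V → Prop) (v p q : V) (U : Finset V) : Prop :=
  ∃ u w, U = {p, u, w, q} ∧ r p u ∧ r u v ∧ r v w ∧ r w q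

lemma ChainAt.strong_union {v p q : V} {U : Finset V} (h : ChainAt r v p q U) (hK : Strong r K)
    (hp : ∃ z ∈ K, r z p) (hq : ∃ z ∈ K, r q z) : Strong r (K ∪ insert v U) := by
  obtain ⟨u, w, rfl, h1, h2, h3, h4⟩ := h
  obtain ⟨z, hz, hp⟩ := hp
  obtain ⟨z', hz', hq⟩ := hq
  set E := K ∪ insert v {p, u, w, q} with hE
  have hKE : K ⊆ E := Finset.subset_union_left
  have mp : p ∈ E := by simp [hE]
  have mu : u ∈ E := by simp [hE]
  have mv : v ∈ E := by simp [hE]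
  have mw : w ∈ E := by simp [hE]
  have mq : q ∈ E := by simp [hE]
  have e0 : Rch r E z p := .single hp (hKE hz) mp
  have e1 : Rch r E p u := .single h1 mp mu
  have e2 : Rch r E u v := .single h2 mu mv
  have e3 : Rch r E v w := .single h3 mv mw
  have e4 : Rch r E w q := .single h4 mw mq
  have e5 : Rch r E q z' := .single hq mq (hKE hz')
  refine strong_ear hK fun y hy => ⟨⟨z, hz, ?_⟩, z', hz', ?_⟩
  all_goals
    simp only [Finset.mem_insert, Finset.mem_singleton] at hy
  · rcases hy with rfl | rfl | rfl | rfl | rfl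
    · exact (e0.trans e1).trans e2
    · exact e0
    · exact e0.trans e1
    · exact ((e0.trans e1).trans e2).trans e3
    · exact (((e0.trans e1).trans e2).trans e3).trans e4
  · rcases hy with rfl | rfl | rfl | rfl | rfl
    · exact (e3.trans e4).trans e5
    · exact ((((e1.trans e2).trans e3).trans e4).trans e5)
    · exact ((e2.trans e3).trans e4).trans e5
    · exact e4.trans e5
    · exact e5

/-- `U` consists of two walks of length two, the middle vertex of the first dominating `v` and
that of the second dominated by `v`; the first vertices of the walks are `p`, `p'` and the last
ones `q`, `q'`. -/
def UnitAt (r : V → V → Prop) (v p p' q q' : V) (U : Finset V) : Prop :=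
  ∃ u w, U = {p, u, q, p', w, q'} ∧ r p u ∧ r u v ∧ r u q ∧ r p' w ∧ r v w ∧ r w q'

lemma UnitAt.strong_union {v p p' q q' : V} {U : Finset V} (h : UnitAt r v p p' q q' U)
    (hK : Strong r K) (hp : ∃ z ∈ K, r z p) (hp' : ∃ z ∈ K, r z p') (hq : ∃ z ∈ K, r q z)
    (hq' : ∃ z ∈ K, r q' z) : Strong r (K ∪ U) ∧ Strong r (K ∪ insert v U) := by
  obtain ⟨u, w, rfl, h1, h2, h3, h4, h5, h6⟩ := h
  obtain ⟨z1, hz1, hp⟩ := hp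
  obtain ⟨z2, hz2, hp'⟩ := hp'
  obtain ⟨z3, hz3, hq⟩ := hq
  obtain ⟨z4, hz4, hq'⟩ := hq'
  have key : Strong r (K ∪ {p, u, q, p', w, q'}) := by
    set E := K ∪ {p, u, q, p', w, q'} with hE
    have hKE : K ⊆ E := Finset.subset_union_left
    have mp : p ∈ E := by simp [hE]
    have mu : u ∈ E := by simp [hE]
    have mq : q ∈ E := by simp [hE]
    have mp' : p' ∈ E := by simp [hE]
    have mw : w ∈ E := by simp [hE]
    have mq' : q' ∈ E := by simp [hE]
    have e1 : Rch r E z1 p := .single hp (hKE hz1) mp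
    have e2 : Rch r E p u := .single h1 mp mu
    have e3 : Rch r E u q := .single h3 mu mq
    have e4 : Rch r E q z3 := .single hq mq (hKE hz3)
    have f1 : Rch r E z2 p' := .single hp' (hKE hz2) mp'
    have f2 : Rch r E p' w := .single h4 mp' mw
    have f3 : Rch r E w q' := .single h6 mw mq'
    have f4 : Rch r E q' z4 := .single hq' mq' (hKE hz4)
    refine strong_ear hK fun y hy => ?_
    simp only [Finset.mem_insert, Finset.mem_singleton] at hy
    rcases hy with rfl | rfl | rfl | rfl | rfl | rfl
    · exact ⟨⟨z1, hz1, e1⟩, z3, hz3, (e2.trans e3).trans e4⟩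
    · exact ⟨⟨z1, hz1, e1.trans e2⟩, z3, hz3, e3.trans e4⟩
    · exact ⟨⟨z1, hz1, (e1.trans e2).trans e3⟩, z3, hz3, e4⟩
    · exact ⟨⟨z2, hz2, f1⟩, z4, hz4, (f2.trans f3).trans f4⟩
    · exact ⟨⟨z2, hz2, f1.trans f2⟩, z4, hz4, f3.trans f4⟩
    · exact ⟨⟨z2, hz2, (f1.trans f2).trans f3⟩, z4, hz4, f4⟩
  refine ⟨key, ?_⟩
  have := strong_attach key (F := {v}) (by
    intro y hy
    rw [Finset.mem_singleton] at hy
    subst hy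
    exact ⟨⟨u, by simp, h2⟩, w, by simp, h5⟩)
  rwa [Finset.union_assoc, Finset.union_comm _ {v}, ← Finset.insert_eq] at this

variable [Fintype V]

/-- Vertices set aside around a configuration: a walk through each `x i`, and a unit for every
vertex of the configuration and of these walks. -/
structure Reserve {t : ℕ} {x : Fin t → V} (c : Config r x) where
  Ch : Fin t → Finset V
  p : Fin t → V
  q : Fin t → V
  Un : V → Finset V
  chain : ∀ i, ChainAt r (x i) (p i) (q i) (Ch i)
  chain_sub : ∀ i, Ch i ⊆ c.D
  p_mem : ∀ i, p i ∈ c.D ∧ p i ∉ c.EA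
  q_mem : ∀ i, q i ∈ c.D ∧ q i ∉ c.EB
  chain_disj : ∀ i j, i ≠ j → Disjoint (Ch i) (Ch j)
  unit : ∀ σ ∈ (c.TA.biUnion c.A ∪ c.SB.biUnion c.B) ∪ Finset.univ.biUnion Ch,
    ∃ p p' q q', UnitAt r σ p p' q q' (Un σ) ∧ p ∈ c.D ∧ p ∉ c.EA ∧ p' ∈ c.D ∧ p' ∉ c.EA ∧
      q ∈ c.D ∧ q ∉ c.EB ∧ q' ∈ c.D ∧ q' ∉ c.EB
  unit_sub : ∀ σ ∈ (c.TA.biUnion c.A ∪ c.SB.biUnion c.B) ∪ Finset.univ.biUnion Ch, Un σ ⊆ c.D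
  unit_card : ∀ σ ∈ (c.TA.biUnion c.A ∪ c.SB.biUnion c.B) ∪ Finset.univ.biUnion Ch,
    (Un σ).card ≤ 6
  unit_disj : ∀ σ ∈ (c.TA.biUnion c.A ∪ c.SB.biUnion c.B) ∪ Finset.univ.biUnion Ch,
    ∀ τ ∈ (c.TA.biUnion c.A ∪ c.SB.biUnion c.B) ∪ Finset.univ.biUnion Ch, σ ≠ τ →
      Disjoint (Un σ) (Un τ)
  unit_chain : ∀ σ ∈ (c.TA.biUnion c.A ∪ c.SB.biUnion c.B) ∪ Finset.univ.biUnion Ch,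
    Disjoint (Un σ) (Finset.univ.biUnion Ch)

lemma Config.card_core_le {t : ℕ} {x : Fin t → V} (c : Config r x) (ht : 1 ≤ t) :
    (c.TA.biUnion c.A ∪ c.SB.biUnion c.B).card ≤ 6900 * t := by
  have key : ∀ (Tg : Finset V) (A : V → Finset V) (s₀ : V), s₀ ∈ Tg → Tg.card = 30 * t + 1 →
      (A s₀).card ≤ c.s + 3 → (∀ a ∈ Tg, a ≠ s₀ → (A a).card ≤ 110) →
      (Tg.biUnion A).card ≤ 3450 * t := by
    intro Tg A s₀ hs hc h1 h2
    have h3 : (Tg.biUnion A).card ≤ ∑ a ∈ Tg, (A a).card := Finset.card_biUnion_le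
    rw [← Finset.add_sum_erase _ _ hs] at h3
    have h4 : ∑ a ∈ Tg.erase s₀, (A a).card ≤ (Tg.erase s₀).card * 110 :=
      Finset.sum_le_card_nsmul _ _ _ fun a ha =>
        h2 a (Finset.mem_of_mem_erase ha) (Finset.ne_of_mem_erase ha)
    rw [Finset.card_erase_of_mem hs, hc] at h4
    have := c.s_le
    omega
  have h1 := key _ _ _ c.sideA.star_mem c.sideA.card_eq c.sideA.card_star c.sideA.card_le
  have h2 := key _ _ _ c.sideB.star_mem c.sideB.card_eq c.sideB.card_star c.sideB.card_le
  have := Finset.card_union_le (c.TA.biUnion c.A) (c.SB.biUnion c.B)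
  omega

lemma Config.exists_reserve {t : ℕ} {x : Fin t → V} (c : Config r x) (ht : 1 ≤ t) :
    Nonempty (Reserve c) := by
  have hcore := c.card_core_le ht
  have hB := c.sideB.pick
  have hB' := c.sideB.pick_typical
  simp only [Function.swap] at hB hB'
  obtain ⟨Ch, h1, h2⟩ := exists_disjoint_choice
    (Q := fun (i : Fin t) U => U ⊆ c.D ∧ ∃ p q, ChainAt r (x i) p q U ∧ p ∉ c.EA ∧ q ∉ c.EB)
    4 (10 ^ 6 * t) Finset.univ ∅ (by
      intro i _ Z hZ
      obtain ⟨u, hu, huZ, hux⟩ := c.sideA.pick (x i) Z hZ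
      obtain ⟨w, hw, hwZ, hxw⟩ := hB (x i) Z hZ
      obtain ⟨p, hp, hpE, hpZ, hpu⟩ := c.sideA.pick_typical u hu Z hZ
      obtain ⟨q, hq, hqE, hqZ, hwq⟩ := hB' w hw Z hZ
      refine ⟨{p, u, w, q}, ?_, Finset.card_le_four, ?_, p, q, ⟨u, w, rfl, hpu, hux, hxw, hwq⟩,
        hpE, hqE⟩
      · simp [hpZ, huZ, hwZ, hqZ]
      · simp [Finset.insert_subset_iff, hp, hu, hw, hq])
    (by simp only [Finset.card_empty, Finset.card_univ, Fintype.card_fin]; omega)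
  choose p q hch hp hq using fun i => (h1 i (Finset.mem_univ i)).1.2
  have hsub : ∀ i, Ch i ⊆ c.D := fun i => (h1 i (Finset.mem_univ i)).1.1
  have hCc : (Finset.univ.biUnion Ch).card ≤ 4 * t := by
    refine Finset.card_biUnion_le.trans ((Finset.sum_le_card_nsmul _ _ 4 fun i hi =>
      (h1 i hi).2.2).trans ?_)
    simp [mul_comm]
  have hSc := Finset.card_union_le (c.TA.biUnion c.A ∪ c.SB.biUnion c.B)
    (Finset.univ.biUnion Ch)
  obtain ⟨Un, h3, h4⟩ := exists_disjoint_choice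
    (Q := fun (σ : V) U => U ⊆ c.D ∧ ∃ p p' q q', UnitAt r σ p p' q q' U ∧ p ∈ c.D ∧ p ∉ c.EA ∧
      p' ∈ c.D ∧ p' ∉ c.EA ∧ q ∈ c.D ∧ q ∉ c.EB ∧ q' ∈ c.D ∧ q' ∉ c.EB)
    6 (10 ^ 6 * t) ((c.TA.biUnion c.A ∪ c.SB.biUnion c.B) ∪ Finset.univ.biUnion Ch)
    (Finset.univ.biUnion Ch) (by
      intro σ _ Z hZ
      obtain ⟨u, hu, huZ, hux⟩ := c.sideA.pick σ Z hZ
      obtain ⟨w, hw, hwZ, hxw⟩ := hB σ Z hZ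
      obtain ⟨p, hp, hpE, hpZ, hpu⟩ := c.sideA.pick_typical u hu Z hZ
      obtain ⟨p', hp', hpE', hpZ', hpu'⟩ := c.sideA.pick_typical w hw Z hZ
      obtain ⟨q, hq, hqE, hqZ, hwq⟩ := hB' u hu Z hZ
      obtain ⟨q', hq', hqE', hqZ', hwq'⟩ := hB' w hw Z hZ
      refine ⟨{p, u, q, p', w, q'}, ?_, Finset.card_le_six, ?_, p, p', q, q',
        ⟨u, w, rfl, hpu, hux, hwq, hpu', hxw, hwq'⟩, hp, hpE, hp', hpE', hq, hqE, hq', hqE'⟩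
      · simp [hpZ, huZ, hwZ, hqZ, hpZ', hqZ']
      · simp [Finset.insert_subset_iff, hp, hu, hw, hq, hp', hq'])
    (by omega)
  refine ⟨⟨Ch, p, q, Un, hch, hsub, fun i => ⟨hsub i ?_, hp i⟩, fun i => ⟨hsub i ?_, hq i⟩,
    fun i j hij => h2 i (Finset.mem_univ i) j (Finset.mem_univ j) hij, fun σ hσ => (h3 σ hσ).1.2,
    fun σ hσ => (h3 σ hσ).1.1, fun σ hσ => (h3 σ hσ).2.2, h4, fun σ hσ => (h3 σ hσ).2.1⟩⟩
  · obtain ⟨u, w, hU, -⟩ := hch i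
    simp [hU]
  · obtain ⟨u, w, hU, -⟩ := hch i
    simp [hU]

end CyclePartition

namespace CyclePartition

open scoped Classical

variable {V : Type*} [Fintype V]
variable {r : V → V → Prop} {W W' K L : Finset V} {a b x y : V}

lemma exists_link {r' : V → V → Prop} {z : V} {D B Z : Finset V}
    (hroot : 10 * (Finset.univ.filter (fun v => ¬ r z v)).card ≤ 6 * Fintype.card V)
    (hund : 100 * (undom r' D B).card ≤ Fintype.card V)
    (hZ : 10 * ((Finset.univ \ D).card + Z.card) < 3 * Fintype.card V) :
    ∃ f ∈ D, f ∉ Z ∧ r z f ∧ ∃ v ∈ B, r' v f := by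
  have h1 := Finset.card_filter_add_card_filter_not (s := (Finset.univ : Finset V))
    (fun v => r z v)
  rw [Finset.card_univ] at h1
  have h2 := Finset.le_card_sdiff (undom r' D B) (Finset.univ.filter (fun v => r z v))
  obtain ⟨f, hf, hfD, hfZ⟩ := exists_mem_of_card_lt
    (X := Finset.univ.filter (fun v => r z v) \ undom r' D B) (D := D) (Z := Z) (by omega)
  rw [Finset.mem_sdiff, Finset.mem_filter, mem_undom, not_and] at hf
  have h3 := hf.2 hfD
  push Not at h3
  exact ⟨f, hfD, hfZ, hf.1.2, h3⟩

variable {t : ℕ} {X : Fin t → V}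

namespace Config

/-- All vertices of the dominating and dominated sets. -/
noncomputable def core (c : Config r X) : Finset V := c.TA.biUnion c.A ∪ c.SB.biUnion c.B

lemma mem_D (c : Config r X) {v : V} : v ∈ c.D ↔ (∀ i, v ≠ X i) ∧ v ∉ c.core := by
  rw [c.D_eq, core]
  simp only [Finset.mem_sdiff, Finset.mem_univ, true_and, Finset.mem_union, Finset.mem_image]
  constructor
  · intro h
    refine ⟨?_, by tauto⟩
    rintro i rfl
    exact h (Or.inl (Or.inl ⟨i, rfl⟩))
  · rintro ⟨h1, h2⟩ h3
    rcases h3 with (⟨i, rfl⟩ | h3) | h3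
    · exact h1 i rfl
    · exact h2 (Or.inl h3)
    · exact h2 (Or.inr h3)

lemma TA_subset (c : Config r X) : c.TA ⊆ c.core := fun a ha =>
  Finset.mem_union_left _ (Finset.mem_biUnion.2 ⟨a, ha, c.sideA.entry_mem a ha⟩)

lemma SB_subset (c : Config r X) : c.SB ⊆ c.core := fun a ha =>
  Finset.mem_union_right _ (Finset.mem_biUnion.2 ⟨a, ha, c.sideB.entry_mem a ha⟩)

lemma A_subset (c : Config r X) (ha : a ∈ c.TA) : c.A a ⊆ c.core := fun _ hv =>
  Finset.mem_union_left _ (Finset.mem_biUnion.2 ⟨a, ha, hv⟩)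

lemma B_subset (c : Config r X) (ha : a ∈ c.SB) : c.B a ⊆ c.core := fun _ hv =>
  Finset.mem_union_right _ (Finset.mem_biUnion.2 ⟨a, ha, hv⟩)

lemma A_disj_B (c : Config r X) (ha : a ∈ c.TA) (hb : b ∈ c.SB) : Disjoint (c.A a) (c.B b) := by
  refine Disjoint.symm ((c.sideB.disjZ b hb).mono_right ?_)
  exact (Finset.subset_biUnion_of_mem c.A ha).trans Finset.subset_union_right

lemma X_notMem_core (c : Config r X) (i : Fin t) : X i ∉ c.core := by
  intro h
  have hX : X i ∈ Finset.univ.image X := Finset.mem_image_of_mem _ (Finset.mem_univ i)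
  rcases Finset.mem_union.1 h with h | h
  · obtain ⟨a, ha, h⟩ := Finset.mem_biUnion.1 h
    exact Finset.disjoint_left.1 (c.sideA.disjZ a ha) h hX
  · obtain ⟨a, ha, h⟩ := Finset.mem_biUnion.1 h
    exact Finset.disjoint_left.1 (c.sideB.disjZ a ha) h (Finset.mem_union_left _ hX)

lemma card_compl_D (c : Config r X) (ht : 1 ≤ t) : (Finset.univ \ c.D).card ≤ 7000 * t := by
  have h1 : Finset.univ \ c.D ⊆ Finset.univ.image X ∪ c.core := by
    intro v hv
    rw [Finset.mem_sdiff, c.mem_D] at hv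
    by_contra hcon
    rw [Finset.mem_union, not_or, Finset.mem_image] at hcon
    exact hv.2 ⟨fun i hi => hcon.1 ⟨i, Finset.mem_univ i, hi.symm⟩, hcon.2⟩
  have h2 := (Finset.card_le_card h1).trans (Finset.card_union_le _ _)
  have h3 : (Finset.univ.image X).card ≤ t := Finset.card_image_le.trans (by simp)
  have h4 : c.core.card ≤ 6900 * t := c.card_core_le ht
  omega

lemma exists_link_out (c : Config r X) (ha : a ∈ c.TA) (hb : b ∈ c.SB) (Z : Finset V)
    (hZ : 10 * ((Finset.univ \ c.D).card + Z.card) < 3 * Fintype.card V) :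
    ∃ f ∈ c.D, f ∉ Z ∧ r (c.rA a) f ∧ ∃ v ∈ c.B b, r f v :=
  exists_link (c.sideA.root_out a ha) (c.sideB.undom_le b hb) hZ

lemma exists_link_in (c : Config r X) (ha : a ∈ c.TA) (hb : b ∈ c.SB) (Z : Finset V)
    (hZ : 10 * ((Finset.univ \ c.D).card + Z.card) < 3 * Fintype.card V) :
    ∃ g ∈ c.D, g ∉ Z ∧ r g (c.rB b) ∧ ∃ v ∈ c.A a, r v g :=
  exists_link (r := Function.swap r) (c.sideB.root_out b hb) (c.sideA.undom_le a ha) hZ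

end Config

namespace Reserve

variable {c : Config r X}

/-- The vertices carrying a unit. -/
noncomputable def sig (ρ : Reserve c) : Finset V := c.core ∪ Finset.univ.biUnion ρ.Ch

/-- The vertices kept away from the linking paths. -/
noncomputable def off (ρ : Reserve c) : Finset V :=
  Finset.univ.image X ∪ (ρ.sig \ (c.TA ∪ c.SB) ∪ ρ.sig.biUnion ρ.Un)

lemma Ch_card (ρ : Reserve c) (i : Fin t) : (ρ.Ch i).card ≤ 4 := by
  obtain ⟨u, w, h, -⟩ := ρ.chain i
  rw [h]
  exact Finset.card_le_four

lemma card_sig (ρ : Reserve c) (ht : 1 ≤ t) : ρ.sig.card ≤ 6904 * t := by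
  have h1 : c.core.card ≤ 6900 * t := c.card_core_le ht
  have h2 : (Finset.univ.biUnion ρ.Ch).card ≤ 4 * t := by
    refine Finset.card_biUnion_le.trans ((Finset.sum_le_card_nsmul _ _ 4 fun i _ =>
      ρ.Ch_card i).trans ?_)
    simp [mul_comm]
  have := Finset.card_union_le c.core (Finset.univ.biUnion ρ.Ch)
  rw [sig]
  omega

lemma card_off (ρ : Reserve c) (ht : 1 ≤ t) : ρ.off.card ≤ 50000 * t := by
  have h1 := ρ.card_sig ht
  have h2 : (Finset.univ.image X).card ≤ t := Finset.card_image_le.trans (by simp)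
  have h3 : (ρ.sig.biUnion ρ.Un).card ≤ ρ.sig.card * 6 :=
    Finset.card_biUnion_le.trans (Finset.sum_le_card_nsmul _ _ 6 ρ.unit_card)
  have h4 := Finset.card_union_le (Finset.univ.image X)
    (ρ.sig \ (c.TA ∪ c.SB) ∪ ρ.sig.biUnion ρ.Un)
  have h5 := Finset.card_union_le (ρ.sig \ (c.TA ∪ c.SB)) (ρ.sig.biUnion ρ.Un)
  have h6 := Finset.card_le_card (Finset.sdiff_subset (s := ρ.sig) (t := c.TA ∪ c.SB))
  rw [off]
  omega

lemma ends_disjoint_off (ρ : Reserve c) : Disjoint (c.TA ∪ c.SB) ρ.off := by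
  rw [Finset.disjoint_left]
  intro v hv hvo
  have hvc : v ∈ c.core := Finset.union_subset c.TA_subset c.SB_subset hv
  rw [off, Finset.mem_union, Finset.mem_union, Finset.mem_sdiff] at hvo
  rcases hvo with h | h | h
  · obtain ⟨i, -, rfl⟩ := Finset.mem_image.1 h
    exact c.X_notMem_core i hvc
  · exact h.2 hv
  · obtain ⟨σ, hσ, h⟩ := Finset.mem_biUnion.1 h
    exact (c.mem_D.1 (ρ.unit_sub σ hσ h)).2 hvc

/-- When the ends `b` and `a` of a linking path may serve an index. -/
def Compat (ρ : Reserve c) : Option (Fin t) → V → V → Prop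
  | none, b, a => b = c.bs ∨ a = c.as
  | some i, b, a => b ≠ c.bs ∧ a ≠ c.as ∧ (∃ v ∈ c.A a, r v (ρ.p i)) ∧ ∃ v ∈ c.B b, r (ρ.q i) v

/-- What a linking path serving an index provides. -/
def Served (ρ : Reserve c) (ℓ : Fin t → ℕ) (h : ℕ) : Option (Fin t) → V → V → Finset V → Prop
  | none, b, a, R => Between r b a R
  | some i, b, a, R =>
    (b ∈ R ∧ a ∈ R ∧
      Strong r ((c.A a ∪ (c.B b ∪ R)) ∪ insert (X i) (ρ.Ch i)) ∧
      (ℓ i < 1000 * h → ((c.A a ∪ (c.B b ∪ R)) ∪ insert (X i) (ρ.Ch i)).card ≤ ℓ i)) ∨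
    (ℓ i < 1000 * h ∧ ∃ C, X i ∈ C ∧ C.card = ℓ i ∧ Cyc r C ∧ R ⊆ C ∧
      C ⊆ ((c.A a).erase a ∪ ((c.B b).erase b ∪ R)) ∪ insert (X i) (ρ.Ch i))

lemma served_of_between (ρ : Reserve c) (hT : Tourn r) {ℓ : Fin t → ℕ} (hℓ : ∀ i, 3 ≤ ℓ i)
    (h bd : ℕ) (ht : 1 ≤ t) (hbd : 10 * (7000 * t + bd) < 3 * Fintype.card V)
    (o : Option (Fin t)) (hb : b ∈ c.SB) (ha : a ∈ c.TA) (hc : ρ.Compat o b a) (G P : Finset V)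
    (hPG : P ⊆ G) (hG : (Finset.univ \ G).card ≤ bd) (hP : Between r b a P) :
    ∃ R ⊆ G, (R \ P).card ≤ 2 ∧ Disjoint (R \ P) (c.SB ∪ c.TA) ∧ ρ.Served ℓ h o b a R := by
  rcases o with _ | i
  · exact ⟨P, hPG, by simp, by simp, hP⟩
  obtain ⟨-, -, hp, hq⟩ := hc
  have hD := c.card_compl_D ht
  obtain ⟨f, hfD, hfG, hf, hf'⟩ := c.exists_link_out ha hb (Finset.univ \ G) (by omega)
  obtain ⟨g, hgD, hgG, hg, hg'⟩ := c.exists_link_in ha hb (Finset.univ \ G) (by omega)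
  have hS := hP.strong (c.sideA.fan ha) (c.sideB.fan_swap hb) hf hg hf' hg'
  have hS' := (ρ.chain i).strong_union hS
    (by obtain ⟨v, hv, h⟩ := hp; exact ⟨v, Finset.mem_union_left _ hv, h⟩)
    (by obtain ⟨v, hv, h⟩ := hq
        exact ⟨v, Finset.mem_union_right _ (Finset.mem_union_left _ hv), h⟩)
  have hRG : P ∪ {f, g} ⊆ G := by
    refine Finset.union_subset hPG ?_
    simp only [Finset.mem_sdiff, Finset.mem_univ, true_and, not_not] at hfG hgG
    simp [Finset.insert_subset_iff, hfG, hgG]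
  have hRP : (P ∪ {f, g}) \ P ⊆ {f, g} := by
    intro v hv
    rw [Finset.mem_sdiff, Finset.mem_union] at hv
    tauto
  have hdisj : Disjoint ({f, g} : Finset V) (c.SB ∪ c.TA) := by
    rw [Finset.disjoint_left]
    intro v hv hv'
    have hvc : v ∈ c.core := Finset.union_subset c.SB_subset c.TA_subset hv'
    rw [Finset.mem_insert, Finset.mem_singleton] at hv
    rcases hv with rfl | rfl
    · exact (c.mem_D.1 hfD).2 hvc
    · exact (c.mem_D.1 hgD).2 hvc
  by_cases hbig : ℓ i < 1000 * h →
      ((c.A a ∪ (c.B b ∪ (P ∪ {f, g}))) ∪ insert (X i) (ρ.Ch i)).card ≤ ℓ i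
  · exact ⟨P ∪ {f, g}, hRG, (Finset.card_le_card hRP).trans Finset.card_le_two,
      hdisj.mono_left hRP, Or.inl ⟨Finset.mem_union_left _ hP.1,
      Finset.mem_union_left _ hP.2.1, hS', hbig⟩⟩
  · push Not at hbig
    obtain ⟨C, hC, hxC, hCc, hcyc⟩ := exists_cyc hT hS' (x := X i) (by simp) (hℓ i) hbig.2.le
    have hRP' : (C ∩ (P ∪ {f, g})) \ P ⊆ {f, g} :=
      (Finset.sdiff_subset_sdiff Finset.inter_subset_right le_rfl).trans hRP
    refine ⟨C ∩ (P ∪ {f, g}), Finset.inter_subset_right.trans hRG,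
      (Finset.card_le_card hRP').trans Finset.card_le_two, hdisj.mono_left hRP',
      Or.inr ⟨hbig.1, C, hxC, hCc, hcyc, Finset.inter_subset_left, ?_⟩⟩
    intro v hv
    have haQ : a ∈ P ∪ {f, g} := Finset.mem_union_left _ hP.2.1
    have hbQ : b ∈ P ∪ {f, g} := Finset.mem_union_left _ hP.1
    have hvC := hC hv
    generalize P ∪ {f, g} = Q at hvC haQ hbQ ⊢
    rcases Finset.mem_union.1 hvC with h1 | h1
    · refine Finset.mem_union_left _ ?_
      by_cases hvQ : v ∈ Q
      · exact Finset.mem_union_right _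
          (Finset.mem_union_right _ (Finset.mem_inter.2 ⟨hv, hvQ⟩))
      rcases Finset.mem_union.1 h1 with h1 | h1
      · exact Finset.mem_union_left _ (Finset.mem_erase.2 ⟨fun h => hvQ (h ▸ haQ), h1⟩)
      · exact Finset.mem_union_right _ (Finset.mem_union_left _ (Finset.mem_erase.2
          ⟨fun h => hvQ (h ▸ hbQ), (Finset.mem_union.1 h1).resolve_right hvQ⟩))
    · exact Finset.mem_union_right _ h1

end Reserve

/-- How many linking paths an index demands. -/
noncomputable def demand (ℓ : Fin t → ℕ) (h n : ℕ) : Option (Fin t) → ℕ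
  | none => 3
  | some i => if ℓ i < 1000 * h then 1 else 10 * (t * ℓ i / n + 1)

lemma Reserve.exists_linkage {c : Config r X} (ρ : Reserve c) (hT : Tourn r) {ℓ : Fin t → ℕ}
    (hℓ : ∀ i, 3 ≤ ℓ i) (ht : 1 ≤ t) (hn : 10 ^ 50 * t < Fintype.card V)
    (hconn : KC r Finset.univ (10 ^ 50 * t)) {h : ℕ} (hh : h * (10 ^ 40 * t) ≤ Fintype.card V)
    (hh' : Fintype.card V < (h + 1) * (10 ^ 40 * t)) :
    ∃ tgt asg R, Linkage r (demand ℓ h (Fintype.card V)) ρ.Compat (ρ.Served ℓ h) h (10 ^ 49 * t)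
      c.SB c.TA (Finset.univ \ ρ.off) tgt asg R := by
  have hoff := ρ.card_off ht
  have hh0 : 10 ^ 10 ≤ h := by
    by_contra hlt
    have h1 : (h + 1) * (10 ^ 40 * t) ≤ 10 ^ 10 * (10 ^ 40 * t) :=
      Nat.mul_le_mul_right _ (by omega)
    omega
  have hht : t ≤ h * t := Nat.le_mul_of_pos_left _ (by omega)
  have hht' : h ≤ h * t := Nat.le_mul_of_pos_right _ (by omega)
  have e1 : h * (10 ^ 40 * t) = 10 ^ 40 * (h * t) := by ring
  have hbd : (Finset.univ \ (Finset.univ \ ρ.off)).card + (30 * t + 1) * (h + 2) ≤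
      50000 * t + (30 * t + 1) * (h + 2) := by
    rw [Finset.sdiff_sdiff_eq_self (Finset.subset_univ _)]
    omega
  have e2 : (30 * t + 1) * (h + 2) = 30 * (h * t) + 60 * t + h + 2 := by ring
  have hdis := ρ.ends_disjoint_off
  have hsub : ∀ T ⊆ c.TA ∪ c.SB, T ⊆ Finset.univ \ ρ.off := by
    intro T hT v hv
    exact Finset.mem_sdiff.2 ⟨Finset.mem_univ _, Finset.disjoint_left.1 hdis (hT hv)⟩
  refine CyclePartition.exists_linkage hT ρ.Compat (ρ.Served ℓ h) h (10 ^ 49 * t)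
    (50000 * t + (30 * t + 1) * (h + 2)) (by omega) ?_ c.SB c.TA ?_ (30 * t + 1) _ c.SB c.TA
    (Finset.univ \ ρ.off) c.sideB.card_eq c.sideA.card_eq
    (hsub _ Finset.subset_union_right) (hsub _ Finset.subset_union_left) le_rfl le_rfl
    (hconn.sdiff (by omega)) hbd
  · have h1 : (h + 1) * (10 ^ 40 * t) ≤ ((h - 1) * 10 ^ 9) * (10 ^ 40 * t) :=
      Nat.mul_le_mul_right _ (by omega)
    have h2 : ((h - 1) * 10 ^ 9) * (10 ^ 40 * t) = (h - 1) * (10 ^ 49 * t) := by ring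
    omega
  · intro o b hb a ha hc G P hPG hG hPh hbP haP hP
    exact ρ.served_of_between hT hℓ h _ ht (by omega) o hb ha hc G P hPG hG ⟨hbP, haP, hP⟩

end CyclePartition

namespace CyclePartition

open scoped Classical

variable {V : Type*} [Fintype V]
variable {r : V → V → Prop} {W W' K L : Finset V} {a b x y : V}
variable {t : ℕ} {X : Fin t → V} {c : Config r X} {ρ : Reserve c} {ℓ : Fin t → ℕ} {h : ℕ}

lemma sum_demand_le (hsum : ∑ i, ℓ i = Fintype.card V) (hn : 0 < Fintype.card V) :
    ∑ i, demand ℓ h (Fintype.card V) (some i) ≤ 20 * t := by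
  have h1 : ∀ i, demand ℓ h (Fintype.card V) (some i) ≤
      10 * (t * ℓ i / Fintype.card V) + 10 := by
    intro i
    rw [demand]
    split_ifs <;> omega
  refine (Finset.sum_le_sum fun i _ => h1 i).trans ?_
  rw [Finset.sum_add_distrib, ← Finset.mul_sum]
  have h2 : ∑ i, t * ℓ i / Fintype.card V ≤ t := by
    have h3 : (∑ i, t * ℓ i / Fintype.card V) * Fintype.card V ≤ t * Fintype.card V := by
      rw [Finset.sum_mul, ← hsum, Finset.mul_sum, hsum]
      exact Finset.sum_le_sum fun i _ => Nat.div_mul_le_self _ _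
    exact Nat.le_of_mul_le_mul_right h3 hn
  simp only [Finset.sum_const, Finset.card_univ, Fintype.card_fin, smul_eq_mul]
  omega

lemma card_filter_misses_le {V : Type*} {r : V → V → Prop} {S T : Finset V} {A : V → Finset V}
    {s v : V} {f : V → V}
    (hf : ∀ b ∈ S, f b ∈ T) (hinj : Set.InjOn f S) :
    (S.filter (fun b => f b ≠ s ∧ Misses r (A (f b)) v)).card ≤ badCount r T A s v := by
  rw [badCount]
  refine Finset.card_le_card_of_injOn f ?_ (hinj.mono ?_)
  · intro b hb
    rw [Finset.mem_coe, Finset.mem_filter] at hb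
    rw [Finset.mem_coe, Finset.mem_filter, Finset.mem_erase]
    exact ⟨⟨hb.2.1, hf b hb.1⟩, hb.2.2⟩
  · intro b hb
    rw [Finset.mem_coe, Finset.mem_filter] at hb
    exact hb.1

lemma Linkage.count_eq {tgt : V → V} {asg : V → Option (Option (Fin t))} {R : V → Finset V}
    {k : ℕ} {G : Finset V} (hL : Linkage r (demand ℓ h (Fintype.card V)) ρ.Compat
      (ρ.Served ℓ h) h k c.SB c.TA G tgt asg R)
    (hsum : ∑ i, ℓ i = Fintype.card V) (hn : 0 < Fintype.card V) (i : Fin t) :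
    (c.SB.filter (fun b => asg b = some (some i))).card =
      demand ℓ h (Fintype.card V) (some i) := by
  have hle : ∀ o, (c.SB.filter (fun b => asg b = some o)).card ≤
      demand ℓ h (Fintype.card V) o := fun o => by convert hL.le_dem o
  refine le_antisymm (hle _) ?_
  by_contra hlt
  push Not at hlt
  have hmax := hL.maximal (some i) (lt_of_le_of_lt (le_of_eq (by convert rfl)) hlt)
  have hsub : c.SB.filter (fun b => asg b = none) ⊆
      (c.SB.filter (fun b => b = c.bs) ∪ c.SB.filter (fun b => tgt b = c.as)) ∪
      (c.SB.filter (fun b => tgt b ≠ c.as ∧ Misses r (c.A (tgt b)) (ρ.p i)) ∪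
        c.SB.filter (fun b => b ≠ c.bs ∧ Misses (Function.swap r) (c.B b) (ρ.q i))) := by
    intro b hb
    rw [Finset.mem_filter] at hb
    have h1 := hmax b hb.1 hb.2
    simp only [Finset.mem_union, Finset.mem_filter, hb.1, true_and]
    by_contra hcon
    push Not at hcon
    obtain ⟨⟨h2, h3⟩, h4, h5⟩ := hcon
    have h4 := h4 h3
    have h5 := h5 h2
    simp only [Misses, not_forall, not_not] at h4 h5
    obtain ⟨u, hu, hu'⟩ := h4
    obtain ⟨w, hw, hw'⟩ := h5
    exact h1 ⟨h2, h3, ⟨u, hu, hu'⟩, w, hw, hw'⟩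
  have c1 : (c.SB.filter (fun b => b = c.bs)).card ≤ 1 := by
    rw [Finset.card_le_one]
    intro b hb b' hb'
    rw [Finset.mem_filter] at hb hb'
    rw [hb.2, hb'.2]
  have c2 : (c.SB.filter (fun b => tgt b = c.as)).card ≤ 1 := by
    rw [Finset.card_le_one]
    intro b hb b' hb'
    rw [Finset.mem_filter] at hb hb'
    exact hL.tgt_inj hb.1 hb'.1 (hb.2.trans hb'.2.symm)
  have c3 := card_filter_misses_le (r := r) (A := c.A) (s := c.as) (v := ρ.p i) hL.tgt_mem
    hL.tgt_inj
  have c4 := card_filter_misses_le (r := Function.swap r) (S := c.SB) (T := c.SB) (A := c.B)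
    (s := c.bs) (v := ρ.q i) (f := id) (fun _ h => h) Function.injective_id.injOn
  simp only [id] at c4
  have c5 := c.sideA.bad_lt _ (ρ.p_mem i).1 (ρ.p_mem i).2
  have c6 := c.sideB.bad_lt _ (ρ.q_mem i).1 (ρ.q_mem i).2
  have c7 := (Finset.card_le_card hsub).trans (Finset.card_union_le _ _)
  have c8 := Finset.card_union_le (c.SB.filter (fun b => b = c.bs))
    (c.SB.filter (fun b => tgt b = c.as))
  have c9 := Finset.card_union_le
    (c.SB.filter (fun b => tgt b ≠ c.as ∧ Misses r (c.A (tgt b)) (ρ.p i)))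
    (c.SB.filter (fun b => b ≠ c.bs ∧ Misses (Function.swap r) (c.B b) (ρ.q i)))
  have d1 : c.SB.card = ∑ o : Option (Option (Fin t)), (c.SB.filter (fun b => asg b = o)).card :=
    Finset.card_eq_sum_card_fiberwise fun _ _ => Finset.mem_coe.2 (Finset.mem_univ _)
  rw [Fintype.sum_option, Fintype.sum_option, c.sideB.card_eq] at d1
  have d2 := hle none
  have d3 : ∑ j, (c.SB.filter (fun b => asg b = some (some j))).card <
      ∑ j, demand ℓ h (Fintype.card V) (some j) :=
    Finset.sum_lt_sum (fun j _ => hle _) ⟨i, Finset.mem_univ i, hlt⟩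
  have d4 := sum_demand_le (h := h) hsum hn
  have d5 : demand ℓ h (Fintype.card V) none = 3 := rfl
  omega

lemma Linkage.star_assigned {tgt : V → V} {asg : V → Option (Option (Fin t))}
    {R : V → Finset V} {k : ℕ} {G : Finset V} (hL : Linkage r (demand ℓ h (Fintype.card V))
      ρ.Compat (ρ.Served ℓ h) h k c.SB c.TA G tgt asg R) (hb : b ∈ c.SB) :
    asg b = some none ↔ b = c.bs ∨ tgt b = c.as := by
  refine ⟨fun h => (hL.good b hb _ h).1, fun hs => ?_⟩
  rcases ha : asg b with _ | _ | i
  · exfalso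
    refine hL.maximal none ?_ b hb ha hs
    have hsub : c.SB.filter (fun b => asg b = some none) ⊆
        c.SB.filter (fun b => b = c.bs) ∪ c.SB.filter (fun b => tgt b = c.as) := by
      intro b hb
      rw [Finset.mem_filter] at hb
      have := (hL.good b hb.1 _ hb.2).1
      rw [Finset.mem_union, Finset.mem_filter, Finset.mem_filter]
      exact this.imp (fun h => ⟨hb.1, h⟩) fun h => ⟨hb.1, h⟩
    have c1 : (c.SB.filter (fun b => b = c.bs)).card ≤ 1 := by
      rw [Finset.card_le_one]
      intro b hb b' hb'
      rw [Finset.mem_filter] at hb hb'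
      rw [hb.2, hb'.2]
    have c2 : (c.SB.filter (fun b => tgt b = c.as)).card ≤ 1 := by
      rw [Finset.card_le_one]
      intro b hb b' hb'
      rw [Finset.mem_filter] at hb hb'
      exact hL.tgt_inj hb.1 hb'.1 (hb.2.trans hb'.2.symm)
    have c3 := (Finset.card_le_card hsub).trans (Finset.card_union_le _ _)
    refine lt_of_le_of_lt (b := 2) ?_ (by rw [demand]; omega)
    convert c3.trans (Nat.add_le_add c1 c2)
  · rfl
  · have := (hL.good b hb _ ha).1
    exact absurd hs (not_or.2 ⟨this.1, this.2.1⟩)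

/-- Disjoint strongly connected beginnings of the parts, together with what is left over. -/
structure Start (ρ : Reserve c) (ℓ : Fin t → ℕ) (h : ℕ) where
  W : Fin t → Finset V
  done : Fin t → Prop
  J : Fin t → Finset V
  tgt : V → V
  R : V → Finset V
  b₁ : V
  U : Finset V
  tgt_mem : ∀ b ∈ c.SB, tgt b ∈ c.TA
  tgt_inj : Set.InjOn tgt c.SB
  J_sub : ∀ i, J i ⊆ c.SB
  J_ne : ∀ i, ∀ b ∈ J i, b ≠ c.bs ∧ tgt b ≠ c.as
  J_disj : ∀ i j, i ≠ j → Disjoint (J i) (J j)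
  J_card : ∀ i, (J i).card = demand ℓ h (Fintype.card V) (some i)
  mem : ∀ i, X i ∈ W i
  done_cyc : ∀ i, done i → (W i).card = ℓ i ∧ Cyc r (W i)
  done_lt : ∀ i, done i → ℓ i < 1000 * h
  strong : ∀ i, ¬ done i → Strong r (W i)
  sub : ∀ i, ¬ done i → ∀ b ∈ J i, c.A (tgt b) ⊆ W i ∧ c.B b ⊆ W i
  card_lt : ∀ i, ℓ i < 1000 * h → (W i).card ≤ ℓ i
  card_big : ∀ i, 1000 * h ≤ ℓ i → 40 * (W i).card ≤ ℓ i
  disj : ∀ i j, i ≠ j → Disjoint (W i) (W j)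
  disj_unit : ∀ i, ∀ σ ∈ ρ.sig, Disjoint (W i) (ρ.Un σ)
  b₁_mem : b₁ ∈ c.SB
  tgt_b₁ : tgt b₁ = c.as
  betw₁ : Between r b₁ c.as (R b₁)
  betw : Between r c.bs (tgt c.bs) (R c.bs)
  disj_ear : ∀ i, ∀ b ∈ c.SB, b = c.bs ∨ tgt b = c.as →
    Disjoint (W i) (c.A (tgt b) ∪ (c.B b ∪ R b))
  ear_unit : ∀ σ ∈ ρ.sig, ∀ b ∈ c.SB, Disjoint (R b) (ρ.Un σ)
  card_R : ∀ b ∈ c.SB, (R b).card ≤ h + 2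
  conn : KC r U (10 ^ 49 * t)
  cover : ∀ v, v ∉ ρ.off → v ∉ U → (∃ i, v ∈ W i) ∨ v ∈ R b₁ ∨ v ∈ R c.bs
  small : ∀ v ∈ U, (∃ i, v ∈ W i) ∨ v ∈ R b₁ ∨ v ∈ R c.bs → v ∈ c.TA ∪ c.SB

namespace Reserve

/-- The part of the dominating and dominated sets at `a`, `b` used together with a linking
path. -/
noncomputable def piece (c : Config r X) (a b : V) (P : Finset V) : Finset V :=
  (c.A a).erase a ∪ ((c.B b).erase b ∪ P)

lemma subset_piece {P : Finset V} (haP : a ∈ P) (hbP : b ∈ P) :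
    c.A a ∪ (c.B b ∪ P) ⊆ piece c a b P := by
  intro v hv
  simp only [piece, Finset.mem_union, Finset.mem_erase] at hv ⊢
  by_cases h1 : v = a
  · subst h1; exact Or.inr (Or.inr haP)
  by_cases h2 : v = b
  · subst h2; exact Or.inr (Or.inr hbP)
  tauto

lemma mem_off_of_mem_core (ρ : Reserve c) {v : V} (hv : v ∈ c.core) (hA : v ∉ c.TA)
    (hB : v ∉ c.SB) : v ∈ ρ.off := by
  refine Finset.mem_union_right _ (Finset.mem_union_left _ (Finset.mem_sdiff.2 ⟨?_, ?_⟩))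
  · exact Finset.mem_union_left _ hv
  · rw [Finset.mem_union, not_or]
    exact ⟨hA, hB⟩

lemma eraseA_subset (ρ : Reserve c) (ha : a ∈ c.TA) : (c.A a).erase a ⊆ ρ.off := by
  intro v hv
  rw [Finset.mem_erase] at hv
  refine ρ.mem_off_of_mem_core (c.A_subset ha hv.2) (fun h => ?_) fun h => ?_
  · exact Finset.disjoint_left.1 (c.sideA.disj v h a ha hv.1) (c.sideA.entry_mem v h) hv.2
  · exact Finset.disjoint_left.1 (c.A_disj_B ha h) hv.2 (c.sideB.entry_mem v h)

lemma eraseB_subset (ρ : Reserve c) (hb : b ∈ c.SB) : (c.B b).erase b ⊆ ρ.off := by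
  intro v hv
  rw [Finset.mem_erase] at hv
  refine ρ.mem_off_of_mem_core (c.B_subset hb hv.2) (fun h => ?_) fun h => ?_
  · exact Finset.disjoint_left.1 (c.A_disj_B h hb) (c.sideA.entry_mem v h) hv.2
  · exact Finset.disjoint_left.1 (c.sideB.disj v h b hb hv.1) (c.sideB.entry_mem v h) hv.2

lemma Ch_subset_off (ρ : Reserve c) (i : Fin t) : ρ.Ch i ⊆ ρ.off := by
  intro v hv
  refine Finset.mem_union_right _ (Finset.mem_union_left _ (Finset.mem_sdiff.2 ⟨?_, ?_⟩))
  · exact Finset.mem_union_right _ (Finset.mem_biUnion.2 ⟨i, Finset.mem_univ i, hv⟩)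
  · exact fun h => (c.mem_D.1 (ρ.chain_sub i hv)).2
      (Finset.union_subset c.TA_subset c.SB_subset h)

lemma X_mem_off (ρ : Reserve c) (i : Fin t) : X i ∈ ρ.off :=
  Finset.mem_union_left _ (Finset.mem_image_of_mem _ (Finset.mem_univ i))

lemma Un_subset_off (ρ : Reserve c) {σ : V} (hσ : σ ∈ ρ.sig) : ρ.Un σ ⊆ ρ.off := fun _ hv =>
  Finset.mem_union_right _ (Finset.mem_union_right _ (Finset.mem_biUnion.2 ⟨σ, hσ, hv⟩))

lemma piece_subset (ρ : Reserve c) (ha : a ∈ c.TA) (hb : b ∈ c.SB) {P : Finset V}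
    {v : V} (hv : v ∈ piece c a b P) : (v ∈ c.core ∧ v ∈ ρ.off) ∨ v ∈ P := by
  simp only [piece, Finset.mem_union] at hv
  rcases hv with h | h | h
  · exact Or.inl ⟨c.A_subset ha (Finset.mem_of_mem_erase h), ρ.eraseA_subset ha h⟩
  · exact Or.inl ⟨c.B_subset hb (Finset.mem_of_mem_erase h), ρ.eraseB_subset hb h⟩
  · exact Or.inr h

lemma piece_disjoint (ρ : Reserve c) {a' b' : V} (ha : a ∈ c.TA) (hb : b ∈ c.SB)
    (ha' : a' ∈ c.TA) (hb' : b' ∈ c.SB) (hab : a ≠ a') (hbb : b ≠ b') {P P' : Finset V}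
    (hP : P ⊆ Finset.univ \ ρ.off) (hP' : P' ⊆ Finset.univ \ ρ.off) (hPP : Disjoint P P') :
    Disjoint (piece c a b P) (piece c a' b' P') := by
  rw [Finset.disjoint_left]
  intro v hv hv'
  have hn : v ∈ ρ.off → v ∉ P ∧ v ∉ P' := fun h =>
    ⟨fun h1 => (Finset.mem_sdiff.1 (hP h1)).2 h, fun h1 => (Finset.mem_sdiff.1 (hP' h1)).2 h⟩
  simp only [piece, Finset.mem_union] at hv hv'
  rcases hv with h | h | h <;> rcases hv' with h' | h' | h'
  · exact Finset.disjoint_left.1 (c.sideA.disj a ha a' ha' hab) (Finset.mem_of_mem_erase h)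
      (Finset.mem_of_mem_erase h')
  · exact Finset.disjoint_left.1 (c.A_disj_B ha hb') (Finset.mem_of_mem_erase h)
      (Finset.mem_of_mem_erase h')
  · exact (hn (ρ.eraseA_subset ha h)).2 h'
  · exact Finset.disjoint_left.1 (c.A_disj_B ha' hb) (Finset.mem_of_mem_erase h')
      (Finset.mem_of_mem_erase h)
  · exact Finset.disjoint_left.1 (c.sideB.disj b hb b' hb' hbb) (Finset.mem_of_mem_erase h)
      (Finset.mem_of_mem_erase h')
  · exact (hn (ρ.eraseB_subset hb h)).2 h'
  · exact (hn (ρ.eraseA_subset ha' h')).1 h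
  · exact (hn (ρ.eraseB_subset hb' h')).1 h
  · exact Finset.disjoint_left.1 hPP h h'

lemma piece_disjoint_chain (ρ : Reserve c) (ha : a ∈ c.TA) (hb : b ∈ c.SB) (i : Fin t)
    {P : Finset V} (hP : P ⊆ Finset.univ \ ρ.off) :
    Disjoint (piece c a b P) (insert (X i) (ρ.Ch i)) := by
  rw [Finset.disjoint_left]
  intro v hv hv'
  rcases ρ.piece_subset ha hb hv with ⟨h, -⟩ | h
  · rcases Finset.mem_insert.1 hv' with rfl | h'
    · exact c.X_notMem_core i h
    · exact (c.mem_D.1 (ρ.chain_sub i h')).2 h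
  · refine (Finset.mem_sdiff.1 (hP h)).2 ?_
    rcases Finset.mem_insert.1 hv' with rfl | h'
    · exact ρ.X_mem_off i
    · exact ρ.Ch_subset_off i h'

lemma piece_disjoint_unit (ρ : Reserve c) (ha : a ∈ c.TA) (hb : b ∈ c.SB) {σ : V}
    (hσ : σ ∈ ρ.sig) {P : Finset V} (hP : P ⊆ Finset.univ \ ρ.off) :
    Disjoint (piece c a b P) (ρ.Un σ) := by
  rw [Finset.disjoint_left]
  intro v hv hv'
  rcases ρ.piece_subset ha hb hv with ⟨h, -⟩ | h
  · exact (c.mem_D.1 (ρ.unit_sub σ hσ hv')).2 h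
  · exact (Finset.mem_sdiff.1 (hP h)).2 (ρ.Un_subset_off hσ hv')

lemma chain_disjoint_unit (ρ : Reserve c) {σ : V} (hσ : σ ∈ ρ.sig) (i : Fin t) :
    Disjoint (insert (X i) (ρ.Ch i)) (ρ.Un σ) := by
  rw [Finset.disjoint_left]
  intro v hv hv'
  rcases Finset.mem_insert.1 hv with rfl | h'
  · exact (c.mem_D.1 (ρ.unit_sub σ hσ hv')).1 i rfl
  · exact Finset.disjoint_left.1 (ρ.unit_chain σ hσ) hv'
      (Finset.mem_biUnion.2 ⟨i, Finset.mem_univ i, h'⟩)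

lemma chain_disjoint_chain (ρ : Reserve c) (hX : Function.Injective X) {i j : Fin t}
    (hij : i ≠ j) : Disjoint (insert (X i) (ρ.Ch i)) (insert (X j) (ρ.Ch j)) := by
  have hXC : ∀ i j, X i ∉ ρ.Ch j := fun i j h => (c.mem_D.1 (ρ.chain_sub j h)).1 i rfl
  rw [Finset.disjoint_left]
  intro v hv hv'
  rcases Finset.mem_insert.1 hv with rfl | h <;> rcases Finset.mem_insert.1 hv' with h' | h'
  · exact hij (hX h')
  · exact hXC _ _ h'
  · exact hXC _ _ (h' ▸ h)
  · exact Finset.disjoint_left.1 (ρ.chain_disj i j hij) h h'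

end Reserve

end CyclePartition

namespace CyclePartition

open scoped Classical

variable {V : Type*} [Fintype V]
variable {r : V → V → Prop} {W W' K L : Finset V} {a b x y : V}
variable {t : ℕ} {X : Fin t → V} {c : Config r X} {ρ : Reserve c} {ℓ : Fin t → ℕ} {h : ℕ}

lemma Config.card_AB_le (c : Config r X) (ha : a ∈ c.TA) (ha' : a ≠ c.as) (hb : b ∈ c.SB)
    (hb' : b ≠ c.bs) (P : Finset V) : (c.A a ∪ (c.B b ∪ P)).card ≤ 220 + P.card := by
  have h1 := c.sideA.card_le a ha ha'
  have h2 := c.sideB.card_le b hb hb'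
  have h3 := Finset.card_union_le (c.A a) (c.B b ∪ P)
  have h4 := Finset.card_union_le (c.B b) P
  omega

lemma exists_part (ρ : Reserve c) (hh0 : 10 ^ 10 ≤ h)
    (hh : h * (10 ^ 40 * t) ≤ Fintype.card V) (ht : 1 ≤ t) {tgt : V → V} {R : V → Finset V}
    (i : Fin t) {J : Finset V} (hJ : J ⊆ c.SB) (htgt : ∀ b ∈ c.SB, tgt b ∈ c.TA)
    (hJc : J.card = demand ℓ h (Fintype.card V) (some i)) (hR : ∀ b ∈ J, (R b).card ≤ h + 2)
    (hgood : ∀ b ∈ J, ρ.Compat (some i) b (tgt b) ∧ ρ.Served ℓ h (some i) b (tgt b) (R b)) :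
    ∃ (W : Finset V) (done : Prop), X i ∈ W ∧ (done → W.card = ℓ i ∧ Cyc r W ∧ ℓ i < 1000 * h) ∧
      (¬ done → Strong r W ∧ ∀ b ∈ J, c.A (tgt b) ⊆ W ∧ c.B b ⊆ W) ∧
      (ℓ i < 1000 * h → W.card ≤ ℓ i) ∧ (1000 * h ≤ ℓ i → 40 * W.card ≤ ℓ i) ∧
      W ⊆ insert (X i) (ρ.Ch i) ∪ J.biUnion (fun b => Reserve.piece c (tgt b) b (R b)) ∧
      ∀ b ∈ J, R b ⊆ W := by
  have hJpos : 1 ≤ J.card := by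
    rw [hJc, demand]
    split_ifs
    · exact le_rfl
    · rw [mul_add]
      omega
  by_cases hd : ∃ b ∈ J, ℓ i < 1000 * h ∧ ∃ C, X i ∈ C ∧ C.card = ℓ i ∧ Cyc r C ∧ R b ⊆ C ∧
      C ⊆ ((c.A (tgt b)).erase (tgt b) ∪ ((c.B b).erase b ∪ R b)) ∪ insert (X i) (ρ.Ch i)
  · obtain ⟨b, hb, hlt, C, hxC, hCc, hcyc, hRC, hC⟩ := hd
    have hJ1 : J.card = 1 := by rw [hJc, demand, if_pos hlt]
    refine ⟨C, True, hxC, fun _ => ⟨hCc, hcyc, hlt⟩, fun hnot => absurd trivial hnot,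
      fun _ => hCc.le, fun hge => absurd hlt (not_lt.2 hge), ?_, ?_⟩
    · intro v hv
      rcases Finset.mem_union.1 (hC hv) with h | h
      · exact Finset.mem_union_right _ (Finset.mem_biUnion.2 ⟨b, hb, h⟩)
      · exact Finset.mem_union_left _ h
    · intro b' hb'
      rwa [Finset.card_le_one.1 hJ1.le b' hb' b hb]
  have hS : ∀ b ∈ J, b ∈ R b ∧ tgt b ∈ R b ∧
      Strong r ((c.A (tgt b) ∪ (c.B b ∪ R b)) ∪ insert (X i) (ρ.Ch i)) ∧
      (ℓ i < 1000 * h →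
        ((c.A (tgt b) ∪ (c.B b ∪ R b)) ∪ insert (X i) (ρ.Ch i)).card ≤ ℓ i) := by
    intro b hb
    rcases (hgood b hb).2 with h | h
    · exact h
    · exact absurd ⟨b, hb, h⟩ hd
  set f : V → Finset V := fun b => (c.A (tgt b) ∪ (c.B b ∪ R b)) ∪ insert (X i) (ρ.Ch i) with hf
  have hfsub : ∀ b ∈ J, f b ⊆ {X i} ∪ J.biUnion f := fun b hb =>
    (Finset.subset_biUnion_of_mem f hb).trans Finset.subset_union_right
  refine ⟨{X i} ∪ J.biUnion f, False, by simp, fun h => h.elim, fun _ => ⟨?_, ?_⟩, ?_, ?_, ?_, ?_⟩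
  · refine strong_singleton_union_biUnion (c := X i) J f ?_ (fun b hb => (hS b hb).2.2.1)
      (fun b _ => by simp [f]) (by simp)
    intro u hu v hv
    rw [Finset.mem_singleton] at hu hv
    rw [hu, hv]
    exact Rch.refl _
  · intro b hb
    exact ⟨(Finset.subset_union_left.trans Finset.subset_union_left).trans (hfsub b hb),
      (Finset.subset_union_left.trans (Finset.subset_union_right.trans
        Finset.subset_union_left)).trans (hfsub b hb)⟩
  · intro hlt
    have hJ1 : J.card = 1 := by rw [hJc, demand, if_pos hlt]
    obtain ⟨b, rfl⟩ := Finset.card_eq_one.1 hJ1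
    refine le_trans (Finset.card_le_card ?_) ((hS b (by simp)).2.2.2 hlt)
    rw [Finset.singleton_biUnion]
    exact Finset.union_subset (by simp) le_rfl
  · intro hge
    have h1 : ∀ b ∈ J, (f b).card ≤ h + 227 := by
      intro b hb
      have h2 := (hgood b hb).1
      have h3 := c.card_AB_le (htgt b (hJ hb)) h2.2.1 (hJ hb) h2.1 (R b)
      have h4 := hR b hb
      have h5 := ρ.Ch_card i
      have h6 := Finset.card_insert_le (X i) (ρ.Ch i)
      have h7 := Finset.card_union_le (c.A (tgt b) ∪ (c.B b ∪ R b)) (insert (X i) (ρ.Ch i))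
      show (c.A (tgt b) ∪ (c.B b ∪ R b) ∪ insert (X i) (ρ.Ch i)).card ≤ h + 227
      omega
    have h2 : (J.biUnion f).card ≤ J.card * (h + 227) :=
      Finset.card_biUnion_le.trans (Finset.sum_le_card_nsmul _ _ _ h1)
    have h3 := Finset.card_union_le {X i} (J.biUnion f)
    rw [Finset.card_singleton] at h3
    rw [hJc, demand, if_neg (by omega)] at h2
    have h4 := Nat.div_mul_le_self (t * ℓ i) (Fintype.card V)
    generalize t * ℓ i / Fintype.card V = q at h2 h4
    have h5 : t * (q * h * 10 ^ 40) ≤ t * ℓ i := by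
      calc t * (q * h * 10 ^ 40) = q * (h * (10 ^ 40 * t)) := by ring
        _ ≤ q * Fintype.card V := Nat.mul_le_mul_left _ hh
        _ ≤ _ := h4
    have h6 := Nat.le_of_mul_le_mul_left h5 (by omega)
    have h7 : q ≤ q * h := Nat.le_mul_of_pos_right _ (by omega)
    have h8 : 10 * (q + 1) * (h + 227) = 10 * (q * h) + 2270 * q + 10 * h + 2270 := by ring
    omega
  · intro v hv
    rw [Finset.mem_union, Finset.mem_singleton] at hv
    rcases hv with rfl | hv
    · simp
    · obtain ⟨b, hb, hv⟩ := Finset.mem_biUnion.1 hv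
      rcases Finset.mem_union.1 hv with hv | hv
      · exact Finset.mem_union_right _ (Finset.mem_biUnion.2 ⟨b, hb,
          Reserve.subset_piece (hS b hb).2.1 (hS b hb).1 hv⟩)
      · exact Finset.mem_union_left _ hv
  · intro b hb
    exact (Finset.subset_union_right.trans (Finset.subset_union_right.trans
        Finset.subset_union_left)).trans (hfsub b hb)

lemma exists_start (ρ : Reserve c) (hT : Tourn r) (hℓ : ∀ i, 3 ≤ ℓ i)
    (hX : Function.Injective X) (hsum : ∑ i, ℓ i = Fintype.card V)
    (ht : 1 ≤ t) (hn : 10 ^ 50 * t < Fintype.card V)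
    (hconn : KC r Finset.univ (10 ^ 50 * t)) (hh0 : 10 ^ 10 ≤ h)
    (hh : h * (10 ^ 40 * t) ≤ Fintype.card V)
    (hh' : Fintype.card V < (h + 1) * (10 ^ 40 * t)) : Nonempty (Start ρ ℓ h) := by
  obtain ⟨tgt, asg, R, hL⟩ := ρ.exists_linkage hT hℓ ht hn hconn hh hh'
  have hJm : ∀ i b, b ∈ c.SB.filter (fun b => asg b = some (some i)) ↔
      b ∈ c.SB ∧ asg b = some (some i) := fun i b => Finset.mem_filter
  have hJsub : ∀ i, c.SB.filter (fun b => asg b = some (some i)) ⊆ c.SB :=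
    fun i => Finset.filter_subset _ _
  choose W done h1 h2 h3 h4 h5 h6 h7 using fun i => exists_part ρ hh0 hh ht (R := R) i
    (hJsub i) hL.tgt_mem (hL.count_eq hsum (by omega) i)
    (fun b hb => hL.card_le b (hJsub i hb))
    (fun b hb => hL.good b (hJsub i hb) _ ((hJm i b).1 hb).2)
  have hpd : ∀ b ∈ c.SB, ∀ b' ∈ c.SB, b ≠ b' →
      Disjoint (Reserve.piece c (tgt b) b (R b)) (Reserve.piece c (tgt b') b' (R b')) :=
    fun b hb b' hb' hbb => ρ.piece_disjoint (hL.tgt_mem b hb) hb (hL.tgt_mem b' hb') hb'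
      (fun h => hbb (hL.tgt_inj hb hb' h)) hbb (hL.sub b hb) (hL.sub b' hb')
      (hL.disj b hb b' hb' hbb)
  have hpc : ∀ i, ∀ b ∈ c.SB,
      Disjoint (Reserve.piece c (tgt b) b (R b)) (insert (X i) (ρ.Ch i)) :=
    fun i b hb => ρ.piece_disjoint_chain (hL.tgt_mem b hb) hb i (hL.sub b hb)
  obtain ⟨b₁, hb₁, hb₁'⟩ : ∃ b ∈ c.SB, tgt b = c.as :=
    Finset.surj_on_of_inj_on_of_card_le (fun b _ => tgt b) hL.tgt_mem
      (fun b b' hb hb' h => hL.tgt_inj hb hb' h)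
      (by rw [c.sideA.card_eq, c.sideB.card_eq]) c.as c.sideA.star_mem |>.imp
        fun b ⟨hb, h⟩ => ⟨hb, h.symm⟩
  have hbs : c.bs ∈ c.SB := c.sideB.star_mem
  have hbet : ∀ b ∈ c.SB, b = c.bs ∨ tgt b = c.as → Between r b (tgt b) (R b) :=
    fun b hb h => (hL.good b hb _ ((hL.star_assigned hb).2 h)).2
  refine ⟨⟨W, done, fun i => c.SB.filter (fun b => asg b = some (some i)), tgt, R, b₁,
    (Finset.univ \ ρ.off) \ c.SB.biUnion R, hL.tgt_mem, hL.tgt_inj, hJsub, ?_, ?_,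
    hL.count_eq hsum (by omega), h1, fun i h => ⟨(h2 i h).1, (h2 i h).2.1⟩,
    fun i h => (h2 i h).2.2, fun i h => (h3 i h).1, fun i h => (h3 i h).2, h4, h5, ?_, ?_, hb₁,
    hb₁', ?_, hbet _ hbs (Or.inl rfl), ?_, ?_, hL.card_le, hL.conn, ?_, ?_⟩⟩
  · intro i b hb
    rw [hJm] at hb
    have := (hL.good b hb.1 _ hb.2).1
    exact ⟨this.1, this.2.1⟩
  · intro i j hij
    rw [Finset.disjoint_left]
    intro b hb hb'
    rw [hJm] at hb hb'
    have := hb.2.symm.trans hb'.2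
    simp only [Option.some.injEq] at this
    exact hij this
  · intro i j hij
    refine Finset.disjoint_of_subset_left (h6 i) (Finset.disjoint_of_subset_right (h6 j) ?_)
    rw [Finset.disjoint_union_left, Finset.disjoint_union_right, Finset.disjoint_union_right]
    refine ⟨⟨ρ.chain_disjoint_chain hX hij, ?_⟩, ?_, ?_⟩
    · rw [Finset.disjoint_biUnion_right]
      exact fun b hb => (hpc i b (hJsub j hb)).symm
    · rw [Finset.disjoint_biUnion_left]
      exact fun b hb => hpc j b (hJsub i hb)
    · rw [Finset.disjoint_biUnion_left]
      intro b hb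
      rw [Finset.disjoint_biUnion_right]
      intro b' hb'
      refine hpd b (hJsub i hb) b' (hJsub j hb') ?_
      rintro rfl
      rw [hJm] at hb hb'
      have := hb.2.symm.trans hb'.2
      simp only [Option.some.injEq] at this
      exact hij this
  · intro i σ hσ
    refine Finset.disjoint_of_subset_left (h6 i) ?_
    rw [Finset.disjoint_union_left, Finset.disjoint_biUnion_left]
    exact ⟨ρ.chain_disjoint_unit hσ i, fun b hb =>
      ρ.piece_disjoint_unit (hL.tgt_mem b (hJsub i hb)) (hJsub i hb) hσ (hL.sub b (hJsub i hb))⟩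
  · rw [← hb₁']
    exact hbet _ hb₁ (Or.inr hb₁')
  · intro i b hb hs
    have hB := hbet b hb hs
    refine Finset.disjoint_of_subset_left (h6 i)
      (Finset.disjoint_of_subset_right (Reserve.subset_piece hB.2.1 hB.1) ?_)
    rw [Finset.disjoint_union_left, Finset.disjoint_biUnion_left]
    refine ⟨(hpc i b hb).symm, fun b' hb' => hpd b' (hJsub i hb') b hb ?_⟩
    rintro rfl
    rw [hJm] at hb'
    have := ((hL.star_assigned hb).2 hs).symm.trans hb'.2
    simp at this
  · intro σ hσ b hb
    exact (ρ.piece_disjoint_unit (hL.tgt_mem b hb) hb hσ (hL.sub b hb)).mono_left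
      (Finset.subset_union_right.trans Finset.subset_union_right)
  · intro v hv hvU
    simp only [Finset.mem_sdiff, Finset.mem_univ, true_and, hv, not_false_eq_true, not_not] at hvU
    obtain ⟨b, hb, hvb⟩ := Finset.mem_biUnion.1 hvU
    rcases ha : asg b with _ | _ | i
    · rw [hL.unassigned b hb ha] at hvb
      simp at hvb
    · rcases (hL.star_assigned hb).1 ha with rfl | hs
      · exact Or.inr (Or.inr hvb)
      · rw [hL.tgt_inj hb hb₁ (hs.trans hb₁'.symm)] at hvb
        exact Or.inr (Or.inl hvb)
    · exact Or.inl ⟨i, h7 i b ((hJm i b).2 ⟨hb, ha⟩) hvb⟩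
  · intro v hvU hv
    rw [Finset.mem_sdiff, Finset.mem_sdiff] at hvU
    obtain ⟨⟨-, hoff⟩, hR⟩ := hvU
    have hR' : ∀ b ∈ c.SB, v ∉ R b := fun b hb h => hR (Finset.mem_biUnion.2 ⟨b, hb, h⟩)
    rcases hv with ⟨i, hv⟩ | hv | hv
    · exfalso
      rcases Finset.mem_union.1 (h6 i hv) with h | h
      · rcases Finset.mem_insert.1 h with rfl | h
        · exact hoff (ρ.X_mem_off i)
        · exact hoff (ρ.Ch_subset_off i h)
      · obtain ⟨b, hb, h⟩ := Finset.mem_biUnion.1 h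
        rcases ρ.piece_subset (hL.tgt_mem b (hJsub i hb)) (hJsub i hb) h with h | h
        · exact hoff h.2
        · exact hR' b (hJsub i hb) h
    · exact absurd hv (hR' _ hb₁)
    · exact absurd hv (hR' _ hbs)

end CyclePartition

namespace CyclePartition

open scoped Classical

variable {V : Type*} [Fintype V]
variable {r : V → V → Prop} {W W' K L : Finset V} {a b x y : V}
variable {t : ℕ} {X : Fin t → V} {c : Config r X} {ρ : Reserve c} {ℓ : Fin t → ℕ} {h : ℕ}

lemma Config.card_A_le (c : Config r X) (ha : a ∈ c.TA) : (c.A a).card ≤ c.s + 110 := by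
  by_cases h : a = c.as
  · have := c.sideA.card_star
    rw [h]
    omega
  · have := c.sideA.card_le a ha h
    omega

lemma Config.card_B_le (c : Config r X) (hb : b ∈ c.SB) : (c.B b).card ≤ c.s + 110 := by
  by_cases h : b = c.bs
  · have := c.sideB.card_star
    rw [h]
    omega
  · have := c.sideB.card_le b hb h
    omega

lemma exists_scale_le (hsum : ∑ i, ℓ i = Fintype.card V) (ht : 1 ≤ t) :
    ∃ i, Fintype.card V ≤ t * ℓ i := by
  by_contra hcon
  push Not at hcon
  have h1 : ∑ i, t * ℓ i < ∑ _i : Fin t, Fintype.card V :=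
    Finset.sum_lt_sum_of_nonempty ⟨⟨0, ht⟩, Finset.mem_univ _⟩ fun i _ => hcon i
  rw [← Finset.mul_sum, hsum] at h1
  simp at h1

namespace Start

lemma betw_of_star (S : Start ρ ℓ h) (hb : b ∈ c.SB) (hstar : b = c.bs ∨ S.tgt b = c.as) :
    Between r b (S.tgt b) (S.R b) := by
  rcases hstar with rfl | hs
  · exact S.betw
  · have : b = S.b₁ := S.tgt_inj hb S.b₁_mem (hs.trans S.tgt_b₁.symm)
    rw [hs, this]
    exact S.betw₁

lemma card_biUnion_le (S : Start ρ ℓ h) (hsum : ∑ i, ℓ i = Fintype.card V) :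
    40 * (Finset.univ.biUnion S.W).card ≤ Fintype.card V + t * (40000 * h) := by
  have h1 : (Finset.univ.biUnion S.W).card ≤ ∑ i, (S.W i).card := Finset.card_biUnion_le
  have h2 : ∑ i, 40 * (S.W i).card ≤ ∑ i, (ℓ i + 40000 * h) := by
    refine Finset.sum_le_sum fun i _ => ?_
    rcases lt_or_ge (ℓ i) (1000 * h) with hlt | hge
    · have := S.card_lt i hlt
      omega
    · have := S.card_big i hge
      omega
  rw [← Finset.mul_sum, Finset.sum_add_distrib, hsum] at h2
  simp only [Finset.sum_const, Finset.card_univ, Fintype.card_fin, smul_eq_mul] at h2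
  omega

lemma exists_ear (S : Start ρ ℓ h) (hsum : ∑ i, ℓ i = Fintype.card V) (ht : 1 ≤ t)
    (hn : 10 ^ 50 * t < Fintype.card V) (hh : h * (10 ^ 40 * t) ≤ Fintype.card V)
    (hb : b ∈ c.SB) (hstar : b = c.bs ∨ S.tgt b = c.as) {b₀ : V} (hb₀ : b₀ ∈ c.SB) :
    ∃ E, c.A (S.tgt b) ⊆ E ∧ c.B b ⊆ E ∧ S.R b ⊆ E ∧ (∀ i, Disjoint (S.W i) E) ∧
      (∀ σ ∈ ρ.sig, Disjoint E (ρ.Un σ)) ∧ E.card ≤ 2 * c.s + h + 230 ∧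
      (∃ Z : Finset V, Z.card ≤ 2 ∧ E ⊆ c.core ∪ (S.R b ∪ Z)) ∧
      ∀ K, Strong r K → c.A (S.tgt b₀) ⊆ K → c.B b₀ ⊆ K → Strong r (K ∪ E) := by
  have h1 := S.card_biUnion_le hsum
  have h2 : (ρ.sig.biUnion ρ.Un).card ≤ ρ.sig.card * 6 :=
    Finset.card_biUnion_le.trans (Finset.sum_le_card_nsmul _ _ 6 ρ.unit_card)
  have h3 := ρ.card_sig ht
  have h4 := c.card_compl_D ht
  have h5 := Finset.card_union_le (Finset.univ.biUnion S.W) (ρ.sig.biUnion ρ.Un)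
  have hth : h * (10 ^ 40 * t) = 10 ^ 40 * (t * h) := by ring
  rw [hth] at hh
  have hth' : t * (40000 * h) = 40000 * (t * h) := by ring
  rw [hth'] at h1
  have hZ : 10 * ((Finset.univ \ c.D).card +
      (Finset.univ.biUnion S.W ∪ ρ.sig.biUnion ρ.Un).card) < 3 * Fintype.card V := by omega
  have ha := S.tgt_mem b hb
  have ha₀ := S.tgt_mem b₀ hb₀
  obtain ⟨f, hfD, hfZ, hf, hf'⟩ := c.exists_link_out ha hb₀ _ hZ
  obtain ⟨g, hgD, hgZ, hg, hg'⟩ := c.exists_link_in ha₀ hb _ hZ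
  simp only [Finset.mem_union, Finset.mem_biUnion, Finset.mem_univ, true_and, not_or, not_exists,
    not_and] at hfZ hgZ
  have hcoreD : ∀ v ∈ c.core, v ∉ c.D := fun v hv hvD => (c.mem_D.1 hvD).2 hv
  refine ⟨c.A (S.tgt b) ∪ (c.B b ∪ (S.R b ∪ {f, g})), Finset.subset_union_left,
    Finset.subset_union_left.trans Finset.subset_union_right,
    Finset.subset_union_left.trans (Finset.subset_union_right.trans Finset.subset_union_right),
    ?_, ?_, ?_, ⟨{f, g}, Finset.card_le_two, ?_⟩, ?_⟩
  · intro i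
    rw [Finset.disjoint_left]
    intro v hv hvE
    have hd := Finset.disjoint_left.1 (S.disj_ear i b hb hstar) hv
    simp only [Finset.mem_union, Finset.mem_insert, Finset.mem_singleton] at hvE hd
    rcases hvE with h | h | h | rfl | rfl
    · exact hd (Or.inl h)
    · exact hd (Or.inr (Or.inl h))
    · exact hd (Or.inr (Or.inr h))
    · exact hfZ.1 i hv
    · exact hgZ.1 i hv
  · intro σ hσ
    rw [Finset.disjoint_left]
    intro v hvE hv
    have hvD : v ∈ c.D := ρ.unit_sub σ hσ hv
    simp only [Finset.mem_union, Finset.mem_insert, Finset.mem_singleton] at hvE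
    rcases hvE with h | h | h | rfl | rfl
    · exact hcoreD v (c.A_subset ha h) hvD
    · exact hcoreD v (c.B_subset hb h) hvD
    · exact Finset.disjoint_left.1 (S.ear_unit σ hσ b hb) h hv
    · exact hfZ.2 σ hσ hv
    · exact hgZ.2 σ hσ hv
  · have h6 := c.card_A_le ha
    have h7 := c.card_B_le hb
    have h8 := S.card_R b hb
    have h9 := Finset.card_union_le (c.A (S.tgt b)) (c.B b ∪ (S.R b ∪ {f, g}))
    have h10 := Finset.card_union_le (c.B b) (S.R b ∪ {f, g})
    have h11 := Finset.card_union_le (S.R b) {f, g}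
    have h12 : ({f, g} : Finset V).card ≤ 2 := Finset.card_le_two
    omega
  · exact Finset.union_subset ((c.A_subset ha).trans Finset.subset_union_left)
      (Finset.union_subset ((c.B_subset hb).trans Finset.subset_union_left)
        Finset.subset_union_right)
  · intro K hK hAK hBK
    obtain ⟨v, hv, hfv⟩ := hf'
    obtain ⟨w, hw, hwg⟩ := hg'
    exact (S.betw_of_star hb hstar).strong_union (c.sideA.toDomFam.fan ha)
      (c.sideB.toDomFam.fan_swap hb) hf hg hK ⟨v, hBK hv, hfv⟩ ⟨w, hAK hw, hwg⟩

/-- A family of pairwise disjoint sets extending the starting one. -/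
structure Grow (S : Start ρ ℓ h) (W : Fin t → Finset V) : Prop where
  sub : ∀ i, S.W i ⊆ W i
  disj : ∀ i j, i ≠ j → Disjoint (W i) (W j)
  strong : ∀ i, ¬ S.done i → Strong r (W i)
  tiny : ∀ i, ℓ i < 1000 * h → W i = S.W i

lemma exists_ears (S : Start ρ ℓ h) (hsum : ∑ i, ℓ i = Fintype.card V) (ht : 1 ≤ t)
    (hn : 10 ^ 50 * t < Fintype.card V) (hh : h * (10 ^ 40 * t) ≤ Fintype.card V)
    {i₀ : Fin t} (hi₀ : 1000 * h ≤ ℓ i₀) :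
    ∃ W, S.Grow W ∧ (∀ i, i ≠ i₀ → W i = S.W i) ∧ c.A c.as ⊆ W i₀ ∧ c.B c.bs ⊆ W i₀ ∧
      S.R S.b₁ ⊆ W i₀ ∧ S.R c.bs ⊆ W i₀ ∧ (∀ i, ∀ σ ∈ ρ.sig, Disjoint (W i) (ρ.Un σ)) ∧
      (W i₀).card ≤ (S.W i₀).card + (4 * c.s + 2 * h + 460) ∧
      ∃ Z : Finset V, Z.card ≤ 4 ∧ W i₀ ⊆ S.W i₀ ∪ (c.core ∪ (S.R S.b₁ ∪ S.R c.bs ∪ Z)) := by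
  have hJ : (S.J i₀).Nonempty := by
    rw [← Finset.card_pos, S.J_card, demand, if_neg (by omega)]
    positivity
  obtain ⟨b₀, hb₀⟩ := hJ
  have hnd : ¬ S.done i₀ := fun hd => absurd (S.done_lt i₀ hd) (by omega)
  have hsub := S.sub i₀ hnd b₀ hb₀
  have hb₀S := S.J_sub i₀ hb₀
  obtain ⟨E₁, hA₁, -, hR₁, hW₁, hU₁, hc₁, ⟨Z₁, hZ₁, hE₁⟩, hs₁⟩ :=
    S.exists_ear hsum ht hn hh S.b₁_mem (Or.inr S.tgt_b₁) hb₀S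
  obtain ⟨E₂, -, hB₂, hR₂, hW₂, hU₂, hc₂, ⟨Z₂, hZ₂, hE₂⟩, hs₂⟩ :=
    S.exists_ear hsum ht hn hh c.sideB.star_mem (Or.inl rfl) hb₀S
  rw [S.tgt_b₁] at hA₁
  set N := (S.W i₀ ∪ E₁) ∪ E₂ with hN
  have hsN : S.W i₀ ⊆ N := Finset.subset_union_left.trans Finset.subset_union_left
  have h1N : E₁ ⊆ N := Finset.subset_union_right.trans Finset.subset_union_left
  have h2N : E₂ ⊆ N := Finset.subset_union_right
  have hdN : ∀ j, j ≠ i₀ → Disjoint N (S.W j) := fun j hj => by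
    rw [hN, Finset.disjoint_union_left, Finset.disjoint_union_left]
    exact ⟨⟨S.disj i₀ j hj.symm, (hW₁ j).symm⟩, (hW₂ j).symm⟩
  have hne : ∀ i, i ≠ i₀ → Function.update S.W i₀ N i = S.W i := fun i hi =>
    Function.update_of_ne hi _ _
  have heq : Function.update S.W i₀ N i₀ = N := Function.update_self _ _ _
  refine ⟨Function.update S.W i₀ N, ⟨?_, ?_, ?_, ?_⟩, hne, ?_, ?_, ?_, ?_, ?_, ?_,
    Z₁ ∪ Z₂, (Finset.card_union_le _ _).trans (by omega), ?_⟩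
  · intro i
    by_cases hi : i = i₀
    · rw [hi, heq]; exact hsN
    · rw [hne i hi]
  · intro i j hij
    by_cases hi : i = i₀
    · have hj : j ≠ i₀ := fun hj => hij (hi.trans hj.symm)
      rw [hi, heq, hne j hj]
      exact hdN j hj
    · by_cases hj : j = i₀
      · rw [hj, heq, hne i hi]
        exact (hdN i hi).symm
      · rw [hne i hi, hne j hj]
        exact S.disj i j hij
  · intro i hi
    by_cases hi' : i = i₀
    · rw [hi', heq]
      refine hs₂ _ (hs₁ _ (S.strong i₀ hnd) hsub.1 hsub.2) ?_ ?_
      · exact hsub.1.trans Finset.subset_union_left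
      · exact hsub.2.trans Finset.subset_union_left
    · rw [hne i hi']
      exact S.strong i hi
  · intro i hi
    exact hne i (fun hi' => by rw [hi'] at hi; omega)
  · rw [heq]; exact hA₁.trans h1N
  · rw [heq]; exact hB₂.trans h2N
  · rw [heq]; exact hR₁.trans h1N
  · rw [heq]; exact hR₂.trans h2N
  · intro i σ hσ
    by_cases hi : i = i₀
    · rw [hi, heq, hN, Finset.disjoint_union_left, Finset.disjoint_union_left]
      exact ⟨⟨S.disj_unit i₀ σ hσ, hU₁ σ hσ⟩, hU₂ σ hσ⟩
    · rw [hne i hi]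
      exact S.disj_unit i σ hσ
  · rw [heq, hN]
    have h1 := Finset.card_union_le (S.W i₀ ∪ E₁) E₂
    have h2 := Finset.card_union_le (S.W i₀) E₁
    omega
  · rw [heq, hN]
    intro v hv
    have hv₁ := @hE₁ v
    have hv₂ := @hE₂ v
    simp only [Finset.mem_union] at hv hv₁ hv₂ ⊢
    tauto

end Start

end CyclePartition

namespace CyclePartition

open scoped Classical

variable {V : Type*} [Fintype V]
variable {r : V → V → Prop} {W W' K L : Finset V} {a b x y : V}
variable {t : ℕ} {X : Fin t → V} {c : Config r X} {ρ : Reserve c} {ℓ : Fin t → ℕ} {h : ℕ}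

namespace Start

lemma sum_le_of_card_lt (S : Start ρ ℓ h) (hn : 0 < Fintype.card V) (ht : 1 ≤ t)
    {s : Finset (Fin t)} (hs : ∀ i ∈ s, 1000 * h ≤ ℓ i) (hJ : (s.biUnion S.J).card < t) :
    10 * ∑ i ∈ s, ℓ i ≤ Fintype.card V := by
  rw [Finset.card_biUnion fun i _ j _ hij => S.J_disj i j hij] at hJ
  have h1 : ∑ i ∈ s, (10 * t) * ℓ i ≤ ∑ i ∈ s, Fintype.card V * (S.J i).card := by
    refine Finset.sum_le_sum fun i hi => ?_
    have h2 := hs i hi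
    rw [S.J_card, demand, if_neg (by omega)]
    have h3 := Nat.lt_mul_div_succ (t * ℓ i) hn
    calc (10 * t) * ℓ i = 10 * (t * ℓ i) := by ring
      _ ≤ 10 * (Fintype.card V * (t * ℓ i / Fintype.card V + 1)) := by omega
      _ = _ := by ring
  rw [← Finset.mul_sum, ← Finset.mul_sum] at h1
  refine Nat.le_of_mul_le_mul_left ?_ (show 0 < t by omega)
  calc t * (10 * ∑ i ∈ s, ℓ i) = (10 * t) * ∑ i ∈ s, ℓ i := by ring
    _ ≤ _ := h1
    _ ≤ Fintype.card V * t := Nat.mul_le_mul_left _ hJ.le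
    _ = _ := mul_comm _ _

lemma not_done (S : Start ρ ℓ h) {i : Fin t} (hi : 1000 * h ≤ ℓ i) : ¬ S.done i := fun hd =>
  absurd (S.done_lt i hd) (by omega)

lemma sum_miss_in_le (S : Start ρ ℓ h) (hn : 0 < Fintype.card V) (ht : 1 ≤ t) {v : V}
    (hv : v ∈ c.D) (hvE : v ∉ c.EA) {s : Finset (Fin t)}
    (hs : ∀ i ∈ s, 1000 * h ≤ ℓ i ∧ ¬ ∃ z ∈ S.W i, r z v) :
    10 * ∑ i ∈ s, ℓ i ≤ Fintype.card V := by
  refine S.sum_le_of_card_lt hn ht (fun i hi => (hs i hi).1) (lt_of_le_of_lt ?_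
    (c.sideA.bad_lt v hv hvE))
  refine (Finset.card_le_card fun b hb => ?_).trans
    (card_filter_misses_le (S := c.SB) S.tgt_mem S.tgt_inj)
  obtain ⟨i, hi, hb⟩ := Finset.mem_biUnion.1 hb
  refine Finset.mem_filter.2 ⟨S.J_sub i hb, (S.J_ne i b hb).2, fun z hz hzv => (hs i hi).2 ?_⟩
  exact ⟨z, (S.sub i (S.not_done (hs i hi).1) b hb).1 hz, hzv⟩

lemma sum_miss_out_le (S : Start ρ ℓ h) (hn : 0 < Fintype.card V) (ht : 1 ≤ t) {v : V}
    (hv : v ∈ c.D) (hvE : v ∉ c.EB) {s : Finset (Fin t)}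
    (hs : ∀ i ∈ s, 1000 * h ≤ ℓ i ∧ ¬ ∃ z ∈ S.W i, r v z) :
    10 * ∑ i ∈ s, ℓ i ≤ Fintype.card V := by
  refine S.sum_le_of_card_lt hn ht (fun i hi => (hs i hi).1) (lt_of_le_of_lt ?_
    (c.sideB.bad_lt v hv hvE))
  refine (Finset.card_le_card fun b hb => ?_).trans
    (card_filter_misses_le (S := c.SB) (f := id) (fun _ hb => hb) Function.injective_id.injOn)
  obtain ⟨i, hi, hb⟩ := Finset.mem_biUnion.1 hb
  refine Finset.mem_filter.2 ⟨S.J_sub i hb, (S.J_ne i b hb).1, fun z hz hzv => (hs i hi).2 ?_⟩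
  exact ⟨z, (S.sub i (S.not_done (hs i hi).1) b hb).2 hz, hzv⟩

/-- Apart from indices of small total length, every large set is joined both ways to given
typical vertices. -/
lemma sum_bad_le (S : Start ρ ℓ h) (hn : 0 < Fintype.card V) (ht : 1 ≤ t)
    (hh : h * (10 ^ 40 * t) ≤ Fintype.card V) {p p' q q' : V}
    (hp : p ∈ c.D) (hpE : p ∉ c.EA) (hp' : p' ∈ c.D) (hpE' : p' ∉ c.EA)
    (hq : q ∈ c.D) (hqE : q ∉ c.EB) (hq' : q' ∈ c.D) (hqE' : q' ∉ c.EB) {s : Finset (Fin t)}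
    (hs : ∀ i ∈ s, 1000 * h ≤ ℓ i → (∃ z ∈ S.W i, r z p) → (∃ z ∈ S.W i, r z p') →
      (∃ z ∈ S.W i, r q z) → ¬ ∃ z ∈ S.W i, r q' z) :
    100 * ∑ i ∈ s, ℓ i ≤ 41 * Fintype.card V := by
  set s₀ := s.filter (fun i => ℓ i < 1000 * h)
  set s₁ := s.filter (fun i => 1000 * h ≤ ℓ i ∧ ¬ ∃ z ∈ S.W i, r z p)
  set s₂ := s.filter (fun i => 1000 * h ≤ ℓ i ∧ ¬ ∃ z ∈ S.W i, r z p')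
  set s₃ := s.filter (fun i => 1000 * h ≤ ℓ i ∧ ¬ ∃ z ∈ S.W i, r q z)
  set s₄ := s.filter (fun i => 1000 * h ≤ ℓ i ∧ ¬ ∃ z ∈ S.W i, r q' z)
  have h1 := S.sum_miss_in_le hn ht hp hpE (s := s₁) fun i hi => (Finset.mem_filter.1 hi).2
  have h2 := S.sum_miss_in_le hn ht hp' hpE' (s := s₂) fun i hi => (Finset.mem_filter.1 hi).2
  have h3 := S.sum_miss_out_le hn ht hq hqE (s := s₃) fun i hi => (Finset.mem_filter.1 hi).2
  have h4 := S.sum_miss_out_le hn ht hq' hqE' (s := s₄) fun i hi => (Finset.mem_filter.1 hi).2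
  have h0 : ∑ i ∈ s₀, ℓ i ≤ t * (1000 * h) := by
    refine (Finset.sum_le_card_nsmul _ _ (1000 * h) fun i hi => ?_).trans ?_
    · exact (Finset.mem_filter.1 hi).2.le
    · rw [smul_eq_mul]
      refine Nat.mul_le_mul_right _ ((Finset.card_le_univ _).trans ?_)
      simp
  have hsub : s ⊆ s₀ ∪ (s₁ ∪ (s₂ ∪ (s₃ ∪ s₄))) := by
    intro i hi
    simp only [s₀, s₁, s₂, s₃, s₄, Finset.mem_union, Finset.mem_filter]
    have := hs i hi
    rcases lt_or_ge (ℓ i) (1000 * h) with hlt | hge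
    · exact Or.inl ⟨hi, hlt⟩
    · tauto
  have h5 : ∑ i ∈ s, ℓ i ≤ ∑ i ∈ s₀ ∪ (s₁ ∪ (s₂ ∪ (s₃ ∪ s₄))), ℓ i :=
    Finset.sum_le_sum_of_subset hsub
  have key : ∀ A B : Finset (Fin t), ∑ i ∈ A ∪ B, ℓ i ≤ ∑ i ∈ A, ℓ i + ∑ i ∈ B, ℓ i := by
    intro A B
    rw [← Finset.sum_union_inter]
    exact Nat.le_add_right _ _
  have h6 := key s₀ (s₁ ∪ (s₂ ∪ (s₃ ∪ s₄)))
  have h7 := key s₁ (s₂ ∪ (s₃ ∪ s₄))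
  have h8 := key s₂ (s₃ ∪ s₄)
  have h9 := key s₃ s₄
  have hth : h * (10 ^ 40 * t) = 10 ^ 40 * (t * h) := by ring
  rw [hth] at hh
  have hth' : t * (1000 * h) = 1000 * (t * h) := by ring
  rw [hth'] at h0
  omega

end Start

lemma Strong.union_biUnion {V : Type*} {r : V → V → Prop} {W : Finset V} {ι : Type*}
    {s : Finset ι} {N : ι → Finset V} (hW : Strong r W)
    (hN : ∀ i ∈ s, ∀ K, W ⊆ K → Strong r K → Strong r (K ∪ N i)) :
    Strong r (W ∪ s.biUnion N) := by
  induction s using Finset.induction_on with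
  | empty => simpa using hW
  | insert i s hi ih =>
    rw [Finset.biUnion_insert, Finset.union_comm (N i), ← Finset.union_assoc]
    exact hN i (Finset.mem_insert_self _ _) _ Finset.subset_union_left
      (ih fun j hj => hN j (Finset.mem_insert_of_mem hj))

namespace Start

lemma exists_host_coloring (S : Start ρ ℓ h) (hsum : ∑ i, ℓ i = Fintype.card V) (ht : 1 ≤ t)
    (hn : 10 ^ 50 * t < Fintype.card V) (hh0 : 10 ^ 10 ≤ h)
    (hh : h * (10 ^ 40 * t) ≤ Fintype.card V) :
    ∃ col : V → Fin t, (∀ σ ∈ ρ.sig, 1000 * h ≤ ℓ (col σ) ∧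
      ∀ K, S.W (col σ) ⊆ K → Strong r K →
        Strong r (K ∪ ρ.Un σ) ∧ Strong r (K ∪ insert σ (ρ.Un σ))) ∧
      ∀ i, (ρ.sig.filter (fun σ => col σ = i)).card ≤ ℓ i / 1000 := by
  have : Nonempty (Fin t) := ⟨⟨0, ht⟩⟩
  refine (exists_coloring_of_hall ρ.sig (fun i => ℓ i / 1000) (fun σ i => 1000 * h ≤ ℓ i ∧
      ∀ K, S.W i ⊆ K → Strong r K →
        Strong r (K ∪ ρ.Un σ) ∧ Strong r (K ∪ insert σ (ρ.Un σ))) ?_).imp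
    fun col hc => ⟨hc.1, fun i => by convert hc.2 i⟩
  intro F hF
  rcases F.eq_empty_or_nonempty with rfl | ⟨σ, hσ⟩
  · simp
  set s : Finset (Fin t) := Finset.univ.filter (fun i => ∃ σ ∈ F, 1000 * h ≤ ℓ i ∧
      ∀ K, S.W i ⊆ K → Strong r K →
        Strong r (K ∪ ρ.Un σ) ∧ Strong r (K ∪ insert σ (ρ.Un σ))) with hs
  obtain ⟨p, p', q, q', hu, hp, hpE, hp', hpE', hq, hqE, hq', hqE'⟩ := ρ.unit σ (hF hσ)
  have h1 : 100 * ∑ i ∈ sᶜ, ℓ i ≤ 41 * Fintype.card V := by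
    refine S.sum_bad_le (by omega) ht hh hp hpE hp' hpE' hq hqE hq' hqE' ?_
    intro i hi hbig h1 h2 h3 h4
    rw [Finset.mem_compl, hs, Finset.mem_filter] at hi
    refine hi ⟨Finset.mem_univ i, σ, hσ, hbig, fun K hK hKs => hu.strong_union hKs ?_ ?_ ?_ ?_⟩
    · exact h1.imp fun z hz => ⟨hK hz.1, hz.2⟩
    · exact h2.imp fun z hz => ⟨hK hz.1, hz.2⟩
    · exact h3.imp fun z hz => ⟨hK hz.1, hz.2⟩
    · exact h4.imp fun z hz => ⟨hK hz.1, hz.2⟩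
  have h2 := Finset.sum_add_sum_compl s ℓ
  rw [hsum] at h2
  have h3 : ∑ i ∈ s, ℓ i ≤ ∑ i ∈ s, 2000 * (ℓ i / 1000) := by
    refine Finset.sum_le_sum fun i hi => ?_
    rw [hs, Finset.mem_filter] at hi
    obtain ⟨-, -, -, hi, -⟩ := hi
    omega
  rw [← Finset.mul_sum] at h3
  have h4 := (Finset.card_le_card hF).trans (ρ.card_sig ht)
  have h5 : F.card ≤ ∑ i ∈ s, ℓ i / 1000 := by omega
  convert h5 using 2
  rw [hs]
  congr

lemma exists_hosts (S : Start ρ ℓ h) (hsum : ∑ i, ℓ i = Fintype.card V) (ht : 1 ≤ t)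
    (hn : 10 ^ 50 * t < Fintype.card V) (hh0 : 10 ^ 10 ≤ h)
    (hh : h * (10 ^ 40 * t) ≤ Fintype.card V) {W : Fin t → Finset V} (hW : S.Grow W)
    (hdu : ∀ i, ∀ σ ∈ ρ.sig, Disjoint (W i) (ρ.Un σ)) :
    ∃ W', S.Grow W' ∧ (∀ i, W i ⊆ W' i) ∧ (∀ i, (W' i).card ≤ (W i).card + ℓ i / 1000 * 7) ∧
      (∀ i, W' i ⊆ W i ∪ (ρ.sig ∪ ρ.sig.biUnion ρ.Un)) ∧
      ∀ σ ∈ ρ.sig, (∃ i, σ ∈ W' i) ∧ ∃ i, ρ.Un σ ⊆ W' i := by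
  obtain ⟨col, hcol, hcard⟩ := S.exists_host_coloring hsum ht hn hh0 hh
  set N : V → Finset V := fun σ => if ∃ i, σ ∈ W i then ρ.Un σ else insert σ (ρ.Un σ) with hN
  have hNsub : ∀ σ, ∀ v ∈ N σ, (v = σ ∧ ∀ i, σ ∉ W i) ∨ v ∈ ρ.Un σ := by
    intro σ v hv
    simp only [hN] at hv
    split_ifs at hv with hi
    · exact Or.inr hv
    · rcases Finset.mem_insert.1 hv with h | h
      · exact Or.inl ⟨h, fun i hi' => hi ⟨i, hi'⟩⟩
      · exact Or.inr h
  have hUnsig : ∀ σ ∈ ρ.sig, ∀ τ ∈ ρ.sig, τ ∉ ρ.Un σ := by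
    intro σ hσ τ hτ hτσ
    rcases Finset.mem_union.1 hτ with h | h
    · exact (c.mem_D.1 (ρ.unit_sub σ hσ hτσ)).2 h
    · exact Finset.disjoint_left.1 (ρ.unit_chain σ hσ) hτσ h
  have hNN : ∀ σ ∈ ρ.sig, ∀ τ ∈ ρ.sig, σ ≠ τ → Disjoint (N σ) (N τ) := by
    intro σ hσ τ hτ hne
    rw [Finset.disjoint_left]
    intro v hv hv'
    rcases hNsub σ v hv with ⟨h, -⟩ | h <;> rcases hNsub τ v hv' with ⟨h', -⟩ | h'
    · exact hne (h.symm.trans h')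
    · rw [h] at h'
      exact hUnsig τ hτ σ hσ h'
    · rw [h'] at h
      exact hUnsig σ hσ τ hτ h
    · exact Finset.disjoint_left.1 (ρ.unit_disj σ hσ τ hτ hne) h h'
  have hWN : ∀ i, ∀ σ ∈ ρ.sig, Disjoint (W i) (N σ) := by
    intro i σ hσ
    rw [Finset.disjoint_left]
    intro v hv hv'
    rcases hNsub σ v hv' with ⟨h, h'⟩ | h
    · exact h' i (h ▸ hv)
    · exact Finset.disjoint_left.1 (hdu i σ hσ) hv h
  set fib : Fin t → Finset V := fun i => ρ.sig.filter (fun σ => col σ = i) with hfib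
  have hmem : ∀ i, ∀ σ ∈ fib i, σ ∈ ρ.sig ∧ col σ = i := fun i σ hσ => Finset.mem_filter.1 hσ
  have hself : ∀ σ ∈ ρ.sig, σ ∈ fib (col σ) := fun σ hσ => Finset.mem_filter.2 ⟨hσ, rfl⟩
  have hNW' : ∀ σ ∈ ρ.sig, N σ ⊆ W (col σ) ∪ (fib (col σ)).biUnion N := fun σ hσ =>
    (Finset.subset_biUnion_of_mem N (hself σ hσ)).trans Finset.subset_union_right
  refine ⟨fun i => W i ∪ (fib i).biUnion N, ⟨fun i => ?_, ?_, ?_, ?_⟩,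
    fun i => Finset.subset_union_left, ?_, ?_, ?_⟩
  · exact (hW.sub i).trans Finset.subset_union_left
  · intro i j hij
    rw [Finset.disjoint_left]
    intro v hv hv'
    simp only [Finset.mem_union, Finset.mem_biUnion] at hv hv'
    rcases hv with hv | ⟨σ, hσ, hv⟩ <;> rcases hv' with hv' | ⟨τ, hτ, hv'⟩
    · exact Finset.disjoint_left.1 (hW.disj i j hij) hv hv'
    · exact Finset.disjoint_left.1 (hWN i τ (hmem j τ hτ).1) hv hv'
    · exact Finset.disjoint_left.1 (hWN j σ (hmem i σ hσ).1) hv' hv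
    · have hne : σ ≠ τ := by
        rintro rfl
        exact hij ((hmem i σ hσ).2.symm.trans (hmem j σ hτ).2)
      exact Finset.disjoint_left.1 (hNN σ (hmem i σ hσ).1 τ (hmem j τ hτ).1 hne) hv hv'
  · intro i hi
    refine (hW.strong i hi).union_biUnion fun σ hσ K hK hKs => ?_
    obtain ⟨hσ', rfl⟩ := hmem i σ hσ
    have h1 := (hcol σ hσ').2 K ((hW.sub _).trans hK) hKs
    simp only [hN]
    split_ifs
    · exact h1.1
    · exact h1.2
  · intro i hi
    have : fib i = ∅ := by
      rw [Finset.eq_empty_iff_forall_notMem]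
      intro σ hσ
      obtain ⟨hσ', rfl⟩ := hmem i σ hσ
      have := (hcol σ hσ').1
      omega
    simp only [this, Finset.biUnion_empty, Finset.union_empty]
    exact hW.tiny i hi
  · intro i
    refine (Finset.card_union_le _ _).trans (Nat.add_le_add_left ?_ _)
    refine Finset.card_biUnion_le.trans ((Finset.sum_le_card_nsmul _ _ 7 fun σ hσ => ?_).trans ?_)
    · have h1 := ρ.unit_card σ (hmem i σ hσ).1
      simp only [hN]
      split_ifs
      · omega
      · have := Finset.card_insert_le σ (ρ.Un σ)
        omega
    · rw [smul_eq_mul]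
      exact Nat.mul_le_mul_right _ (hcard i)
  · intro i
    refine Finset.union_subset_union_right fun v hv => ?_
    obtain ⟨σ, hσ, hv⟩ := Finset.mem_biUnion.1 hv
    have hσ' := (hmem i σ hσ).1
    rcases hNsub σ v hv with ⟨rfl, -⟩ | h
    · exact Finset.mem_union_left _ hσ'
    · exact Finset.mem_union_right _ (Finset.mem_biUnion.2 ⟨σ, hσ', h⟩)
  · intro σ hσ
    constructor
    · by_cases hi : ∃ i, σ ∈ W i
      · obtain ⟨i, hi⟩ := hi
        exact ⟨i, Finset.mem_union_left _ hi⟩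
      · refine ⟨col σ, hNW' σ hσ ?_⟩
        simp only [hN, if_neg hi, Finset.mem_insert_self]
    · refine ⟨col σ, Finset.Subset.trans ?_ (hNW' σ hσ)⟩
      simp only [hN]
      split_ifs
      · exact le_rfl
      · exact Finset.subset_insert _ _

end Start

end CyclePartition

namespace CyclePartition

open scoped Classical

section

variable {V : Type*} {r : V → V → Prop} {U W W' K L E : Finset V} {a b x y : V}

lemma exists_rescue_in (hU : Strong r U) (hEU : E ⊆ U)
    (hin : ∀ v ∈ U, v ∉ E → ∃ z ∈ K, r z v) (hne : ∃ v ∈ U, v ∉ E) :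
    ∃ Y ⊆ U, E ⊆ Y ∧ Y.card ≤ 2 * E.card ∧
      ∀ Y', Y ⊆ Y' → Y' ⊆ U → ∀ v ∈ Y', ∃ u ∈ K, Rch r (K ∪ Y') u v := by
  obtain ⟨v₀, hv₀, hv₀E⟩ := hne
  have hφ : ∀ v, ∃ u, u ∈ U ∧ ((∃ u ∈ U, u ∉ E ∧ r u v) → u ∉ E ∧ r u v) := by
    intro v
    by_cases hv : ∃ u ∈ U, u ∉ E ∧ r u v
    · obtain ⟨u, hu, h⟩ := hv
      exact ⟨u, hu, fun _ => h⟩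
    · exact ⟨v₀, hv₀, fun h => absurd h hv⟩
  choose φ hφU hφ using hφ
  refine ⟨E ∪ E.image φ, Finset.union_subset hEU ?_, Finset.subset_union_left, ?_, ?_⟩
  · intro v hv
    obtain ⟨u, -, rfl⟩ := Finset.mem_image.1 hv
    exact hφU u
  · have h1 := Finset.card_union_le E (E.image φ)
    have h2 : (E.image φ).card ≤ E.card := Finset.card_image_le
    omega
  intro Y' hY hY'U v hv
  have hdirect : ∀ w ∈ Y', w ∉ E → ∃ u ∈ K, Rch r (K ∪ Y') u w := by
    intro w hw hwE
    obtain ⟨z, hz, hzw⟩ := hin w (hY'U hw) hwE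
    exact ⟨z, hz, .single hzw (Finset.mem_union_left _ hz) (Finset.mem_union_right _ hw)⟩
  by_contra hcon
  obtain ⟨u, w, -, hu, hw, huw, huU, hwU⟩ := (hU v₀ hv₀ v (hY'U hv)).exists_cross
    (fun w => w ∈ E → ∃ u ∈ K, Rch r (K ∪ Y') u w) (fun h => absurd h hv₀E) (fun h => by
      by_cases hvE : v ∈ E
      · exact hcon (h hvE)
      · exact hcon (hdirect v hv hvE))
  push Not at hw
  obtain ⟨hwE, hw⟩ := hw
  have hEY : E ⊆ Y' := Finset.subset_union_left.trans hY
  have hstep : ∀ u' ∈ Y', r u' w → ¬ ∃ z ∈ K, Rch r (K ∪ Y') z u' := by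
    rintro u' hu' huw' ⟨z, hz, hzu⟩
    exact hw z hz (hzu.trans (.single huw' (Finset.mem_union_right _ hu')
      (Finset.mem_union_right _ (hEY hwE))))
  by_cases huE : u ∈ E
  · exact hstep u (hEY huE) huw (hu huE)
  · have h1 := hφ w ⟨u, huU, huE, huw⟩
    have h2 : φ w ∈ Y' := hY (Finset.mem_union_right _ (Finset.mem_image_of_mem _ hwE))
    exact hstep _ h2 h1.2 (hdirect _ h2 h1.1)

/-- A small set of exceptional vertices can be attached to a strong set which dominates, and
is dominated by, all the other vertices. -/
lemma exists_rescue (hU : Strong r U) (hK : Strong r K) (hEU : E ⊆ U)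
    (hin : ∀ v ∈ U, v ∉ E → ∃ z ∈ K, r z v) (hout : ∀ v ∈ U, v ∉ E → ∃ z ∈ K, r v z)
    (hne : ∃ v ∈ U, v ∉ E) :
    ∃ Y ⊆ U, E ⊆ Y ∧ Y.card ≤ 4 * E.card ∧ Strong r (K ∪ Y) := by
  obtain ⟨Y₁, hU₁, hE₁, hc₁, h₁⟩ := exists_rescue_in hU hEU hin hne
  obtain ⟨Y₂, hU₂, hE₂, hc₂, h₂⟩ := exists_rescue_in hU.swap hEU hout hne
  have hYU := Finset.union_subset hU₁ hU₂
  refine ⟨Y₁ ∪ Y₂, hYU, hE₁.trans Finset.subset_union_left, ?_, strong_ear hK fun v hv => ⟨?_, ?_⟩⟩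
  · have := Finset.card_union_le Y₁ Y₂
    omega
  · exact h₁ _ Finset.subset_union_left hYU v hv
  · obtain ⟨u, hu, huv⟩ := h₂ _ Finset.subset_union_right hYU v hv
    exact ⟨u, hu, huv.swap⟩

end

variable {V : Type*} [Fintype V]
variable {r : V → V → Prop} {t : ℕ} {X : Fin t → V} {c : Config r X} {ρ : Reserve c}
variable {ℓ : Fin t → ℕ} {h : ℕ}

lemma Config.card_E_le (c : Config r X) (ht : 1 ≤ t) :
    2 ^ 58 * t * (c.EA ∪ c.EB).card ≤ Fintype.card V := by
  have h1 : 2 ^ 60 * t ≤ 2 ^ (60 * t) := by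
    obtain ⟨m, rfl⟩ : ∃ m, t = m + 1 := ⟨t - 1, by omega⟩
    have h2 : m + 1 ≤ 2 ^ m := Nat.lt_two_pow_self
    calc 2 ^ 60 * (m + 1) ≤ 2 ^ 60 * 2 ^ m := Nat.mul_le_mul_left _ h2
      _ = 2 ^ (60 + m) := (pow_add _ _ _).symm
      _ ≤ _ := Nat.pow_le_pow_right (by norm_num) (by omega)
  have h2 := c.sideA.E_card
  have h3 := c.sideB.E_card
  have h4 := Finset.card_union_le c.EA c.EB
  have h5 : 2 ^ 60 * t * (c.EA ∪ c.EB).card ≤ 4 * Fintype.card V :=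
    calc 2 ^ 60 * t * (c.EA ∪ c.EB).card ≤ 2 ^ (60 * t) * (c.EA.card + c.EB.card) :=
          Nat.mul_le_mul h1 h4
      _ ≤ 4 * Fintype.card V := by rw [mul_add]; omega
  have h6 : 2 ^ 60 * t * (c.EA ∪ c.EB).card = 4 * (2 ^ 58 * t * (c.EA ∪ c.EB).card) := by ring
  omega

namespace Start

lemma Grow.card_biUnion_le {S : Start ρ ℓ h} {W : Fin t → Finset V} (hW : S.Grow W)
    (hsum : ∑ i, ℓ i = Fintype.card V) (hh : h * (10 ^ 40 * t) ≤ Fintype.card V)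
    (hbig : ∀ i, 1000 * h ≤ ℓ i → 10 * (W i).card ≤ ℓ i) :
    100 * (Finset.univ.biUnion W).card ≤ 11 * Fintype.card V := by
  have h1 : (Finset.univ.biUnion W).card ≤ ∑ i, (W i).card := Finset.card_biUnion_le
  have h2 : ∑ i, 10 * (W i).card ≤ ∑ i, (ℓ i + 10000 * h) := by
    refine Finset.sum_le_sum fun i _ => ?_
    rcases lt_or_ge (ℓ i) (1000 * h) with hlt | hge
    · have := S.card_lt i hlt
      rw [hW.tiny i hlt]
      omega
    · have := hbig i hge
      omega
  rw [← Finset.mul_sum, Finset.sum_add_distrib, hsum] at h2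
  simp only [Finset.sum_const, Finset.card_univ, Fintype.card_fin, smul_eq_mul] at h2
  have hth : h * (10 ^ 40 * t) = 10 ^ 40 * (t * h) := by ring
  rw [hth] at hh
  have hth' : t * (10000 * h) = 10000 * (t * h) := by ring
  rw [hth'] at h2
  omega

lemma exists_precover (S : Start ρ ℓ h) (hsum : ∑ i, ℓ i = Fintype.card V) (ht : 1 ≤ t)
    (hn : 10 ^ 50 * t < Fintype.card V) (hh0 : 10 ^ 10 ≤ h)
    (hh : h * (10 ^ 40 * t) ≤ Fintype.card V) {i₀ : Fin t} (hi₀ : 1000 * h ≤ ℓ i₀) :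
    ∃ W U, S.Grow W ∧ c.A c.as ⊆ W i₀ ∧ c.B c.bs ⊆ W i₀ ∧ Strong r U ∧ U ⊆ c.D ∧
      (∀ v, v ∈ U ↔ ∀ i, v ∉ W i) ∧
      (W i₀).card ≤ (S.W i₀).card + (4 * c.s + 2 * h + 460) + ℓ i₀ / 1000 * 7 ∧
      ∀ i, i ≠ i₀ → (W i).card ≤ (S.W i).card + ℓ i / 1000 * 7 := by
  obtain ⟨W₁, hW₁, hne₁, hA₁, hB₁, hR₁, hR₁', hU₁, hc₁, Z, hZ, hZ₁⟩ :=
    S.exists_ears hsum ht hn hh hi₀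
  obtain ⟨W₂, hW₂, hsub₂, hc₂, hd₂, hcov₂⟩ := S.exists_hosts hsum ht hn hh0 hh hW₁ hU₁
  obtain ⟨U, hmemU⟩ : ∃ U : Finset V, ∀ v, v ∈ U ↔ ∀ i, v ∉ W₂ i :=
    ⟨Finset.univ \ Finset.univ.biUnion W₂, by simp⟩
  have hUsig : ∀ v ∈ U, v ∉ ρ.sig := fun v hv hσ => by
    obtain ⟨i, hi⟩ := (hcov₂ v hσ).1
    exact (hmemU v).1 hv i hi
  have hUX : ∀ v ∈ U, ∀ i, v ≠ X i := by
    rintro v hv i rfl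
    exact (hmemU _).1 hv i (hW₂.sub i (S.mem i))
  have hUD : U ⊆ c.D := fun v hv =>
    c.mem_D.2 ⟨hUX v hv, fun hc => hUsig v hv (Finset.mem_union_left _ hc)⟩
  have hUoff : ∀ v ∈ U, v ∉ ρ.off := by
    intro v hv ho
    rcases Finset.mem_union.1 ho with ho | ho
    · obtain ⟨i, -, rfl⟩ := Finset.mem_image.1 ho
      exact hUX _ hv i rfl
    rcases Finset.mem_union.1 ho with ho | ho
    · exact hUsig v hv (Finset.mem_sdiff.1 ho).1
    · obtain ⟨σ, hσ, hvσ⟩ := Finset.mem_biUnion.1 ho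
      obtain ⟨i, hi⟩ := (hcov₂ σ hσ).2
      exact (hmemU v).1 hv i (hi hvσ)
  have hUS : U ⊆ S.U := by
    intro v hv
    by_contra hvS
    rcases S.cover v (hUoff v hv) hvS with ⟨i, hi⟩ | hi | hi
    · exact (hmemU v).1 hv i (hW₂.sub i hi)
    · exact (hmemU v).1 hv i₀ (hsub₂ i₀ (hR₁ hi))
    · exact (hmemU v).1 hv i₀ (hsub₂ i₀ (hR₁' hi))
  refine ⟨W₂, U, hW₂, hA₁.trans (hsub₂ i₀), hB₁.trans (hsub₂ i₀), ?_, hUD, hmemU,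
    (hc₂ i₀).trans (Nat.add_le_add_right hc₁ _), fun i hi => hne₁ i hi ▸ hc₂ i⟩
  have h1 : S.U \ U ⊆ ρ.sig ∪ (ρ.sig.biUnion ρ.Un ∪ Z) := by
    intro v hv
    obtain ⟨hvS, hvU⟩ := Finset.mem_sdiff.1 hv
    rw [hmemU] at hvU
    push Not at hvU
    obtain ⟨i, hi⟩ := hvU
    have hends : (∃ i, v ∈ S.W i) ∨ v ∈ S.R S.b₁ ∨ v ∈ S.R c.bs → v ∈ ρ.sig := fun h3 =>
      Finset.mem_union_left _ (Finset.union_subset c.TA_subset c.SB_subset (S.small v hvS h3))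
    rcases Finset.mem_union.1 (hd₂ i hi) with hi | hi
    · by_cases h3 : i = i₀
      · subst h3
        rcases Finset.mem_union.1 (hZ₁ hi) with hi | hi
        · exact Finset.mem_union_left _ (hends (Or.inl ⟨i, hi⟩))
        rcases Finset.mem_union.1 hi with hi | hi
        · exact Finset.mem_union_left _ (Finset.mem_union_left _ hi)
        rcases Finset.mem_union.1 hi with hi | hi
        · exact Finset.mem_union_left _ (hends (Or.inr (Finset.mem_union.1 hi)))
        · exact Finset.mem_union_right _ (Finset.mem_union_right _ hi)
      · rw [hne₁ i h3] at hi
        exact Finset.mem_union_left _ (hends (Or.inl ⟨i, hi⟩))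
    · rw [← Finset.union_assoc]
      exact Finset.mem_union_left _ hi
  have h2 : (ρ.sig.biUnion ρ.Un).card ≤ ρ.sig.card * 6 :=
    Finset.card_biUnion_le.trans (Finset.sum_le_card_nsmul _ _ 6 ρ.unit_card)
  have h3 := ρ.card_sig ht
  have h4 := Finset.card_le_card h1
  have h5 := Finset.card_union_le ρ.sig (ρ.sig.biUnion ρ.Un ∪ Z)
  have h6 := Finset.card_union_le (ρ.sig.biUnion ρ.Un) Z
  have h7 := S.conn.sdiff (D := S.U \ U) (m := 1) (by omega)
  rw [Finset.sdiff_sdiff_eq_self hUS] at h7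
  exact h7.strong one_pos

lemma exists_cover (S : Start ρ ℓ h) (hsum : ∑ i, ℓ i = Fintype.card V) (ht : 1 ≤ t)
    (hn : 10 ^ 50 * t < Fintype.card V) (hh0 : 10 ^ 10 ≤ h)
    (hh : h * (10 ^ 40 * t) ≤ Fintype.card V) :
    ∃ W, S.Grow W ∧ (∀ i, 1000 * h ≤ ℓ i → 10 * (W i).card ≤ ℓ i) ∧
      ∀ v, (∀ i, v ∉ W i) → v ∈ c.D ∧ v ∉ c.EA ∧ v ∉ c.EB := by
  obtain ⟨i₀, hi₀⟩ := exists_scale_le hsum ht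
  have hhi : 10 ^ 40 * h ≤ ℓ i₀ := by
    refine Nat.le_of_mul_le_mul_left ?_ (show 0 < t by omega)
    calc t * (10 ^ 40 * h) = h * (10 ^ 40 * t) := by ring
      _ ≤ _ := hh.trans hi₀
  have hsi : 10 ^ 6 * c.s ≤ ℓ i₀ := by
    refine Nat.le_of_mul_le_mul_left ?_ (show 0 < t by omega)
    calc t * (10 ^ 6 * c.s) = c.s * (10 ^ 6 * t) := by ring
      _ ≤ _ := c.s_le'.trans hi₀
  have hEi : 2 ^ 58 * (c.EA ∪ c.EB).card ≤ ℓ i₀ := by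
    refine Nat.le_of_mul_le_mul_left ?_ (show 0 < t by omega)
    calc t * (2 ^ 58 * (c.EA ∪ c.EB).card) = 2 ^ 58 * t * (c.EA ∪ c.EB).card := by ring
      _ ≤ _ := (c.card_E_le ht).trans hi₀
  have hbig₀ : 1000 * h ≤ ℓ i₀ := by omega
  obtain ⟨W, U, hW, hA, hB, hUs, hUD, hU, hc₀, hc⟩ := S.exists_precover hsum ht hn hh0 hh hbig₀
  have hsz₀ : 10 * ((W i₀).card + 4 * (c.EA ∪ c.EB).card) ≤ ℓ i₀ := by
    have h1 := S.card_big i₀ hbig₀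
    omega
  have hsz : ∀ i, 1000 * h ≤ ℓ i → 10 * (W i).card ≤ ℓ i := by
    intro i hi
    by_cases h1 : i = i₀
    · rw [h1]
      omega
    · have h2 := hc i h1
      have h3 := S.card_big i hi
      omega
  obtain ⟨Y, hYU, hEY, hYc, hYs⟩ : ∃ Y ⊆ U, (c.EA ∪ c.EB) ∩ U ⊆ Y ∧
      Y.card ≤ 4 * (c.EA ∪ c.EB).card ∧ Strong r (W i₀ ∪ Y) := by
    have hK := hW.strong i₀ (S.not_done hbig₀)
    have hcard := Finset.card_le_card (Finset.inter_subset_left (s₁ := c.EA ∪ c.EB) (s₂ := U))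
    by_cases hE : (c.EA ∪ c.EB).Nonempty
    · have hflag : c.flag := by
        obtain ⟨v, hv⟩ := hE
        rcases Finset.mem_union.1 hv with hv | hv
        · exact c.sideA.E_flag ⟨v, hv⟩
        · exact c.sideB.E_flag ⟨v, hv⟩
      have hsplit : ∀ v, v ∈ U → v ∉ (c.EA ∪ c.EB) ∩ U → v ∈ c.D ∧ v ∉ c.EA ∧ v ∉ c.EB := by
        intro v hv hvE
        rw [Finset.mem_inter, Finset.mem_union] at hvE
        exact ⟨hUD hv, by tauto⟩
      obtain ⟨Y, h1, h2, h3, h4⟩ := exists_rescue hUs hK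
        (Finset.inter_subset_right (s₁ := c.EA ∪ c.EB)) (fun v hv hvE => by
          obtain ⟨h1, h2, h3⟩ := hsplit v hv hvE
          obtain ⟨a, ha, hav⟩ := c.sideA.star_dom hflag v h1 h2
          exact ⟨a, hA ha, hav⟩) (fun v hv hvE => by
          obtain ⟨h1, h2, h3⟩ := hsplit v hv hvE
          obtain ⟨b, hb, hbv⟩ := c.sideB.star_dom hflag v h1 h3
          exact ⟨b, hB hb, hbv⟩) (by
          by_contra hcon
          push Not at hcon
          have h1 := hW.card_biUnion_le hsum hh hsz
          have h2 : Finset.univ \ Finset.univ.biUnion W ⊆ c.EA ∪ c.EB := by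
            intro v hv
            refine (Finset.mem_inter.1 (hcon v ((hU v).2 fun i hi => ?_))).1
            exact (Finset.mem_sdiff.1 hv).2 (Finset.mem_biUnion.2 ⟨i, Finset.mem_univ i, hi⟩)
          have h3 := Finset.card_le_card h2
          rw [Finset.card_univ_sdiff] at h3
          have h4 := Finset.single_le_sum (fun i _ => Nat.zero_le (ℓ i)) (Finset.mem_univ i₀)
          rw [hsum] at h4
          omega)
      exact ⟨Y, h1, h2, h3.trans (by omega), h4⟩
    · rw [Finset.not_nonempty_iff_eq_empty] at hE
      exact ⟨∅, by simp, by simp [hE], by simp, by simpa using hK⟩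
  have hne : ∀ i, i ≠ i₀ → Function.update W i₀ (W i₀ ∪ Y) i = W i := fun i hi =>
    Function.update_of_ne hi _ _
  have heq : Function.update W i₀ (W i₀ ∪ Y) i₀ = W i₀ ∪ Y := Function.update_self _ _ _
  have hWY : ∀ i, Disjoint Y (W i) := fun i =>
    Finset.disjoint_left.2 fun v hv hvi => (hU v).1 (hYU hv) i hvi
  have hsub : ∀ i, W i ⊆ Function.update W i₀ (W i₀ ∪ Y) i := by
    intro i
    by_cases hi : i = i₀
    · rw [hi, heq]
      exact Finset.subset_union_left
    · rw [hne i hi]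
  refine ⟨Function.update W i₀ (W i₀ ∪ Y), ⟨fun i => (hW.sub i).trans (hsub i), ?_, ?_, ?_⟩, ?_, ?_⟩
  · intro i j hij
    by_cases hi : i = i₀
    · have hj : j ≠ i₀ := fun hj => hij (hi.trans hj.symm)
      rw [hi, heq, hne j hj, Finset.disjoint_union_left]
      exact ⟨hW.disj i₀ j hj.symm, hWY j⟩
    · by_cases hj : j = i₀
      · rw [hj, heq, hne i hi, Finset.disjoint_union_right]
        exact ⟨hW.disj i i₀ hi, (hWY i).symm⟩
      · rw [hne i hi, hne j hj]
        exact hW.disj i j hij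
  · intro i hi
    by_cases hi' : i = i₀
    · rw [hi', heq]
      exact hYs
    · rw [hne i hi']
      exact hW.strong i hi
  · intro i hi
    rw [hne i (fun hi' => by rw [hi'] at hi; omega)]
    exact hW.tiny i hi
  · intro i hi
    by_cases hi' : i = i₀
    · rw [hi', heq]
      have := Finset.card_union_le (W i₀) Y
      omega
    · rw [hne i hi']
      exact hsz i hi
  · intro v hv
    have hvU : v ∈ U := (hU v).2 fun i hi => hv i (hsub i hi)
    have hvY : v ∉ Y := fun h => hv i₀ (by rw [heq]; exact Finset.mem_union_right _ h)
    have hvE : v ∉ c.EA ∪ c.EB := fun h => hvY (hEY (Finset.mem_inter.2 ⟨h, hvU⟩))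
    rw [Finset.mem_union, not_or] at hvE
    exact ⟨hUD hvU, hvE⟩

end Start

end CyclePartition

namespace CyclePartition

open scoped Classical

variable {V : Type*} [Fintype V]
variable {r : V → V → Prop} {t : ℕ} {X : Fin t → V}

section

variable {c : Config r X} {ρ : Reserve c} {ℓ : Fin t → ℕ} {h : ℕ}

namespace Start

lemma Grow.exists_coloring {S : Start ρ ℓ h} {W : Fin t → Finset V} (hW : S.Grow W)
    (hsum : ∑ i, ℓ i = Fintype.card V) (ht : 1 ≤ t)
    (hn : 10 ^ 50 * t < Fintype.card V) (hh : h * (10 ^ 40 * t) ≤ Fintype.card V)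
    (hbig : ∀ i, 1000 * h ≤ ℓ i → 10 * (W i).card ≤ ℓ i)
    {F : Finset V} (hF : ∀ v, v ∈ F ↔ ∀ i, v ∉ W i)
    (hcov : ∀ v ∈ F, v ∈ c.D ∧ v ∉ c.EA ∧ v ∉ c.EB) (hle : ∀ i, (W i).card ≤ ℓ i) :
    ∃ col : V → Fin t, (∀ v ∈ F, (∃ z ∈ W (col v), r z v) ∧ ∃ z ∈ W (col v), r v z) ∧
      ∀ i, (F.filter (fun v => col v = i)).card = ℓ i - (W i).card := by
  have : Nonempty (Fin t) := ⟨⟨0, ht⟩⟩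
  have hFc : F.card + (Finset.univ.biUnion W).card = Fintype.card V := by
    have : F = (Finset.univ.biUnion W)ᶜ := by
      ext v
      simp [hF]
    rw [this]
    exact Finset.card_compl_add_card _
  have hWc : (Finset.univ.biUnion W).card = ∑ i, (W i).card :=
    Finset.card_biUnion fun i _ j _ hij => hW.disj i j hij
  have h89 := hW.card_biUnion_le hsum hh hbig
  have hd : ∑ i, (ℓ i - (W i).card) = F.card := by
    have h1 : ∑ i, (ℓ i - (W i).card) + ∑ i, (W i).card = ∑ i, ℓ i := by
      rw [← Finset.sum_add_distrib]
      exact Finset.sum_congr rfl fun i _ => Nat.sub_add_cancel (hle i)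
    omega
  refine (exists_exact_coloring F (fun i => ℓ i - (W i).card)
    (fun v i => (∃ z ∈ W i, r z v) ∧ ∃ z ∈ W i, r v z) hd ?_ ?_).imp
    fun col hc => ⟨hc.1, fun i => by convert hc.2 i⟩
  · intro v hv
    obtain ⟨hvD, hvA, hvB⟩ := hcov v hv
    set s : Finset (Fin t) :=
      Finset.univ.filter (fun i => (∃ z ∈ W i, r z v) ∧ ∃ z ∈ W i, r v z) with hs
    have h1 : 100 * ∑ i ∈ sᶜ, ℓ i ≤ 41 * Fintype.card V := by
      refine S.sum_bad_le (by omega) ht hh hvD hvA hvD hvA hvD hvB hvD hvB ?_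
      intro i hi _ h1 _ h3 _
      rw [Finset.mem_compl, hs, Finset.mem_filter] at hi
      exact hi ⟨Finset.mem_univ i, h1.imp fun z hz => ⟨hW.sub i hz.1, hz.2⟩,
        h3.imp fun z hz => ⟨hW.sub i hz.1, hz.2⟩⟩
    have h2 := Finset.sum_add_sum_compl s (fun i => ℓ i - (W i).card)
    have h3 : ∑ i ∈ sᶜ, (ℓ i - (W i).card) ≤ ∑ i ∈ sᶜ, ℓ i :=
      Finset.sum_le_sum fun i _ => Nat.sub_le _ _
    rw [hd] at h2
    have h4 : F.card ≤ 2 * ∑ i ∈ s, (ℓ i - (W i).card) := by omega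
    convert h4 using 2
    rw [hs]
    congr
  · intro i hi
    have hnd : ¬ S.done i := by
      intro hdone
      rw [hW.tiny i (S.done_lt i hdone), (S.done_cyc i hdone).1] at hi
      simp at hi
    have hJ : (S.J i).Nonempty := by
      rw [← Finset.card_pos, S.J_card, demand]
      split_ifs <;> positivity
    obtain ⟨b, hb⟩ := hJ
    have hbS := S.J_sub i hb
    obtain ⟨hA, hB⟩ := S.sub i hnd b hb
    have h1 := c.sideA.undom_le _ (S.tgt_mem b hbS)
    have h2 := c.sideB.undom_le b hbS
    have h3 := (Finset.card_le_card (show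
        F.filter (fun v => ¬ ((∃ z ∈ W i, r z v) ∧ ∃ z ∈ W i, r v z)) ⊆
          undom r c.D (c.A (S.tgt b)) ∪ undom (Function.swap r) c.D (c.B b) from fun v hv => by
      obtain ⟨hv, hbad⟩ := Finset.mem_filter.1 hv
      rw [Finset.mem_union, mem_undom, mem_undom]
      by_contra hcon
      rw [not_or] at hcon
      have hvD := (hcov v hv).1
      refine hbad ⟨?_, ?_⟩
      · by_contra hno
        exact hcon.1 ⟨hvD, fun a ha hav => hno ⟨a, hW.sub i (hA ha), hav⟩⟩
      · by_contra hno
        exact hcon.2 ⟨hvD, fun a ha hav => hno ⟨a, hW.sub i (hB ha), hav⟩⟩)).trans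
      (Finset.card_union_le _ _)
    have h4 : 2 * (F.filter (fun v => ¬ ((∃ z ∈ W i, r z v) ∧ ∃ z ∈ W i, r v z))).card ≤
        F.card := by
      omega
    convert h4 using 2
    congr

lemma exists_cycles (S : Start ρ ℓ h) (hT : Tourn r) (hℓ : ∀ i, 3 ≤ ℓ i)
    (hsum : ∑ i, ℓ i = Fintype.card V) (ht : 1 ≤ t)
    (hn : 10 ^ 50 * t < Fintype.card V) (hh0 : 10 ^ 10 ≤ h)
    (hh : h * (10 ^ 40 * t) ≤ Fintype.card V) :
    ∃ C : Fin t → Finset V, (∀ i j, i ≠ j → Disjoint (C i) (C j)) ∧ (∀ v, ∃ i, v ∈ C i) ∧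
      ∀ i, X i ∈ C i ∧ (C i).card = ℓ i ∧ Cyc r (C i) := by
  obtain ⟨W, hW, hbig, hcov⟩ := S.exists_cover hsum ht hn hh0 hh
  obtain ⟨F, hF⟩ : ∃ F : Finset V, ∀ v, v ∈ F ↔ ∀ i, v ∉ W i :=
    ⟨Finset.univ.filter (fun v => ∀ i, v ∉ W i), by simp⟩
  have hle : ∀ i, (W i).card ≤ ℓ i := by
    intro i
    rcases lt_or_ge (ℓ i) (1000 * h) with hlt | hge
    · rw [hW.tiny i hlt]
      exact S.card_lt i hlt
    · have := hbig i hge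
      omega
  obtain ⟨col, hcol, hcard⟩ := hW.exists_coloring hsum ht hn hh hbig hF
    (fun v hv => hcov v ((hF v).1 hv)) hle
  have hdis : ∀ i j, Disjoint (W i) (F.filter (fun v => col v = j)) := fun i j =>
    Finset.disjoint_left.2 fun v hv hvF => (hF v).1 (Finset.mem_filter.1 hvF).1 i hv
  have hCcard : ∀ i, (W i ∪ F.filter (fun v => col v = i)).card = ℓ i := by
    intro i
    rw [Finset.card_union_of_disjoint (hdis i i), hcard]
    have := hle i
    omega
  refine ⟨fun i => W i ∪ F.filter (fun v => col v = i), ?_, ?_, fun i => ⟨?_, hCcard i, ?_⟩⟩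
  · intro i j hij
    rw [Finset.disjoint_union_left, Finset.disjoint_union_right, Finset.disjoint_union_right]
    refine ⟨⟨hW.disj i j hij, hdis i j⟩, (hdis j i).symm, Finset.disjoint_left.2 fun v hv hv' => ?_⟩
    exact hij ((Finset.mem_filter.1 hv).2.symm.trans (Finset.mem_filter.1 hv').2)
  · intro v
    by_cases hv : v ∈ F
    · exact ⟨col v, Finset.mem_union_right _ (Finset.mem_filter.2 ⟨hv, rfl⟩)⟩
    · rw [hF] at hv
      push Not at hv
      obtain ⟨i, hi⟩ := hv
      exact ⟨i, Finset.mem_union_left _ hi⟩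
  · exact Finset.mem_union_left _ (hW.sub i (S.mem i))
  · by_cases hd : S.done i
    · have h1 : W i = S.W i := hW.tiny i (S.done_lt i hd)
      have h2 : W i ∪ F.filter (fun v => col v = i) = W i := by
        refine (Finset.eq_of_subset_of_card_le Finset.subset_union_left ?_).symm
        rw [hCcard, h1, (S.done_cyc i hd).1]
      beta_reduce
      rw [h2, h1]
      exact (S.done_cyc i hd).2
    · refine (strong_attach (hW.strong i hd) fun v hv => ?_).cyc hT (by rw [hCcard]; exact hℓ i)
      obtain ⟨hv', rfl⟩ := Finset.mem_filter.1 hv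
      exact hcol v hv'

end Start

end

/-- A highly connected tournament can be partitioned into cycles of prescribed lengths through
prescribed vertices. -/
theorem exists_cycle_partition (hT : Tourn r) {ℓ : Fin t → ℕ} (hℓ : ∀ i, 3 ≤ ℓ i)
    (hX : Function.Injective X) (hsum : ∑ i, ℓ i = Fintype.card V) (ht : 1 ≤ t)
    (hn : 10 ^ 50 * t < Fintype.card V) (hconn : KC r Finset.univ (10 ^ 50 * t)) :
    ∃ C : Fin t → Finset V, (∀ i j, i ≠ j → Disjoint (C i) (C j)) ∧ (∀ v, ∃ i, v ∈ C i) ∧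
      ∀ i, X i ∈ C i ∧ (C i).card = ℓ i ∧ Cyc r (C i) := by
  obtain ⟨c⟩ := exists_config hT ht X hconn hn
  obtain ⟨ρ⟩ := c.exists_reserve ht
  set h := Fintype.card V / (10 ^ 40 * t) with hdef
  have hpos : 0 < 10 ^ 40 * t := by positivity
  have hh : h * (10 ^ 40 * t) ≤ Fintype.card V := Nat.div_mul_le_self _ _
  have hh' : Fintype.card V < (h + 1) * (10 ^ 40 * t) := by
    rw [mul_comm]
    exact Nat.lt_mul_div_succ _ hpos
  have hh0 : 10 ^ 10 ≤ h := by
    rw [hdef, Nat.le_div_iff_mul_le hpos]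
    omega
  obtain ⟨S⟩ := exists_start ρ hT hℓ hX hsum ht hn hconn hh0 hh hh'
  exact S.exists_cycles hT hℓ hsum ht hn hh0 hh

end CyclePartition

namespace CyclePartition

variable {V : Type}

lemma Tourn.of_isTournament {T : Digr V} (hT : T.IsTournament) : Tourn T.Adj where
  irrefl := hT.1
  total a b h := by
    rw [hT.2 a b h]
    exact (em _).symm
  asymm a b h := by
    have hne : a ≠ b := by
      rintro rfl
      exact hT.1 _ h
    exact (hT.2 a b hne).1 h

lemma Rch.of_isChain {r : V → V → Prop} {W : Finset V} {v : V} :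
    ∀ (l : List V) (u : V), List.IsChain r (u :: l) → (∀ x ∈ u :: l, x ∈ W) →
      (u :: l).getLast? = some v → Rch r W u v
  | [], u, _, _, hl => by
    obtain rfl : u = v := by simpa using hl
    exact Rch.refl u
  | b :: l, u, hc, hW, hl => by
    rw [List.isChain_cons_cons] at hc
    have hW' : ∀ x ∈ b :: l, x ∈ W := fun x hx => hW x (List.mem_cons_of_mem u hx)
    exact (Rch.single hc.1 (hW u List.mem_cons_self) (hW' b List.mem_cons_self)).trans
      (of_isChain l b hc.2 hW' (by simpa using hl))

open scoped Classical in
lemma KC.of_stronglyConnOn [Fintype V] {T : Digr V} {k : ℕ}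
    (h : T.StronglyConnOn Set.univ k) : KC T.Adj Finset.univ k := by
  intro S hS u hu v hv
  by_cases huv : u = v
  · rw [huv]
    exact Rch.refl v
  obtain ⟨l, -, hc, hm, hhead, hlast⟩ := h.2 u (Set.mem_univ u) v (Set.mem_univ v) huv (S : Set V)
    (fun x hx => ⟨Set.mem_univ x, by
      rintro (rfl | rfl)
      · exact (Finset.mem_sdiff.1 hu).2 hx
      · exact (Finset.mem_sdiff.1 hv).2 hx⟩) (by rwa [Set.ncard_coe_finset])
  cases l with
  | nil => simp at hhead
  | cons a l =>
    obtain rfl : a = u := by simpa using hhead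
    exact Rch.of_isChain l a hc (fun x hx => Finset.mem_sdiff.2 ⟨Finset.mem_univ x, (hm x hx).2⟩)
      hlast

lemma Cyc.exists_isCycleOn {T : Digr V} {C : Finset V} (h : Cyc T.Adj C) :
    ∃ l, T.IsCycleOn (C : Set V) l := by
  obtain ⟨y, l, hlen, hnd, hmem, hc⟩ := h
  rw [← List.cons_append] at hc
  obtain ⟨h1, -, h2⟩ := List.isChain_append.1 hc
  have hne : y :: l ≠ [] := List.cons_ne_nil y l
  exact ⟨y :: l, by simpa using hlen, hnd, hmem, h1, (y :: l).getLast hne, y,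
    List.getLast?_eq_some_getLast hne, rfl,
    h2 _ (List.getLast?_eq_some_getLast hne) y rfl⟩

end CyclePartition

/-- **Theorem 1.1.** Every strongly `10⁵⁰ t`-connected `n`-vertex tournament contains,
for any lengths `ℓ₁,…,ℓ_t ≥ 3` summing to `n` and any distinct vertices `x₁,…,x_t`,
pairwise vertex-disjoint cycles `C₁,…,C_t` with `x_i ∈ V(C_i)` and `|V(C_i)| = ℓ_i`
(so the cycles partition the vertex set). -/
theorem stmt0 {V : Type} [Fintype V] (n t : ℕ) (ℓ : Fin t → ℕ)
    (hℓ : ∀ i, 3 ≤ ℓ i) (hsum : ∑ i, ℓ i = n)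
    (T : Digr V) (hT : T.IsTournament) (hn : Fintype.card V = n)
    (hconn : T.StronglyConnOn Set.univ (10 ^ 50 * t))
    (x : Fin t → V) (hx : Function.Injective x) :
    ∃ C : Fin t → Set V,
      (∀ i j, i ≠ j → Disjoint (C i) (C j)) ∧
      (⋃ i, C i) = Set.univ ∧
      ∀ i, x i ∈ C i ∧ (C i).ncard = ℓ i ∧ ∃ l, T.IsCycleOn (C i) l := by
  classical
  have hcard : 10 ^ 50 * t < Fintype.card V := by
    have := hconn.1
    rw [Set.ncard_univ, Nat.card_eq_fintype_card] at this
    omega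
  have ht : 1 ≤ t := by
    rcases Nat.eq_zero_or_pos t with rfl | h
    · simp at hsum
      omega
    · exact h
  obtain ⟨C, hdis, hcov, hC⟩ := CyclePartition.exists_cycle_partition
    (CyclePartition.Tourn.of_isTournament hT) hℓ hx (hsum.trans hn.symm) ht hcard
    (CyclePartition.KC.of_stronglyConnOn hconn)
  refine ⟨fun i => (C i : Set V), fun i j hij => Finset.disjoint_coe.2 (hdis i j hij), ?_,
    fun i => ⟨(hC i).1, ?_, (hC i).2.2.exists_isCycleOn⟩⟩
  · ext v
    simpa using hcov v
  · rw [Set.ncard_coe_finset]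
    exact (hC i).2.1
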